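/- Let Ω be a quaternionic hyperconvex domain in ℍⁿ. For every φ ∈ PSH⁻(Ω) there is a decreasing sequence {φ_j} of PSH functions such that each φ_j is continuous on the closure of Ω with φ_j = 0 on ∂Ω, the support of (△φ_j)ⁿ is relatively compact in Ω for each j, and φ_j(q) → φ(q) for every q ∈ Ω as j → ∞. -/

import Mathlib

/- ## Preliminaries: quaternionic pluripotential theory -/

open MeasureTheory Filter Topology
open scoped Quaternion ENNReal

noncomputable section

/-- Borel measurable structure on the quaternions. -/
instance : MeasurableSpace ℍ := borel ℍ
instance : BorelSpace ℍ := ⟨rfl⟩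

/-- Lebesgue measure on the quaternions, transported from `ℝ⁴`. -/
instance : MeasureSpace ℍ :=
  ⟨Measure.map Quaternion.linearIsometryEquivTuple.symm volume⟩

instance : SigmaFinite (volume : Measure ℍ) := by
  have h : (volume : Measure ℍ) =
      Measure.map
        (Quaternion.linearIsometryEquivTuple.toHomeomorph.symm.toMeasurableEquiv) volume := rfl
  rw [h]
  exact MeasurableEquiv.sigmaFinite_map _

/-- `n`-dimensional quaternionic space `ℍⁿ`. -/
abbrev Hn (n : ℕ) := Fin n → ℍ

/-! ### Subharmonic and quaternionic plurisubharmonic functions -/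

/-- Second directional derivative. -/
def secondDeriv (h : ℍ → ℝ) (x v : ℍ) : ℝ :=
  fderiv ℝ (fun y => fderiv ℝ h y v) x v

/-- The Laplacian on `ℍ ≅ ℝ⁴`. -/
def lapQ (h : ℍ → ℝ) (x : ℍ) : ℝ :=
  secondDeriv h x 1 + secondDeriv h x ⟨0, 1, 0, 0⟩ +
    secondDeriv h x ⟨0, 0, 1, 0⟩ + secondDeriv h x ⟨0, 0, 0, 1⟩

/-- A real-valued function is harmonic on a set if it is `C²` there with vanishing
Laplacian. -/
def HarmonicOnQ (h : ℍ → ℝ) (s : Set ℍ) : Prop :=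
  ContDiffOn ℝ 2 h s ∧ ∀ x ∈ s, lapQ h x = 0

/-- A `[-∞,∞)`-valued function is subharmonic on `s ⊆ ℍ ≅ ℝ⁴` (in the usual sense) if it is
upper semicontinuous and lies below every harmonic majorant on closed balls. -/
def SubharmonicOn (u : ℍ → EReal) (s : Set ℍ) : Prop :=
  UpperSemicontinuousOn u s ∧ (∀ x ∈ s, u x ≠ ⊤) ∧
  ∀ (x : ℍ) (r : ℝ), 0 < r → Metric.closedBall x r ⊆ s →
    ∀ h : ℍ → ℝ, ContinuousOn h (Metric.closedBall x r) →
      HarmonicOnQ h (Metric.ball x r) →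
      (∀ y ∈ Metric.sphere x r, u y ≤ (h y : EReal)) →
      ∀ y ∈ Metric.closedBall x r, u y ≤ (h y : EReal)

/-- The right quaternionic line through `a` with direction `b`. -/
def qLine {n : ℕ} (a b : Hn n) (t : ℍ) : Hn n := fun k => a k + b k * t

/-- A `[-∞,∞)`-valued function is quaternionic plurisubharmonic on `Ω` if it is upper
semicontinuous on `Ω` and its restriction to every right quaternionic line is subharmonic. -/
def QPSH {n : ℕ} (u : Hn n → EReal) (Ω : Set (Hn n)) : Prop :=
  UpperSemicontinuousOn u Ω ∧ (∀ q ∈ Ω, u q ≠ ⊤) ∧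
  ∀ a b : Hn n, SubharmonicOn (fun t => u (qLine a b t)) {t : ℍ | qLine a b t ∈ Ω}

/-- Quaternionic plurisubharmonicity for real-valued functions. -/
def QPSHr {n : ℕ} (u : Hn n → ℝ) (Ω : Set (Hn n)) : Prop :=
  QPSH (fun q => (u q : EReal)) Ω

/-- A quaternionic hyperconvex domain: open, bounded, connected, admitting a negative
plurisubharmonic exhaustion function. -/
def QHyperconvex {n : ℕ} (Ω : Set (Hn n)) : Prop :=
  IsOpen Ω ∧ Bornology.IsBounded Ω ∧ IsConnected Ω ∧
  ∃ ρ : Hn n → EReal, QPSH ρ Ω ∧ (∀ q ∈ Ω, ρ q < 0) ∧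
    ∀ c : ℝ, c < 0 →
      IsCompact (closure {q | q ∈ Ω ∧ ρ q < (c : EReal)}) ∧
      closure {q | q ∈ Ω ∧ ρ q < (c : EReal)} ⊆ Ω

/-! ### The quaternionic Monge–Ampère operator on smooth functions -/

/-- The four quaternionic units. -/
def unitQ : Fin 4 → ℍ
  | 0 => 1
  | 1 => ⟨0, 1, 0, 0⟩
  | 2 => ⟨0, 0, 1, 0⟩
  | 3 => ⟨0, 0, 0, 1⟩

/-- The coordinate direction `x_{4l+m}` in `ℍⁿ ≅ ℝ^{4n}`. -/
def dirQ {n : ℕ} (l : Fin n) (m : Fin 4) : Hn n := fun k => if k = l then unitQ m else 0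

/-- Real partial derivative of a complex-valued function in the direction `v`. -/
def pdQ {n : ℕ} (v : Hn n) (f : Hn n → ℂ) (q : Hn n) : ℂ := fderiv ℝ f q v

/-- The first-order differential operators `∇_{jα}`, `j < 2n`, `α < 2`. -/
def nablaQ {n : ℕ} (j : Fin (2 * n)) (α : Fin 2) (f : Hn n → ℂ) (q : Hn n) : ℂ :=
  let l : Fin n := ⟨j.val / 2, by omega⟩
  if j.val % 2 = 0 then
    (if α = 0 then pdQ (dirQ l 0) f q + Complex.I * pdQ (dirQ l 1) f q
     else - pdQ (dirQ l 2) f q - Complex.I * pdQ (dirQ l 3) f q)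
  else
    (if α = 0 then pdQ (dirQ l 2) f q - Complex.I * pdQ (dirQ l 3) f q
     else pdQ (dirQ l 0) f q - Complex.I * pdQ (dirQ l 1) f q)

/-- The Baston coefficients `Δ_{ij} u = ½(∇_{i0}∇_{j1}u − ∇_{i1}∇_{j0}u)`. -/
def bastonQ {n : ℕ} (i j : Fin (2 * n)) (u : Hn n → ℝ) (q : Hn n) : ℂ :=
  (1 / 2 : ℂ) * (nablaQ i 0 (fun x => nablaQ j 1 (fun y => (u y : ℂ)) x) q -
    nablaQ i 1 (fun x => nablaQ j 0 (fun y => (u y : ℂ)) x) q)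

/-- The coefficients of `γ(u,v) = ½(d₀u∧d₁v − d₁u∧d₀v)`. -/
def gammaQ {n : ℕ} (i j : Fin (2 * n)) (u v : Hn n → ℝ) (q : Hn n) : ℂ :=
  (1 / 2 : ℂ) * (nablaQ i 0 (fun y => (u y : ℂ)) q * nablaQ j 1 (fun y => (v y : ℂ)) q -
    nablaQ i 1 (fun y => (u y : ℂ)) q * nablaQ j 0 (fun y => (v y : ℂ)) q)

/-- The sign `δ^{i₁j₁…iₙjₙ}_{01…(2n-1)}` of a (possibly non-bijective) index assignment. -/
def permSignC {m : ℕ} (f : Fin m → Fin m) : ℂ :=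
  if h : Function.Bijective f then ((Equiv.Perm.sign (Equiv.ofBijective f h) : ℤ) : ℂ) else 0

/-- Flattening of `(i₁,j₁,…,iₙ,jₙ)` into a self-map of `Fin (2n)`. -/
def flattenQ {n : ℕ} (σ : Fin n → Fin (2 * n) × Fin (2 * n)) : Fin (2 * n) → Fin (2 * n) :=
  fun j => if j.val % 2 = 0 then (σ ⟨j.val / 2, by omega⟩).1 else (σ ⟨j.val / 2, by omega⟩).2

/-- Density of the mixed quaternionic Monge–Ampère form
`△u₁∧…∧△uₙ = (∑ δ…Δ_{i₁j₁}u₁⋯Δ_{iₙjₙ}uₙ) Ω_{2n}` of smooth functions. -/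
def maDensity {n : ℕ} (us : Fin n → (Hn n → ℝ)) (q : Hn n) : ℝ :=
  (∑ σ : Fin n → Fin (2 * n) × Fin (2 * n),
    permSignC (flattenQ σ) * ∏ k : Fin n, bastonQ (σ k).1 (σ k).2 (us k) q).re

/-- Density of `γ(u,v)∧△w₁∧…∧△wₘ` for smooth functions on `ℍ^{m+1}`. -/
def gammaDensity {m : ℕ} (u v : Hn (m + 1) → ℝ) (ws : Fin m → (Hn (m + 1) → ℝ))
    (q : Hn (m + 1)) : ℝ :=
  (∑ σ : Fin (m + 1) → Fin (2 * (m + 1)) × Fin (2 * (m + 1)),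
    permSignC (flattenQ σ) *
      (gammaQ (σ 0).1 (σ 0).2 u v q *
        ∏ k : Fin m, bastonQ (σ k.succ).1 (σ k.succ).2 (ws k) q)).re

/-- The mixed Monge–Ampère measure of smooth functions on `U`. -/
def smoothMA {n : ℕ} (us : Fin n → (Hn n → ℝ)) (U : Set (Hn n)) : Measure (Hn n) :=
  (volume.restrict U).withDensity fun q => ENNReal.ofReal (maDensity us q)

/-! ### Weak convergence and the Bedford–Taylor extension to locally bounded PSH functions -/

/-- Weak convergence of measures against continuous test functions compactly supported in `Ω`. -/
def TendstoWeaklyOn {n : ℕ} (μs : ℕ → Measure (Hn n)) (μ : Measure (Hn n))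
    (Ω : Set (Hn n)) : Prop :=
  ∀ f : Hn n → ℝ, Continuous f → HasCompactSupport f → tsupport f ⊆ Ω →
    Tendsto (fun j => ∫ q, f q ∂(μs j)) atTop (𝓝 (∫ q, f q ∂μ))

/-- `μ` is the mixed Monge–Ampère measure `△u₁∧…∧△uₙ` of the locally bounded
plurisubharmonic functions `us` on `Ω`: on every relatively compact open subset it is the
weak limit of the Monge–Ampère measures of smooth plurisubharmonic functions decreasing
to the `us`. -/
def IsMixedMA {n : ℕ} (Ω : Set (Hn n)) (us : Fin n → (Hn n → ℝ)) (μ : Measure (Hn n)) : Prop :=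
  (∀ U : Set (Hn n), IsOpen U → IsCompact (closure U) → closure U ⊆ Ω →
    ∀ fs : Fin n → ℕ → (Hn n → ℝ),
      (∀ k j, ContDiff ℝ (⊤ : ℕ∞) (fs k j) ∧ QPSHr (fs k j) U) →
      (∀ k, ∀ q ∈ U, Antitone fun j => fs k j q) →
      (∀ k, ∀ q ∈ U, Tendsto (fun j => fs k j q) atTop (𝓝 (us k q))) →
      TendstoWeaklyOn (fun j => smoothMA (fun k => fs k j) U) (μ.restrict U) U) ∧
  μ Ωᶜ = 0 ∧ ∀ K : Set (Hn n), IsCompact K → K ⊆ Ω → μ K < ⊤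

/-- The mixed Monge–Ampère measure of locally bounded plurisubharmonic functions. -/
def MAmix {n : ℕ} (Ω : Set (Hn n)) (us : Fin n → (Hn n → ℝ)) : Measure (Hn n) :=
  open Classical in
  if h : ∃ μ : Measure (Hn n), IsMixedMA Ω us μ then h.choose else 0

/-- The Monge–Ampère measure `(△u)ⁿ` of a locally bounded plurisubharmonic function. -/
def MAn {n : ℕ} (Ω : Set (Hn n)) (u : Hn n → ℝ) : Measure (Hn n) :=
  MAmix Ω fun _ => u

/-! ### The Cegrell classes -/

/-- Boundary limit zero. -/
def ZeroBdry {n : ℕ} (Ω : Set (Hn n)) (φ : Hn n → ℝ) : Prop :=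
  ∀ ζ ∈ frontier Ω, Tendsto φ (𝓝[Ω] ζ) (𝓝 0)

/-- The class `E₀(Ω)` of bounded negative plurisubharmonic functions with zero boundary
values and finite total Monge–Ampère mass. -/
def InE0 {n : ℕ} (Ω : Set (Hn n)) (φ : Hn n → ℝ) : Prop :=
  QPSHr φ Ω ∧ (∀ q ∈ Ω, φ q ≤ 0) ∧ (∃ M : ℝ, ∀ q ∈ Ω, |φ q| ≤ M) ∧
    ZeroBdry Ω φ ∧ MAn Ω φ Ω < ⊤

/-- `g` is a sequence decreasing pointwise on `Ω` to the `[-∞,∞)`-valued function `u`. -/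
def DecTo {n : ℕ} (Ω : Set (Hn n)) (g : ℕ → Hn n → ℝ) (u : Hn n → EReal) : Prop :=
  (∀ q ∈ Ω, Antitone fun j => g j q) ∧
  ∀ q ∈ Ω, Tendsto (fun j => ((g j q : ℝ) : EReal)) atTop (𝓝 (u q))

/-- The class `F(Ω)`. -/
def InF {n : ℕ} (Ω : Set (Hn n)) (u : Hn n → EReal) : Prop :=
  QPSH u Ω ∧ (∀ q ∈ Ω, u q ≤ 0) ∧
  ∃ g : ℕ → Hn n → ℝ, (∀ j, InE0 Ω (g j)) ∧ DecTo Ω g u ∧ (⨆ j, MAn Ω (g j) Ω) < ⊤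

/-- The class `E(Ω)`. -/
def InE {n : ℕ} (Ω : Set (Hn n)) (u : Hn n → EReal) : Prop :=
  QPSH u Ω ∧ (∀ q ∈ Ω, u q ≤ 0) ∧
  ∀ K : Set (Hn n), IsCompact K → K ⊆ Ω →
    ∃ uK : Hn n → EReal, InF Ω uK ∧ ∀ q ∈ K, uK q = u q

/-- The `p`-energy `∫_Ω (−φ)^p (△φ)ⁿ` of `φ ∈ E₀(Ω)`. -/
def energyP {n : ℕ} (Ω : Set (Hn n)) (p : ℝ) (φ : Hn n → ℝ) : ℝ≥0∞ :=
  ∫⁻ q in Ω, ENNReal.ofReal ((-φ q) ^ p) ∂(MAn Ω φ)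

/-- The mutual `p`-energy `∫_Ω (−φ₀)^p △φ₁∧…∧△φₙ`. -/
def mutualEnergyP {n : ℕ} (Ω : Set (Hn n)) (p : ℝ) (φ₀ : Hn n → ℝ)
    (φs : Fin n → (Hn n → ℝ)) : ℝ≥0∞ :=
  ∫⁻ q in Ω, ENNReal.ofReal ((-φ₀ q) ^ p) ∂(MAmix Ω φs)

/-- The class `E_p(Ω)`. -/
def InEp {n : ℕ} (Ω : Set (Hn n)) (p : ℝ) (u : Hn n → EReal) : Prop :=
  QPSH u Ω ∧ (∀ q ∈ Ω, u q ≤ 0) ∧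
  ∃ g : ℕ → Hn n → ℝ, (∀ j, InE0 Ω (g j)) ∧ DecTo Ω g u ∧ (⨆ j, energyP Ω p (g j)) < ⊤

/-! ### The Monge–Ampère operator on the Cegrell classes -/

/-- `μ` is the mixed Monge–Ampère measure `△u¹∧…∧△uⁿ` of functions of the Cegrell
classes: the weak limit on `Ω` of the Monge–Ampère measures of any sequences in `E₀(Ω)`
decreasing to the `us`. -/
def IsMAmixCl {n : ℕ} (Ω : Set (Hn n)) (us : Fin n → (Hn n → EReal))
    (μ : Measure (Hn n)) : Prop :=
  (∀ gs : Fin n → ℕ → (Hn n → ℝ), (∀ k j, InE0 Ω (gs k j)) →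
    (∀ k, DecTo Ω (gs k) (us k)) →
    TendstoWeaklyOn (fun j => MAmix Ω fun k => gs k j) μ Ω) ∧
  μ Ωᶜ = 0 ∧ ∀ K : Set (Hn n), IsCompact K → K ⊆ Ω → μ K < ⊤

/-- The mixed Monge–Ampère measure on the Cegrell classes. -/
def MAmixCl {n : ℕ} (Ω : Set (Hn n)) (us : Fin n → (Hn n → EReal)) : Measure (Hn n) :=
  open Classical in
  if h : ∃ μ : Measure (Hn n), IsMAmixCl Ω us μ then h.choose else 0

/-- The Monge–Ampère measure `(△u)ⁿ` on the Cegrell classes. -/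
def MAnCl {n : ℕ} (Ω : Set (Hn n)) (u : Hn n → EReal) : Measure (Hn n) :=
  MAmixCl Ω fun _ => u

/-- `(△u)ⁿ = μ` for `u` in a Cegrell class. -/
def IsMAnCl {n : ℕ} (Ω : Set (Hn n)) (u : Hn n → EReal) (μ : Measure (Hn n)) : Prop :=
  IsMAmixCl Ω (fun _ => u) μ

/-- The `[0,∞]`-valued part of an extended real number. -/
def erealToENN (x : EReal) : ℝ≥0∞ :=
  if x = ⊤ then ⊤ else ENNReal.ofReal x.toReal

/-- The quaternionic energy `E(u) = ∫_Ω (−u)(△u)ⁿ` of `u ∈ E₁(Ω)`. -/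
def energyCl {n : ℕ} (Ω : Set (Hn n)) (u : Hn n → EReal) : ℝ≥0∞ :=
  ∫⁻ q in Ω, erealToENN (-(u q)) ∂(MAnCl Ω u)

/-- A positive measure has finite quaternionic `1`-energy (`μ ∈ M₁`). -/
def InM1 {n : ℕ} (Ω : Set (Hn n)) (μ : Measure (Hn n)) : Prop :=
  ∃ C : ℝ, 0 < C ∧ ∀ u : Hn n → EReal, InEp Ω 1 u →
    (∫⁻ q in Ω, erealToENN (-(u q)) ∂μ) ≤
      ENNReal.ofReal C * (energyCl Ω u) ^ ((1 : ℝ) / (n + 1))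

/-- The energy functional `F_μ(u) = (1/(n+1)) E(u) + ∫_Ω u dμ`. -/
def energyFunc {n : ℕ} (Ω : Set (Hn n)) (μ : Measure (Hn n)) (u : Hn n → EReal) : ℝ :=
  (1 / (n + 1) : ℝ) * (energyCl Ω u).toReal - (∫⁻ q in Ω, erealToENN (-(u q)) ∂μ).toReal

/-- A positive Radon measure in `Ω`. -/
def RadonOn {n : ℕ} (μ : Measure (Hn n)) (Ω : Set (Hn n)) : Prop :=
  μ Ωᶜ = 0 ∧ ∀ K : Set (Hn n), IsCompact K → K ⊆ Ω → μ K < ⊤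

end

noncomputable section

/-! ### Second order Taylor expansion -/

theorem taylor_two_isLittleO {E : Type*} [NormedAddCommGroup E] [NormedSpace ℝ E]
    {f : E → ℝ} {f' : E → E →L[ℝ] ℝ} {H : E →L[ℝ] E →L[ℝ] ℝ} {x : E}
    (hf : ∀ᶠ y in 𝓝 x, HasFDerivAt f (f' y) y) (hH : HasFDerivAt f' H x) {ε : ℝ} (hε : 0 < ε) :
    ∀ᶠ y in 𝓝 x, |f y - f x - f' x (y - x) - (1 / 2) * H (y - x) (y - x)| ≤ ε * ‖y - x‖ ^ 2 := by
  have hsymm : ∀ v w, H v w = H w v := fun v w =>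
    second_derivative_symmetric_of_eventually hf hH v w
  have h1 := hH.isLittleO.def hε
  obtain ⟨r, hr, hball⟩ := Metric.eventually_nhds_iff_ball.1 (hf.and h1)
  filter_upwards [Metric.ball_mem_nhds x hr] with y hy
  have hseg : segment ℝ x y ⊆ Metric.ball x r :=
    (convex_ball x r).segment_subset (Metric.mem_ball_self hr) hy
  set g : E → ℝ := fun z => f z - f x - f' x (z - x) - (1 / 2) * H (z - x) (z - x) with hg
  have hgd : ∀ z ∈ segment ℝ x y,
      HasFDerivWithinAt g (f' z - f' x - H (z - x)) (segment ℝ x y) z := by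
    intro z hz
    have hz' := (hball z (hseg hz)).1
    have hsub : HasFDerivAt (fun z : E => z - x) (ContinuousLinearMap.id ℝ E) z :=
      (hasFDerivAt_id z).sub_const x
    have hb : HasFDerivAt (fun z : E => H (z - x) (z - x))
        ((H (z - x)).comp (ContinuousLinearMap.id ℝ E) +
          (H.comp (ContinuousLinearMap.id ℝ E)).flip (z - x)) z :=
      (H.hasFDerivAt.comp z hsub).clm_apply hsub
    have h3 := ((hz'.sub_const (f x)).sub ((f' x).hasFDerivAt.comp z hsub)).sub
      (hb.const_mul (1 / 2 : ℝ))
    refine (h3.congr_fderiv ?_).hasFDerivWithinAt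
    ext v
    simp only [ContinuousLinearMap.comp_id, sub_apply, smul_apply,
      add_apply, ContinuousLinearMap.flip_apply, smul_eq_mul]
    rw [hsymm v (z - x)]; ring
  have hbd : ∀ z ∈ segment ℝ x y, ‖f' z - f' x - H (z - x)‖ ≤ ε * ‖y - x‖ := by
    intro z hz
    refine ((hball z (hseg hz)).2).trans ?_
    gcongr
    have := mem_segment_iff_wbtw.1 hz
    obtain ⟨t, ht, rfl⟩ := (segment_eq_image' ℝ x y ▸ hz)
    simp only [add_sub_cancel_left, norm_smul, Real.norm_eq_abs, abs_of_nonneg ht.1]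
    exact mul_le_of_le_one_left (norm_nonneg _) ht.2
  have := (convex_segment x y).norm_image_sub_le_of_norm_hasFDerivWithin_le hgd hbd
    (left_mem_segment ℝ x y) (right_mem_segment ℝ x y)
  simp only [hg, sub_self, map_zero, mul_zero, sub_zero, Real.norm_eq_abs] at this
  rw [sq, ← mul_assoc]
  simpa using this

/-- A quadratic upper bound controls the second derivative. -/
theorem second_deriv_le_of_touch {E : Type*} [NormedAddCommGroup E] [NormedSpace ℝ E]
    {f : E → ℝ} {f' : E → E →L[ℝ] ℝ} {H : E →L[ℝ] E →L[ℝ] ℝ} {x : E}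
    (hf : ∀ᶠ y in 𝓝 x, HasFDerivAt f (f' y) y) (hH : HasFDerivAt f' H x) (v : E) (C : ℝ)
    (hC : ∀ᶠ s in 𝓝 (0 : ℝ), f (x + s • v) + f (x - s • v) - 2 * f x ≤ C * s ^ 2) :
    H v v ≤ C := by
  refine le_of_forall_pos_le_add fun δ hδ => ?_
  have hε : 0 < δ / (2 * (‖v‖ ^ 2 + 1)) := by positivity
  have hT := taylor_two_isLittleO hf hH hε
  have c1 : Tendsto (fun s : ℝ => x + s • v) (𝓝 0) (𝓝 x) := by
    have : Continuous fun s : ℝ => x + s • v := by fun_prop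
    simpa using this.tendsto 0
  have c2 : Tendsto (fun s : ℝ => x - s • v) (𝓝 0) (𝓝 x) := by
    have : Continuous fun s : ℝ => x - s • v := by fun_prop
    simpa using this.tendsto 0
  have hall := (hC.and ((c1.eventually hT).and (c2.eventually hT)))
  have hex : ∃ s : ℝ, s ≠ 0 ∧ _ :=
    ((eventually_mem_nhdsWithin (a := (0 : ℝ)) (s := {0}ᶜ)).and
      (hall.filter_mono nhdsWithin_le_nhds)).exists
  obtain ⟨s, hs, h1, h2, h3⟩ := hex
  have hs2 : 0 < s ^ 2 := by positivity
  simp only [add_sub_cancel_left, map_smul, smul_apply, smul_eq_mul, norm_smul,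
    sub_sub_cancel_left, map_neg, neg_apply, norm_neg, Real.norm_eq_abs, mul_pow,
    sq_abs] at h2 h3
  have a2 := (abs_le.1 h2).1
  have a3 := (abs_le.1 h3).1
  have key : s ^ 2 * H v v ≤ s ^ 2 * (C + 2 * (δ / (2 * (‖v‖ ^ 2 + 1)) * ‖v‖ ^ 2)) := by
    nlinarith
  have key2 := le_of_mul_le_mul_left key hs2
  have : 2 * (δ / (2 * (‖v‖ ^ 2 + 1)) * ‖v‖ ^ 2) ≤ δ := by
    rw [show 2 * (δ / (2 * (‖v‖ ^ 2 + 1)) * ‖v‖ ^ 2) = δ * (‖v‖ ^ 2 / (‖v‖ ^ 2 + 1)) by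
      field_simp]
    apply mul_le_of_le_one_right hδ.le
    rw [div_le_one (by positivity)]; linarith
  linarith

/-! ### The Laplacian and the viscosity characterisation of subharmonicity -/

/-- The trace of a bilinear form over the quaternionic units. -/
def traceQ (β : ℍ →L[ℝ] ℍ →L[ℝ] ℝ) : ℝ := ∑ m, β (unitQ m) (unitQ m)

theorem norm_unitQ (m : Fin 4) : ‖unitQ m‖ = 1 := by
  rw [← sq_eq_sq₀ (norm_nonneg _) zero_le_one, sq, ← Quaternion.normSq_eq_norm_mul_self,
    Quaternion.normSq_def']
  fin_cases m <;> simp [unitQ]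

theorem lapQ_eq_traceQ {h : ℍ → ℝ} {h' : ℍ → ℍ →L[ℝ] ℝ} {H : ℍ →L[ℝ] ℍ →L[ℝ] ℝ} {x : ℍ}
    (hh : ∀ᶠ y in 𝓝 x, HasFDerivAt h (h' y) y) (hH : HasFDerivAt h' H x) :
    lapQ h x = traceQ H := by
  have key : ∀ v, secondDeriv h x v = H v v := by
    intro v
    unfold secondDeriv
    have e : (fun y => fderiv ℝ h y v) =ᶠ[𝓝 x] fun y => h' y v := by
      filter_upwards [hh] with y hy
      rw [hy.fderiv]
    rw [e.fderiv_eq]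
    have := hH.clm_apply (hasFDerivAt_const v x)
    rw [this.fderiv]
    simp
  change secondDeriv h x (unitQ 0) + secondDeriv h x (unitQ 1) + secondDeriv h x (unitQ 2) +
    secondDeriv h x (unitQ 3) = _
  rw [key, key, key, key, traceQ, Fin.sum_univ_four]

theorem ContDiffAt.eventually_hasFDerivAt_two {E : Type*} [NormedAddCommGroup E] [NormedSpace ℝ E]
    {f : E → ℝ} {x : E} (hf : ContDiffAt ℝ 2 f x) :
    (∀ᶠ y in 𝓝 x, HasFDerivAt f (fderiv ℝ f y) y) ∧
      HasFDerivAt (fderiv ℝ f) (fderiv ℝ (fderiv ℝ f) x) x := by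
  constructor
  · filter_upwards [hf.eventually (by simp)] with y hy
    exact (hy.differentiableAt (by simp)).hasFDerivAt
  · have : ContDiffAt ℝ 1 (fderiv ℝ f) x := hf.fderiv_right (by norm_num)
    exact (this.differentiableAt (by simp)).hasFDerivAt

theorem lapQ_eq_traceQ_fderiv {h : ℍ → ℝ} {x : ℍ} (hh : ContDiffAt ℝ 2 h x) :
    lapQ h x = traceQ (fderiv ℝ (fderiv ℝ h) x) :=
  lapQ_eq_traceQ hh.eventually_hasFDerivAt_two.1 hh.eventually_hasFDerivAt_two.2

theorem lapQ_sub {h k : ℍ → ℝ} {x : ℍ} (hh : ContDiffAt ℝ 2 h x) (hk : ContDiffAt ℝ 2 k x) :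
    lapQ (fun y => h y - k y) x = lapQ h x - lapQ k x := by
  obtain ⟨h1, h2⟩ := hh.eventually_hasFDerivAt_two
  obtain ⟨k1, k2⟩ := hk.eventually_hasFDerivAt_two
  rw [lapQ_eq_traceQ (h' := fun y => fderiv ℝ h y - fderiv ℝ k y) (by
    filter_upwards [h1, k1] with y a b using a.sub b) (h2.sub k2),
    lapQ_eq_traceQ h1 h2, lapQ_eq_traceQ k1 k2]
  simp [traceQ, Finset.sum_sub_distrib]

/-- The harmonic majorant property on a single closed ball. -/
def MajOn (w : ℍ → ℝ) (x : ℍ) (r : ℝ) : Prop :=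
  ∀ h : ℍ → ℝ, ContinuousOn h (Metric.closedBall x r) → HarmonicOnQ h (Metric.ball x r) →
    (∀ y ∈ Metric.sphere x r, w y ≤ h y) → ∀ y ∈ Metric.closedBall x r, w y ≤ h y

/-- Subharmonicity at a point, in the viscosity sense, tested on quadratic polynomials. -/
def ViscAt (u : ℍ → ℝ) (x : ℍ) : Prop :=
  ∀ (l : ℍ →L[ℝ] ℝ) (β : ℍ →L[ℝ] ℍ →L[ℝ] ℝ),
    (∀ᶠ t in 𝓝 x, u t ≤ u x + l (t - x) + β (t - x) (t - x)) → 0 ≤ traceQ β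

/-- The Euclidean inner product on `ℍ` as a bilinear form. -/
def innerQ : ℍ →L[ℝ] ℍ →L[ℝ] ℝ := innerSL ℝ

theorem innerQ_self (v : ℍ) : innerQ v v = ‖v‖ ^ 2 := real_inner_self_eq_norm_sq v

theorem traceQ_innerQ : traceQ innerQ = 4 := by
  simp [traceQ, innerQ_self, norm_unitQ]

theorem traceQ_add (β γ : ℍ →L[ℝ] ℍ →L[ℝ] ℝ) : traceQ (β + γ) = traceQ β + traceQ γ := by
  simp [traceQ, Finset.sum_add_distrib]

theorem traceQ_smul (c : ℝ) (β : ℍ →L[ℝ] ℍ →L[ℝ] ℝ) : traceQ (c • β) = c * traceQ β := by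
  simp [traceQ, Finset.mul_sum]

theorem hasFDerivAt_quad {E : Type*} [NormedAddCommGroup E] [NormedSpace ℝ E]
    (k : ℝ) (l : E →L[ℝ] ℝ) (β : E →L[ℝ] E →L[ℝ] ℝ) (x y : E) :
    HasFDerivAt (fun t => k + l (t - x) + β (t - x) (t - x)) (l + (β + β.flip) (y - x)) y := by
  have hsub : HasFDerivAt (fun z : E => z - x) (ContinuousLinearMap.id ℝ E) y :=
    (hasFDerivAt_id y).sub_const x
  have h := ((l.hasFDerivAt.comp y hsub).const_add k).add
    ((β.hasFDerivAt.comp y hsub).clm_apply hsub)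
  refine h.congr_fderiv ?_
  ext v
  simp

theorem hasFDerivAt_quad' {E : Type*} [NormedAddCommGroup E] [NormedSpace ℝ E]
    (l : E →L[ℝ] ℝ) (β : E →L[ℝ] E →L[ℝ] ℝ) (x y : E) :
    HasFDerivAt (fun t => l + (β + β.flip) (t - x)) (β + β.flip) y :=
  ((β + β.flip).hasFDerivAt.comp y ((hasFDerivAt_id y).sub_const x)).const_add l

theorem contDiff_quad {E : Type*} [NormedAddCommGroup E] [NormedSpace ℝ E]
    (k : ℝ) (l : E →L[ℝ] ℝ) (β : E →L[ℝ] E →L[ℝ] ℝ) (x : E) {n : WithTop ℕ∞} :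
    ContDiff ℝ n (fun t => k + l (t - x) + β (t - x) (t - x)) := by
  fun_prop

theorem lapQ_quad (k : ℝ) (l : ℍ →L[ℝ] ℝ) (β : ℍ →L[ℝ] ℍ →L[ℝ] ℝ) (x y : ℍ) :
    lapQ (fun t => k + l (t - x) + β (t - x) (t - x)) y = 2 * traceQ β := by
  rw [lapQ_eq_traceQ (Eventually.of_forall fun z => hasFDerivAt_quad k l β x z)
    (hasFDerivAt_quad' l β x y)]
  simp [traceQ, Finset.mul_sum, two_mul]

theorem viscAt_of_majOn {u : ℍ → ℝ} {x : ℍ} {R : ℝ} (hR : 0 < R)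
    (h : ∀ r, 0 < r → r < R → MajOn u x r) : ViscAt u x := by
  intro l β hu
  by_contra! hneg
  obtain ⟨ρ, hρ, hball⟩ := Metric.eventually_nhds_iff_ball.1 hu
  set r := min ρ R / 2 with hr
  have hr0 : 0 < r := by positivity
  have hrR : r < R := by
    have := min_le_right ρ R; linarith [lt_min hρ hR]
  have hrρ : r < ρ := by
    have := min_le_left ρ R; linarith [lt_min hρ hR]
  set c := -traceQ β / 4 with hc
  have hc0 : 0 < c := by rw [hc]; linarith
  have hp := h r hr0 hrR
    (fun t => (u x - c * r ^ 2) + l (t - x) + (β + c • innerQ) (t - x) (t - x))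
    (contDiff_quad (n := 0) _ _ _ _).continuous.continuousOn
    ⟨(contDiff_quad _ _ _ _).contDiffOn, fun y _ => by
      rw [lapQ_quad, traceQ_add, traceQ_smul, traceQ_innerQ, hc]; ring⟩
    (by
      intro y hy
      have hy' : ‖y - x‖ = r := by rwa [mem_sphere_iff_norm] at hy
      have := hball y (by rw [mem_ball_iff_norm, hy']; exact hrρ)
      simp only [add_apply, smul_apply, innerQ_self, hy',
        smul_eq_mul]
      linarith) x (Metric.mem_closedBall_self hr0.le)
  simp only [sub_self, map_zero] at hp
  have : 0 < c * r ^ 2 := by positivity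
  linarith

theorem majOn_of_viscAt {u : ℍ → ℝ} {x : ℍ} {r : ℝ} (hr : 0 < r)
    (hus : UpperSemicontinuousOn u (Metric.closedBall x r))
    (hv : ∀ y ∈ Metric.ball x r, ViscAt u y) : MajOn u x r := by
  intro h hc hh hle
  by_contra! hcon
  obtain ⟨y, hy, hlt⟩ := hcon
  set ε := (u y - h y) / (2 * r ^ 2) with hε
  have hε0 : 0 < ε := by
    have : 0 < u y - h y := by linarith
    positivity
  have hεr : ε * r ^ 2 < u y - h y := by
    rw [hε]; field_simp; linarith
  set G : ℍ → ℝ := fun t => u t + (-h t + ε * ‖t - x‖ ^ 2) with hG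
  have hGus : UpperSemicontinuousOn G (Metric.closedBall x r) := by
    refine hus.add (ContinuousOn.upperSemicontinuousOn ?_)
    exact hc.neg.add (by fun_prop)
  obtain ⟨z, hz, hmax⟩ := hGus.exists_isMaxOn
    ⟨x, Metric.mem_closedBall_self hr.le⟩ (isCompact_closedBall x r)
  have hmax' : ∀ t ∈ Metric.closedBall x r, G t ≤ G z := fun t ht => hmax ht
  have hzb : z ∈ Metric.ball x r := by
    rw [mem_ball_iff_norm]
    rw [mem_closedBall_iff_norm] at hz
    refine lt_of_le_of_ne hz fun heq => ?_
    have h1 := hle z (by rwa [mem_sphere_iff_norm])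
    have h2 := hmax' y hy
    simp only [hG, heq] at h2
    have h3 : 0 ≤ ε * ‖y - x‖ ^ 2 := by positivity
    linarith
  have hcd : ContDiffAt ℝ 2 h z := hh.1.contDiffAt (Metric.isOpen_ball.mem_nhds hzb)
  obtain ⟨d1, d2⟩ := hcd.eventually_hasFDerivAt_two
  have hT := taylor_two_isLittleO d1 d2 (half_pos hε0)
  have hvz := hv z hzb (fderiv ℝ h z - (2 * ε) • innerQ (z - x))
    ((1 / 2 : ℝ) • fderiv ℝ (fderiv ℝ h) z + (-(ε / 2)) • innerQ) (by
      filter_upwards [hT, Metric.isOpen_ball.mem_nhds hzb] with t ht htb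
      have h1 := hmax' t (Metric.ball_subset_closedBall htb)
      have h2 := (abs_le.1 ht).2
      have e : ‖t - x‖ ^ 2 = ‖t - z‖ ^ 2 + 2 * innerQ (z - x) (t - z) + ‖z - x‖ ^ 2 := by
        have : t - x = (z - x) + (t - z) := by abel
        rw [this, @norm_add_sq_real]
        show _ = _ + 2 * inner ℝ (z - x) (t - z) + _
        ring
      simp only [hG, e] at h1
      simp only [add_apply, sub_apply,
        smul_apply, innerQ_self, smul_eq_mul]
      linarith)
  rw [traceQ_add, traceQ_smul, traceQ_smul, traceQ_innerQ, ← lapQ_eq_traceQ_fderiv hcd,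
    hh.2 z hzb] at hvz
  linarith

/-! ### Reformulations of plurisubharmonicity for real functions -/

theorem upperSemicontinuousOn_coe_iff {X : Type*} [TopologicalSpace X] {u : X → ℝ} {s : Set X} :
    UpperSemicontinuousOn (fun x => (u x : EReal)) s ↔ UpperSemicontinuousOn u s := by
  constructor
  · intro h x hx y hy
    filter_upwards [h x hx (y : EReal) (EReal.coe_lt_coe_iff.2 hy)] with z hz
    exact EReal.coe_lt_coe_iff.1 hz
  · intro h x hx y hy
    induction y with
    | bot => simp at hy
    | top => exact Eventually.of_forall fun z => EReal.coe_lt_top _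
    | coe y =>
      filter_upwards [h x hx y (EReal.coe_lt_coe_iff.1 hy)] with z hz
      exact EReal.coe_lt_coe_iff.2 hz

theorem continuous_qLine {n : ℕ} (a b : Hn n) : Continuous (qLine a b) := by
  unfold qLine; fun_prop

theorem isOpen_qLine_preimage {n : ℕ} {Ω : Set (Hn n)} (hΩ : IsOpen Ω) (a b : Hn n) :
    IsOpen {t : ℍ | qLine a b t ∈ Ω} := hΩ.preimage (continuous_qLine a b)

theorem qpshr_iff_majOn {n : ℕ} {u : Hn n → ℝ} {Ω : Set (Hn n)} :
    QPSHr u Ω ↔ UpperSemicontinuousOn u Ω ∧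
      ∀ (a b : Hn n) (x : ℍ) (r : ℝ), 0 < r → (∀ t ∈ Metric.closedBall x r, qLine a b t ∈ Ω) →
        MajOn (fun t => u (qLine a b t)) x r := by
  unfold QPSHr QPSH SubharmonicOn
  rw [upperSemicontinuousOn_coe_iff]
  constructor
  · rintro ⟨h1, -, h3⟩
    refine ⟨h1, fun a b x r hr hs h hc hh hle y hy => ?_⟩
    exact EReal.coe_le_coe_iff.1 ((h3 a b).2.2 x r hr hs h hc hh
      (fun y hy => EReal.coe_le_coe_iff.2 (hle y hy)) y hy)
  · rintro ⟨h1, h3⟩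
    refine ⟨h1, fun q _ => EReal.coe_ne_top _, fun a b => ⟨?_, fun q _ => EReal.coe_ne_top _, ?_⟩⟩
    · exact (upperSemicontinuousOn_coe_iff.2 h1).comp (continuous_qLine a b).continuousOn
        (fun t ht => ht)
    · intro x r hr hs h hc hh hle y hy
      exact EReal.coe_le_coe_iff.2 (h3 a b x r hr hs h hc hh
        (fun y hy => EReal.coe_le_coe_iff.1 (hle y hy)) y hy)

theorem qLine_zero {n : ℕ} (a b : Hn n) : qLine a b 0 = a := by
  ext k : 1; simp [qLine]

theorem qLine_qLine {n : ℕ} (a b : Hn n) (s t : ℍ) :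
    qLine (qLine a b s) b t = qLine a b (s + t) := by
  ext k : 1; simp [qLine, mul_add, add_assoc]

theorem viscAt_shift {u : ℍ → ℝ} {s : ℍ} (h : ViscAt (fun t => u (s + t)) 0) : ViscAt u s := by
  intro l β hu
  refine h l β ?_
  have c : Tendsto (fun t : ℍ => s + t) (𝓝 0) (𝓝 s) := by
    have : Continuous fun t : ℍ => s + t := by fun_prop
    simpa using this.tendsto 0
  filter_upwards [c.eventually hu] with t ht
  simpa using ht

theorem qpshr_iff_viscAt {n : ℕ} {u : Hn n → ℝ} {Ω : Set (Hn n)} (hΩ : IsOpen Ω) :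
    QPSHr u Ω ↔ UpperSemicontinuousOn u Ω ∧
      ∀ q ∈ Ω, ∀ b : Hn n, ViscAt (fun t => u (qLine q b t)) 0 := by
  rw [qpshr_iff_majOn]
  refine and_congr_right fun hus => ⟨fun h q hq b => ?_, fun h a b x r hr hs => ?_⟩
  · obtain ⟨R, hR, hsub⟩ := Metric.isOpen_iff.1 (isOpen_qLine_preimage hΩ q b) 0
      (by simpa [qLine_zero] using hq)
    exact viscAt_of_majOn hR fun r hr hrR => h q b 0 r hr fun t ht =>
      hsub (Metric.closedBall_subset_ball hrR ht)
  · refine majOn_of_viscAt hr ?_ ?_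
    · exact UpperSemicontinuousOn.comp (g := qLine a b) hus (continuous_qLine a b).continuousOn
        (fun t ht => hs t ht)
    · intro y hy
      refine viscAt_shift ?_
      simpa only [qLine_qLine] using h (qLine a b y) (hs y (Metric.ball_subset_closedBall hy)) b

end

noncomputable section

/-! ### Stability properties of plurisubharmonic functions -/

theorem ViscAt.of_le {u v : ℍ → ℝ} {x : ℍ} (hv : ViscAt v x) (hle : ∀ᶠ t in 𝓝 x, v t ≤ u t)
    (hx : v x = u x) : ViscAt u x := by
  intro l β hu
  refine hv l β ?_
  filter_upwards [hle, hu] with t h1 h2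
  rw [hx]; exact h1.trans h2

theorem viscAt_of_traceQ_nonneg {f : ℍ → ℝ} {f' : ℍ → ℍ →L[ℝ] ℝ} {H : ℍ →L[ℝ] ℍ →L[ℝ] ℝ} {x : ℍ}
    (hf : ∀ᶠ y in 𝓝 x, HasFDerivAt f (f' y) y) (hH : HasFDerivAt f' H x) (hnn : 0 ≤ traceQ H) :
    ViscAt f x := by
  intro l β hu
  have key : ∀ v, H v v ≤ 2 * β v v := by
    intro v
    refine second_deriv_le_of_touch hf hH v _ ?_
    have c1 : Tendsto (fun s : ℝ => x + s • v) (𝓝 0) (𝓝 x) := by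
      have : Continuous fun s : ℝ => x + s • v := by fun_prop
      simpa using this.tendsto 0
    have c2 : Tendsto (fun s : ℝ => x - s • v) (𝓝 0) (𝓝 x) := by
      have : Continuous fun s : ℝ => x - s • v := by fun_prop
      simpa using this.tendsto 0
    filter_upwards [c1.eventually hu, c2.eventually hu] with s h1 h2
    simp only [add_sub_cancel_left, map_smul, smul_apply, smul_eq_mul,
      sub_sub_cancel_left, map_neg, neg_apply] at h1 h2
    nlinarith
  have : traceQ H ≤ 2 * traceQ β := by
    rw [traceQ, traceQ, Finset.mul_sum]
    exact Finset.sum_le_sum fun m _ => key _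
  linarith

theorem traceQ_nonneg_of_viscAt {f : ℍ → ℝ} {f' : ℍ → ℍ →L[ℝ] ℝ} {H : ℍ →L[ℝ] ℍ →L[ℝ] ℝ} {x : ℍ}
    (hf : ∀ᶠ y in 𝓝 x, HasFDerivAt f (f' y) y) (hH : HasFDerivAt f' H x) (hv : ViscAt f x) :
    0 ≤ traceQ H := by
  refine le_of_forall_pos_le_add fun ε hε => ?_
  have hT := taylor_two_isLittleO hf hH (show 0 < ε / 8 by positivity)
  have := hv (f' x) ((1 / 2 : ℝ) • H + (ε / 8) • innerQ) (by
    filter_upwards [hT] with t ht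
    have := (abs_le.1 ht).2
    simp only [add_apply, smul_apply, innerQ_self, smul_eq_mul]
    linarith)
  rw [traceQ_add, traceQ_smul, traceQ_smul, traceQ_innerQ] at this
  linarith

theorem viscAt_affine (c : ℝ) (l : ℍ →L[ℝ] ℝ) (x : ℍ) : ViscAt (fun t => c + l t) x :=
  viscAt_of_traceQ_nonneg (f' := fun _ => l) (H := 0)
    (Eventually.of_forall fun y => (l.hasFDerivAt (x := y)).const_add c)
    (hasFDerivAt_const l x) (by simp [traceQ])

theorem viscAt_const (c : ℝ) (x : ℍ) : ViscAt (fun _ => c) x := by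
  simpa using viscAt_affine c 0 x

theorem majOn_const (c : ℝ) (x : ℍ) {r : ℝ} (hr : 0 < r) : MajOn (fun _ => c) x r :=
  majOn_of_viscAt hr continuousOn_const.upperSemicontinuousOn fun y _ => viscAt_const c y

theorem ViscAt.add_const {u : ℍ → ℝ} {x : ℍ} (h : ViscAt u x) (c : ℝ) :
    ViscAt (fun t => u t + c) x := by
  intro l β hu
  refine h l β ?_
  filter_upwards [hu] with t ht
  linarith

theorem ViscAt.const_mul {u : ℍ → ℝ} {x : ℍ} (h : ViscAt u x) {c : ℝ} (hc : 0 < c) :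
    ViscAt (fun t => c * u t) x := by
  intro l β hu
  have := h (c⁻¹ • l) (c⁻¹ • β) (by
    filter_upwards [hu] with t ht
    simp only [smul_apply, smul_eq_mul]
    have := mul_le_mul_of_nonneg_left ht (inv_pos.2 hc).le
    rw [inv_mul_cancel_left₀ hc.ne'] at this
    calc u t ≤ _ := this
      _ = _ := by field_simp)
  rw [traceQ_smul] at this
  exact nonneg_of_mul_nonneg_right this (inv_pos.2 hc)

/-- The parametrisation `t ↦ b t` of a right quaternionic line, as a real linear map. -/
def lineL {n : ℕ} (b : Hn n) : ℍ →L[ℝ] Hn n :=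
  ContinuousLinearMap.pi fun k => ContinuousLinearMap.mul ℝ ℍ (b k)

theorem qLine_eq {n : ℕ} (a b : Hn n) (t : ℍ) : qLine a b t = a + lineL b t := by
  ext k : 1; simp [qLine, lineL]

theorem norm_lineL {n : ℕ} (b : Hn n) (t : ℍ) : ‖lineL b t‖ = ‖b‖ * ‖t‖ := by
  have h : ∀ k, ‖lineL b t k‖ = ‖b k‖ * ‖t‖ := fun k => by simp [lineL]
  apply le_antisymm
  · rw [pi_norm_le_iff_of_nonneg (by positivity)]
    intro k
    rw [h]; gcongr; exact norm_le_pi_norm b k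
  · rcases eq_or_ne t 0 with rfl | ht
    · simp
    · have ht' : 0 < ‖t‖ := norm_pos_iff.2 ht
      rw [← le_div_iff₀ ht', pi_norm_le_iff_of_nonneg (by positivity)]
      intro k
      rw [le_div_iff₀ ht', ← h]; exact norm_le_pi_norm _ k

/-- The pullback of a real bilinear form on `ℍⁿ` to a right line. -/
def pullL {n : ℕ} (H : Hn n →L[ℝ] Hn n →L[ℝ] ℝ) (b : Hn n) : ℍ →L[ℝ] ℍ →L[ℝ] ℝ :=
  H.bilinearComp (lineL b) (lineL b)

theorem hasFDerivAt_line {n : ℕ} {f : Hn n → ℝ} {f' : Hn n → Hn n →L[ℝ] ℝ}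
    {H : Hn n →L[ℝ] Hn n →L[ℝ] ℝ} {q : Hn n}
    (hf : ∀ᶠ y in 𝓝 q, HasFDerivAt f (f' y) y) (hH : HasFDerivAt f' H q) (b : Hn n) :
    (∀ᶠ t in 𝓝 (0 : ℍ), HasFDerivAt (fun t => f (qLine q b t))
      ((f' (qLine q b t)).comp (lineL b)) t) ∧
    HasFDerivAt (fun t : ℍ => (f' (qLine q b t)).comp (lineL b)) (pullL H b) 0 := by
  have hd : ∀ t, HasFDerivAt (qLine q b) (lineL b) t := fun t => by
    have : qLine q b = fun t => q + lineL b t := funext (qLine_eq q b)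
    rw [this]; exact ((lineL b).hasFDerivAt).const_add q
  have ht : Tendsto (qLine q b) (𝓝 0) (𝓝 q) := by
    simpa [qLine_zero] using (continuous_qLine q b).tendsto 0
  constructor
  · filter_upwards [ht.eventually hf] with t h
    exact h.comp t (hd t)
  · have h1 : HasFDerivAt (fun t => f' (qLine q b t)) (H.comp (lineL b)) 0 :=
      HasFDerivAt.comp (g := f') (0 : ℍ) (by rwa [qLine_zero]) (hd 0)
    have h2 := h1.clm_comp (hasFDerivAt_const (lineL b) (0 : ℍ))
    refine h2.congr_fderiv ?_
    ext s t
    simp [pullL]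

theorem QPSHr.usc {n : ℕ} {u : Hn n → ℝ} {Ω : Set (Hn n)} (h : QPSHr u Ω) :
    UpperSemicontinuousOn u Ω := (qpshr_iff_majOn.1 h).1

theorem qpshr_of_locally {n : ℕ} {u : Hn n → ℝ} {Ω : Set (Hn n)} (hΩ : IsOpen Ω)
    (h : ∀ q ∈ Ω, ∃ V : Set (Hn n), IsOpen V ∧ q ∈ V ∧ ∃ v, QPSHr v V ∧ ∀ p ∈ V, u p = v p) :
    QPSHr u Ω := by
  refine (qpshr_iff_viscAt hΩ).2 ⟨?_, ?_⟩
  · intro q hq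
    obtain ⟨V, hV, hqV, v, hv, huv⟩ := h q hq
    have h1 : UpperSemicontinuousAt v q := fun y hy => by
      have := hv.usc q hqV y hy
      rwa [hV.nhdsWithin_eq hqV] at this
    have h2 : UpperSemicontinuousAt u q := by
      intro y hy
      have hy' : v q < y := by rw [← huv q hqV]; exact hy
      filter_upwards [h1 y hy', hV.mem_nhds hqV] with z hz hzV
      show u z < y
      rw [huv z hzV]; exact hz
    exact h2.upperSemicontinuousWithinAt Ω
  · intro q hq b
    obtain ⟨V, hV, hqV, v, hv, huv⟩ := h q hq
    refine (((qpshr_iff_viscAt hV).1 hv).2 q hqV b).of_le ?_ ?_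
    · filter_upwards [(isOpen_qLine_preimage hV q b).mem_nhds
        (show (0 : ℍ) ∈ {t | qLine q b t ∈ V} by simpa [qLine_zero] using hqV)] with t ht
      rw [huv _ ht]
    · rw [qLine_zero, huv q hqV]

theorem QPSHr.mono {n : ℕ} {u : Hn n → ℝ} {Ω V : Set (Hn n)} (h : QPSHr u Ω) (hV : V ⊆ Ω) :
    QPSHr u V := by
  rw [qpshr_iff_majOn] at h ⊢
  exact ⟨fun x hx y hy => (h.1 x (hV hx) y hy).filter_mono (nhdsWithin_mono x hV),
    fun a b x r hr hs => h.2 a b x r hr fun t ht => hV (hs t ht)⟩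

theorem QPSHr.max {n : ℕ} {u v : Hn n → ℝ} {Ω : Set (Hn n)} (hΩ : IsOpen Ω) (hu : QPSHr u Ω)
    (hv : QPSHr v Ω) : QPSHr (fun q => max (u q) (v q)) Ω := by
  rw [qpshr_iff_viscAt hΩ] at *
  refine ⟨hu.1.sup hv.1, fun q hq b => ?_⟩
  rcases le_total (u q) (v q) with h | h
  · exact (hv.2 q hq b).of_le (Eventually.of_forall fun t => le_max_right _ _)
      (by simp [qLine_zero, h])
  · exact (hu.2 q hq b).of_le (Eventually.of_forall fun t => le_max_left _ _)
      (by simp [qLine_zero, h])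

theorem QPSHr.add_const {n : ℕ} {u : Hn n → ℝ} {Ω : Set (Hn n)} (hΩ : IsOpen Ω) (hu : QPSHr u Ω)
    (c : ℝ) : QPSHr (fun q => u q + c) Ω := by
  rw [qpshr_iff_viscAt hΩ] at *
  exact ⟨hu.1.add continuousOn_const.upperSemicontinuousOn,
    fun q hq b => (hu.2 q hq b).add_const c⟩

theorem QPSHr.const_mul {n : ℕ} {u : Hn n → ℝ} {Ω : Set (Hn n)} (hΩ : IsOpen Ω) (hu : QPSHr u Ω)
    {c : ℝ} (hc : 0 < c) : QPSHr (fun q => c * u q) Ω := by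
  rw [qpshr_iff_viscAt hΩ] at *
  refine ⟨fun q hq y hy => ?_, fun q hq b => (hu.2 q hq b).const_mul hc⟩
  have hy' : u q < y / c := by rw [lt_div_iff₀ hc, mul_comm]; exact hy
  filter_upwards [hu.1 q hq _ hy'] with z hz
  have hz' : u z < y / c := hz
  rw [lt_div_iff₀ hc, mul_comm] at hz'
  exact hz'

theorem qpshr_const {n : ℕ} (c : ℝ) (Ω : Set (Hn n)) : QPSHr (fun _ => c) Ω :=
  qpshr_iff_majOn.2 ⟨continuousOn_const.upperSemicontinuousOn,
    fun _ _ x _ hr _ => majOn_const c x hr⟩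

theorem QPSHr.translate {n : ℕ} {u : Hn n → ℝ} {Ω : Set (Hn n)} (hu : QPSHr u Ω) (h : Hn n) :
    QPSHr (fun q => u (q + h)) {q | q + h ∈ Ω} := by
  rw [qpshr_iff_majOn] at *
  have e : ∀ a b t, qLine a b t + h = qLine (a + h) b t := fun a b t => by
    ext k : 1; simp only [qLine, Pi.add_apply]; abel
  refine ⟨hu.1.comp (f := fun q => u q) (g := fun q : Hn n => q + h) (by fun_prop) (fun q hq => hq),
    fun a b x r hr hs => ?_⟩
  simp only [e]
  exact hu.2 (a + h) b x r hr fun t ht => by simpa [e] using hs t ht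

theorem qpshr_of_sup {n : ℕ} {u : Hn n → ℝ} {Ω : Set (Hn n)} (hu : ContinuousOn u Ω)
    (h : ∀ q ∈ Ω, ∀ ε > 0, ∃ v, QPSHr v Ω ∧ (∀ p ∈ Ω, v p ≤ u p) ∧ u q - ε < v q) :
    QPSHr u Ω := by
  refine qpshr_iff_majOn.2 ⟨hu.upperSemicontinuousOn, fun a b x r hr hs k hc hk hle y hy => ?_⟩
  refine le_of_forall_pos_le_add fun ε hε => ?_
  obtain ⟨v, hv, hvu, hlt⟩ := h _ (hs y hy) ε hε
  have := (qpshr_iff_majOn.1 hv).2 a b x r hr hs k hc hk (fun z hz =>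
    (hvu _ (hs z (Metric.sphere_subset_closedBall hz))).trans (hle z hz)) y hy
  simp only at this
  linarith

theorem coe_toReal_max {x : EReal} {c : ℝ} (hx : x ≤ 0) :
    (((max x (c : EReal)).toReal : ℝ) : EReal) = max x c :=
  EReal.coe_toReal (ne_of_lt (max_lt (hx.trans_lt (by simp)) (EReal.coe_lt_top c)))
    (ne_of_gt ((EReal.bot_lt_coe c).trans_le (le_max_right _ _)))

theorem QPSH.truncate {n : ℕ} {φ : Hn n → EReal} {Ω : Set (Hn n)} (hφ : QPSH φ Ω)
    (hneg : ∀ q ∈ Ω, φ q ≤ 0) (c : ℝ) :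
    QPSHr (fun q => (max (φ q) (c : EReal)).toReal) Ω := by
  refine qpshr_iff_majOn.2 ⟨?_, fun a b x r hr hs h hc hh hle y hy => ?_⟩
  · rw [← upperSemicontinuousOn_coe_iff]
    intro q hq y hy
    simp only at hy
    rw [coe_toReal_max (hneg q hq)] at hy
    have hy2 := max_lt_iff.1 hy
    filter_upwards [hφ.1 q hq y hy2.1, self_mem_nhdsWithin] with z hz hzΩ
    show (((max (φ z) (c : EReal)).toReal : ℝ) : EReal) < y
    rw [coe_toReal_max (hneg z hzΩ)]
    exact max_lt hz hy2.2
  · have hle' : ∀ z ∈ Metric.sphere x r, max (φ (qLine a b z)) c ≤ h z := fun z hz => by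
      rw [← coe_toReal_max (hneg _ (hs z (Metric.sphere_subset_closedBall hz)))]
      exact EReal.coe_le_coe_iff.2 (hle z hz)
    rw [← EReal.coe_le_coe_iff, coe_toReal_max (hneg _ (hs y hy))]
    refine max_le ?_ ?_
    · exact (hφ.2.2 a b).2.2 x r hr hs h hc hh (fun z hz => (max_le_iff.1 (hle' z hz)).1) y hy
    · exact EReal.coe_le_coe_iff.2 (majOn_const c x hr h hc hh (fun z hz =>
        EReal.coe_le_coe_iff.1 (max_le_iff.1 (hle' z hz)).2) y hy)

theorem qpshr_of_hessian {n : ℕ} {f : Hn n → ℝ} {f' : Hn n → Hn n →L[ℝ] ℝ}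
    {H : Hn n → Hn n →L[ℝ] Hn n →L[ℝ] ℝ} (hf : ∀ y, HasFDerivAt f (f' y) y)
    (hH : ∀ y, HasFDerivAt f' (H y) y) (hnn : ∀ q b, 0 ≤ traceQ (pullL (H q) b)) :
    QPSHr f Set.univ := by
  refine (qpshr_iff_viscAt isOpen_univ).2 ⟨?_, fun q _ b => ?_⟩
  · exact (continuous_iff_continuousAt.2 fun y =>
      (hf y).continuousAt).continuousOn.upperSemicontinuousOn
  · obtain ⟨h1, h2⟩ := hasFDerivAt_line (Eventually.of_forall hf) (hH q) b
    exact viscAt_of_traceQ_nonneg h1 h2 (hnn q b)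

theorem QPSHr.traceQ_nonneg {n : ℕ} {f : Hn n → ℝ} {Ω : Set (Hn n)} (hΩ : IsOpen Ω)
    (h : QPSHr f Ω) {q : Hn n} (hq : q ∈ Ω) {f' : Hn n → Hn n →L[ℝ] ℝ}
    {H : Hn n →L[ℝ] Hn n →L[ℝ] ℝ} (hf : ∀ᶠ y in 𝓝 q, HasFDerivAt f (f' y) y)
    (hH : HasFDerivAt f' H q) (b : Hn n) : 0 ≤ traceQ (pullL H b) := by
  obtain ⟨h1, h2⟩ := hasFDerivAt_line hf hH b
  exact traceQ_nonneg_of_viscAt h1 h2 (((qpshr_iff_viscAt hΩ).1 h).2 q hq b)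

theorem qpshr_norm_sub {n : ℕ} (a : Hn n) : QPSHr (fun q => ‖q - a‖) Set.univ := by
  refine (qpshr_iff_viscAt isOpen_univ).2
    ⟨(Continuous.continuousOn (by fun_prop)).upperSemicontinuousOn, fun q _ b => ?_⟩
  obtain ⟨g, hg, hgq⟩ := exists_dual_vector'' ℝ (q - a)
  refine (viscAt_affine (g (q - a)) (g.comp (lineL b)) 0).of_le
    (Eventually.of_forall fun t => ?_) ?_
  · rw [qLine_eq, show q + lineL b t - a = (q - a) + lineL b t by abel]
    have := (le_abs_self _).trans ((g.le_opNorm ((q - a) + lineL b t)).trans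
      (mul_le_of_le_one_left (norm_nonneg _) hg))
    simpa using this
  · simpa [qLine_zero] using hgq

/-- The maximum principle on balls of `ℍⁿ`. -/
theorem QPSHr.le_of_le_sphere {n : ℕ} {v : Hn n → ℝ} {Ω : Set (Hn n)} (hv : QPSHr v Ω)
    {a : Hn n} {R c : ℝ} (hn : 0 < n) (hR : 0 < R) (hb : Metric.closedBall a R ⊆ Ω)
    (h : ∀ q ∈ Metric.sphere a R, v q ≤ c) : ∀ q ∈ Metric.closedBall a R, v q ≤ c := by
  have main : ∀ b : Hn n, b ≠ 0 → ∀ t ∈ Metric.closedBall (0 : ℍ) (R / ‖b‖),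
      v (qLine a b t) ≤ c := by
    intro b hb0 t ht
    have hb' : 0 < ‖b‖ := norm_pos_iff.2 hb0
    refine (qpshr_iff_majOn.1 hv).2 a b 0 (R / ‖b‖) (by positivity) (fun s hs => hb ?_)
      (fun _ => c) continuousOn_const ⟨contDiffOn_const, fun x _ => ?_⟩ (fun s hs => h _ ?_) t ht
    · rw [mem_closedBall_iff_norm, qLine_eq, add_sub_cancel_left, norm_lineL]
      rw [mem_closedBall_zero_iff, le_div_iff₀ hb'] at hs
      linarith
    · rw [lapQ_eq_traceQ_fderiv contDiffAt_const]
      simp [traceQ, fderiv_fun_const]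
    · rw [mem_sphere_iff_norm, qLine_eq, add_sub_cancel_left, norm_lineL]
      rw [mem_sphere_zero_iff_norm] at hs
      rw [hs]; field_simp
  intro q hq
  have : NeZero n := ⟨hn.ne'⟩
  rcases eq_or_ne q a with rfl | hqa
  · have := main (fun _ => 1) (fun h => by simpa using congrFun h 0) 0
      (Metric.mem_closedBall_self (by positivity))
    rwa [qLine_zero] at this
  · have h0 : q - a ≠ 0 := sub_ne_zero.2 hqa
    have hb' : 0 < ‖q - a‖ := norm_pos_iff.2 h0
    have := main (q - a) h0 1 (by
      rw [mem_closedBall_zero_iff, norm_one, le_div_iff₀ hb']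
      rw [mem_closedBall_iff_norm] at hq; linarith)
    have e : qLine a (q - a) 1 = q := by ext k : 1; simp [qLine]
    rwa [e] at this

end

noncomputable section

/-! ### Harmonic polynomials and the Dirichlet problem on balls of `ℍ` -/

/-- The four real coordinates of a quaternion. -/
def coordQ (m : Fin 4) : ℍ →L[ℝ] ℝ := innerQ (unitQ m)

theorem coordQ_eq (t : ℍ) : (fun m => coordQ m t) = ![t.re, t.imI, t.imJ, t.imK] := by
  ext m
  show inner ℝ (unitQ m) t = _
  rw [Quaternion.inner_def, Quaternion.re_mul]
  fin_cases m <;> simp [unitQ]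

theorem coordQ_unitQ (m l : Fin 4) : coordQ m (unitQ l) = if m = l then 1 else 0 := by
  rw [show coordQ m (unitQ l) = _ from congrFun (coordQ_eq (unitQ l)) m]
  fin_cases m <;> fin_cases l <;> simp [unitQ]

theorem norm_sq_eq_sum_coordQ (t : ℍ) : ‖t‖ ^ 2 = ∑ m, coordQ m t ^ 2 := by
  have h := congrFun (coordQ_eq t)
  rw [Fin.sum_univ_four, h 0, h 1, h 2, h 3]
  rw [← real_inner_self_eq_norm_sq, Quaternion.inner_def]
  simp
  ring

/-- Evaluation of a real polynomial in four variables at a quaternion. -/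
def evQ (p : MvPolynomial (Fin 4) ℝ) (t : ℍ) : ℝ := MvPolynomial.eval (fun m => coordQ m t) p

theorem hasFDerivAt_evQ (p : MvPolynomial (Fin 4) ℝ) (t : ℍ) :
    HasFDerivAt (evQ p) (∑ m, evQ (MvPolynomial.pderiv m p) t • coordQ m) t := by
  induction p using MvPolynomial.induction_on with
  | C a =>
    have : evQ (MvPolynomial.C a) = fun _ => a := by ext t; simp [evQ]
    rw [this]
    simpa [evQ] using hasFDerivAt_const a t
  | add p q hp hq =>
    have : evQ (p + q) = fun t => evQ p t + evQ q t := by ext t; simp [evQ]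
    rw [this]
    refine (hp.add hq).congr_fderiv ?_
    simp [evQ, add_smul, Finset.sum_add_distrib]
  | mul_X p i hp =>
    have : evQ (p * MvPolynomial.X i) = fun t => evQ p t * coordQ i t := by ext t; simp [evQ]
    rw [this]
    refine (hp.mul ((coordQ i).hasFDerivAt)).congr_fderiv ?_
    ext v
    simp only [evQ, MvPolynomial.pderiv_mul, map_add, map_mul, MvPolynomial.eval_X,
      MvPolynomial.pderiv_X, add_smul, Finset.sum_add_distrib, add_apply, smul_apply,
      sum_apply, smul_eq_mul, Finset.mul_sum]
    rw [add_comm]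
    congr 1
    · refine Finset.sum_congr rfl fun m _ => by ring
    · rw [Finset.sum_eq_single i]
      · simp
      · intro b _ hb
        simp [hb.symm]
      · simp

theorem contDiff_evQ (p : MvPolynomial (Fin 4) ℝ) : ContDiff ℝ 2 (evQ p) := by
  induction p using MvPolynomial.induction_on with
  | C a =>
    have : evQ (MvPolynomial.C a) = fun _ => a := by ext t; simp [evQ]
    rw [this]; exact contDiff_const
  | add p q hp hq =>
    have : evQ (p + q) = fun t => evQ p t + evQ q t := by ext t; simp [evQ]
    rw [this]; exact hp.add hq
  | mul_X p i hp =>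
    have : evQ (p * MvPolynomial.X i) = fun t => evQ p t * coordQ i t := by ext t; simp [evQ]
    rw [this]; exact hp.mul (coordQ i).contDiff

/-- The Laplacian on polynomials in four variables. -/
def polyLap : MvPolynomial (Fin 4) ℝ →ₗ[ℝ] MvPolynomial (Fin 4) ℝ :=
  ∑ m, (MvPolynomial.pderiv m).toLinearMap ∘ₗ (MvPolynomial.pderiv m).toLinearMap

theorem polyLap_apply (p : MvPolynomial (Fin 4) ℝ) :
    polyLap p = ∑ m, MvPolynomial.pderiv m (MvPolynomial.pderiv m p) := by
  simp [polyLap]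

theorem hasFDerivAt_sum_smul {E ι : Type*} [NormedAddCommGroup E] [NormedSpace ℝ E] [Fintype ι]
    {f : ι → E → ℝ} {f' : ι → E →L[ℝ] ℝ} {c : ι → E →L[ℝ] ℝ} {t : E}
    (h : ∀ i, HasFDerivAt (f i) (f' i) t) :
    HasFDerivAt (fun y => ∑ i, f i y • c i) (∑ i, (f' i).smulRight (c i)) t :=
  HasFDerivAt.fun_sum fun i _ => (h i).smul_const (c i)

theorem evQ_second (p : MvPolynomial (Fin 4) ℝ) (t : ℍ) :
    ∃ H : ℍ →L[ℝ] ℍ →L[ℝ] ℝ,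
      HasFDerivAt (fun y => ∑ m, evQ (MvPolynomial.pderiv m p) y • coordQ m) H t ∧
      traceQ H = evQ (polyLap p) t := by
  refine ⟨_, hasFDerivAt_sum_smul fun m => hasFDerivAt_evQ (MvPolynomial.pderiv m p) t, ?_⟩
  simp only [traceQ, Fin.sum_univ_four, add_apply, ContinuousLinearMap.smulRight_apply,
     smul_apply, smul_eq_mul, coordQ_unitQ]
  simp [polyLap_apply, evQ, Fin.sum_univ_four]

theorem lapQ_evQ (p : MvPolynomial (Fin 4) ℝ) (t : ℍ) : lapQ (evQ p) t = evQ (polyLap p) t := by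
  obtain ⟨H, hH, hT⟩ := evQ_second p t
  rw [lapQ_eq_traceQ (Eventually.of_forall (hasFDerivAt_evQ p)) hH, hT]

theorem majOn_evQ {p : MvPolynomial (Fin 4) ℝ} {x : ℍ} {r : ℝ} (hr : 0 < r)
    (hp : ∀ t, evQ (polyLap p) t = 0) : MajOn (evQ p) x r := by
  refine majOn_of_viscAt hr (contDiff_evQ p).continuous.continuousOn.upperSemicontinuousOn
    fun y _ => ?_
  obtain ⟨H, hH, hT⟩ := evQ_second p y
  exact viscAt_of_traceQ_nonneg (Eventually.of_forall (hasFDerivAt_evQ p)) hH (by rw [hT, hp])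

theorem harmonicOnQ_evQ {p : MvPolynomial (Fin 4) ℝ} {s : Set ℍ}
    (hp : ∀ t, evQ (polyLap p) t = 0) : HarmonicOnQ (evQ p) s :=
  ⟨(contDiff_evQ p).contDiffOn, fun t _ => by rw [lapQ_evQ, hp]⟩

theorem harmonicOnQ_const (c : ℝ) (s : Set ℍ) : HarmonicOnQ (fun _ => c) s := by
  have e : evQ (MvPolynomial.C c) = fun _ => c := by ext t; simp [evQ]
  rw [← e]
  exact harmonicOnQ_evQ fun t => by simp [evQ, polyLap_apply]

theorem totalDegree_pderiv_le (p : MvPolynomial (Fin 4) ℝ) (i : Fin 4) :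
    (MvPolynomial.pderiv i p).totalDegree ≤ p.totalDegree - 1 := by
  refine Finset.sup_le fun s hs => ?_
  rw [MvPolynomial.mem_support_iff, MvPolynomial.coeff_pderiv] at hs
  have h1 : s + Finsupp.single i 1 ∈ p.support :=
    MvPolynomial.mem_support_iff.2 (left_ne_zero_of_mul hs)
  have h2 := MvPolynomial.le_totalDegree h1
  rw [Finsupp.sum_add_index' (by simp) (by simp), Finsupp.sum_single_index rfl] at h2
  omega

theorem totalDegree_polyLap_le (p : MvPolynomial (Fin 4) ℝ) :
    (polyLap p).totalDegree ≤ p.totalDegree - 2 := by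
  rw [polyLap_apply]
  refine MvPolynomial.totalDegree_finsetSum_le fun m _ => ?_
  have h1 := totalDegree_pderiv_le (MvPolynomial.pderiv m p) m
  have h2 := totalDegree_pderiv_le p m
  omega

/-- The defining polynomial of the sphere of centre `x` and radius `r`. -/
def spherePoly (x : ℍ) (r : ℝ) : MvPolynomial (Fin 4) ℝ :=
  ∑ m, (MvPolynomial.X m - MvPolynomial.C (coordQ m x)) ^ 2 - MvPolynomial.C (r ^ 2)

theorem evQ_spherePoly (x : ℍ) (r : ℝ) (t : ℍ) :
    evQ (spherePoly x r) t = ‖t - x‖ ^ 2 - r ^ 2 := by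
  rw [norm_sq_eq_sum_coordQ]
  simp [evQ, spherePoly]

theorem totalDegree_spherePoly_le (x : ℍ) (r : ℝ) : (spherePoly x r).totalDegree ≤ 2 := by
  refine (MvPolynomial.totalDegree_sub_C_le _ _).trans
    (MvPolynomial.totalDegree_finsetSum_le fun m _ => ?_)
  refine (MvPolynomial.totalDegree_pow _ _).trans ?_
  have := (MvPolynomial.totalDegree_sub_C_le (MvPolynomial.X m) (coordQ m x)).trans
    (MvPolynomial.totalDegree_X (R := ℝ) m).le
  omega

theorem evQ_mul (p q : MvPolynomial (Fin 4) ℝ) (t : ℍ) : evQ (p * q) t = evQ p t * evQ q t := by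
  simp [evQ]

theorem eq_zero_of_evQ_eq_zero {q : MvPolynomial (Fin 4) ℝ} {x : ℍ} {r : ℝ} (hr : 0 < r)
    (h : ∀ t ∈ Metric.ball x r, evQ q t = 0) : q = 0 := by
  refine MvPolynomial.funext_set (fun i => Set.Ioo (coordQ i x - r / 2) (coordQ i x + r / 2))
    (fun i => Set.Ioo_infinite (by linarith)) fun c hc => ?_
  have hc' : ∀ i, |c i - coordQ i x| < r / 2 := fun i => by
    have := hc i (Set.mem_univ i)
    rw [abs_lt]; constructor <;> linarith [this.1, this.2]
  obtain ⟨y, hy⟩ : ∃ y : ℍ, y = ⟨c 0, c 1, c 2, c 3⟩ := ⟨_, rfl⟩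
  have e : (fun m => coordQ m y) = c := by
    rw [coordQ_eq]; subst hy; ext m; fin_cases m <;> rfl
  have := h y (by
    rw [mem_ball_iff_norm]
    refine lt_of_pow_lt_pow_left₀ 2 hr.le ?_
    rw [norm_sq_eq_sum_coordQ]
    have hm : ∀ m, coordQ m (y - x) ^ 2 < (r / 2) ^ 2 := fun m => by
      rw [map_sub, show coordQ m y = c m from congrFun e m, ← sq_abs]
      have := hc' m
      gcongr
    rw [Fin.sum_univ_four]
    nlinarith [hm 0, hm 1, hm 2, hm 3])
  unfold evQ at this
  rw [e] at this
  rw [this, map_zero]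

/-- Polynomial solution of the Dirichlet problem with polynomial data on a ball. -/
theorem exists_polyLap_eq_zero (p : MvPolynomial (Fin 4) ℝ) (x : ℍ) {r : ℝ} (hr : 0 < r) :
    ∃ F, polyLap F = 0 ∧ ∀ t ∈ Metric.sphere x r, evQ F t = evQ p t := by
  set V := MvPolynomial.restrictTotalDegree (Fin 4) ℝ p.totalDegree with hV
  let T : MvPolynomial (Fin 4) ℝ →ₗ[ℝ] MvPolynomial (Fin 4) ℝ :=
    polyLap ∘ₗ LinearMap.mulLeft ℝ (spherePoly x r)
  have hTV : ∀ q ∈ V, T q ∈ V := by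
    intro q hq
    rw [hV, MvPolynomial.mem_restrictTotalDegree] at hq ⊢
    have h1 := totalDegree_polyLap_le (spherePoly x r * q)
    have h2 := MvPolynomial.totalDegree_mul (spherePoly x r) q
    have h3 := totalDegree_spherePoly_le x r
    show (polyLap (spherePoly x r * q)).totalDegree ≤ _
    omega
  have hinj : Function.Injective (T.restrict hTV) := by
    rw [injective_iff_map_eq_zero]
    rintro ⟨q, hq⟩ h0
    have h1 : polyLap (spherePoly x r * q) = 0 := congrArg Subtype.val h0
    have h2 : ∀ s : ℝ, ∀ t, evQ (polyLap (s • (spherePoly x r * q))) t = 0 := fun s t => by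
      rw [map_smul, h1]; simp [evQ]
    have h3 : ∀ s : ℝ, ∀ t ∈ Metric.closedBall x r, s * evQ (spherePoly x r * q) t ≤ 0 := by
      intro s t ht
      have := majOn_evQ hr (h2 s) (x := x) (fun _ => 0) continuousOn_const
        (harmonicOnQ_const 0 _) (fun y hy => by
          rw [mem_sphere_iff_norm] at hy
          have := evQ_mul (spherePoly x r) q y
          rw [evQ_spherePoly, hy, sub_self, zero_mul] at this
          unfold evQ at this ⊢
          rw [MvPolynomial.smul_eval, this, mul_zero]) t ht
      simpa [evQ, MvPolynomial.smul_eval] using this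
    refine Subtype.ext (eq_zero_of_evQ_eq_zero hr (x := x) fun t ht => ?_)
    have h4 := h3 1 t (Metric.ball_subset_closedBall ht)
    have h5 := h3 (-1) t (Metric.ball_subset_closedBall ht)
    have h6 : evQ (spherePoly x r * q) t = 0 := by linarith
    rw [evQ_mul, evQ_spherePoly] at h6
    rw [mem_ball_iff_norm] at ht
    refine (mul_eq_zero.1 h6).resolve_left ?_
    have := norm_nonneg (t - x)
    nlinarith
  obtain ⟨⟨q, hq⟩, hq'⟩ := (LinearMap.injective_iff_surjective.1 hinj) ⟨polyLap p, by
    rw [hV, MvPolynomial.mem_restrictTotalDegree]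
    exact (totalDegree_polyLap_le p).trans (Nat.sub_le _ _)⟩
  have hq2 : polyLap (spherePoly x r * q) = polyLap p := congrArg Subtype.val hq'
  refine ⟨p - spherePoly x r * q, by rw [map_sub, hq2, sub_self], fun t ht => ?_⟩
  rw [mem_sphere_iff_norm] at ht
  have := evQ_mul (spherePoly x r) q t
  rw [evQ_spherePoly, ht, sub_self, zero_mul] at this
  unfold evQ at this ⊢
  rw [map_sub, this, sub_zero]

theorem exists_harmonic_near {w : ℍ → ℝ} {x : ℍ} {r : ℝ} (hr : 0 < r)
    (hw : ContinuousOn w (Metric.sphere x r)) {ε : ℝ} (hε : 0 < ε) :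
    ∃ F, polyLap F = 0 ∧ ∀ t ∈ Metric.sphere x r, |evQ F t - w t| ≤ ε := by
  let cm : Fin 4 → C(Metric.sphere x r, ℝ) := fun m => ⟨fun t => coordQ m t, by fun_prop⟩
  let A : MvPolynomial (Fin 4) ℝ →ₐ[ℝ] C(Metric.sphere x r, ℝ) := MvPolynomial.aeval cm
  have hA : ∀ p t, A p t = evQ p t := by
    intro p t
    induction p using MvPolynomial.induction_on with
    | C a =>
      simp only [A, evQ, MvPolynomial.aeval_C, MvPolynomial.eval_C]
      rfl
    | add p q hp hq => simp only [map_add, ContinuousMap.add_apply, hp, hq, evQ]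
    | mul_X p i hp =>
      simp only [map_mul, ContinuousMap.mul_apply, hp, evQ, MvPolynomial.eval_X]
      simp [A, cm]
  obtain ⟨⟨g, hg⟩, hgw⟩ :=
    ContinuousMap.exists_mem_subalgebra_near_continuousMap_of_separatesPoints A.range (by
      intro s t hst
      have : ∃ m, coordQ m (s : ℍ) ≠ coordQ m (t : ℍ) := by
        by_contra! hcon
        refine hst (Subtype.ext ?_)
        rw [← sub_eq_zero, ← norm_eq_zero, ← sq_eq_zero_iff, norm_sq_eq_sum_coordQ]
        simp [hcon]
      obtain ⟨m, hm⟩ := this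
      refine ⟨cm m, ⟨cm m, ⟨MvPolynomial.X m, by simp [A]⟩, rfl⟩, hm⟩)
      ⟨fun t : Metric.sphere x r => w t, continuousOn_iff_continuous_domRestrict.1 hw⟩ ε hε
  obtain ⟨p, rfl⟩ := A.mem_range.1 hg
  obtain ⟨F, hF, hFp⟩ := exists_polyLap_eq_zero p x hr
  refine ⟨F, hF, fun t ht => ?_⟩
  have := (ContinuousMap.norm_coe_le_norm _ (⟨t, ht⟩ : Metric.sphere x r)).trans hgw.le
  simp only [ContinuousMap.sub_apply, hA, Real.norm_eq_abs] at this
  rw [hFp t ht]; exact this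

/-! ### Sums, limits and averages of subharmonic functions -/

theorem HarmonicOnQ.sub {h k : ℍ → ℝ} {s : Set ℍ} (hs : IsOpen s) (hh : HarmonicOnQ h s)
    (hk : HarmonicOnQ k s) : HarmonicOnQ (fun t => h t - k t) s :=
  ⟨hh.1.sub hk.1, fun x hx => by
    rw [lapQ_sub ((hh.1 x hx).contDiffAt (hs.mem_nhds hx))
      ((hk.1 x hx).contDiffAt (hs.mem_nhds hx)), hh.2 x hx, hk.2 x hx, sub_zero]⟩

theorem MajOn.of_approx {w : ℍ → ℝ} {x : ℍ} {r : ℝ}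
    (h : ∀ ε > 0, ∃ v, MajOn v x r ∧ ∀ y ∈ Metric.closedBall x r, |v y - w y| ≤ ε) :
    MajOn w x r := by
  intro k hc hk hle y hy
  refine le_of_forall_pos_le_add fun ε hε => ?_
  obtain ⟨v, hv, hvw⟩ := h (ε / 2) (by positivity)
  have := hv (fun t => k t - (-(ε / 2))) (hc.sub continuousOn_const)
    (hk.sub Metric.isOpen_ball (harmonicOnQ_const _ _)) (fun z hz => by
      have := (abs_le.1 (hvw z (Metric.sphere_subset_closedBall hz))).2
      linarith [hle z hz]) y hy
  have := (abs_le.1 (hvw y hy)).1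
  linarith

theorem MajOn.add {u v : ℍ → ℝ} {x : ℍ} {r : ℝ} (hr : 0 < r)
    (hcu : ContinuousOn u (Metric.closedBall x r))
    (hu : MajOn u x r) (hv : MajOn v x r) : MajOn (fun t => u t + v t) x r := by
  intro k hc hk hle y hy
  refine le_of_forall_pos_le_add fun ε hε => ?_
  obtain ⟨F, hF, hFu⟩ := exists_harmonic_near hr
    (hcu.mono Metric.sphere_subset_closedBall) (show 0 < ε / 2 by positivity)
  have hF' : ∀ t, evQ (polyLap F) t = 0 := fun t => by rw [hF]; simp [evQ]
  have h1 := hu (fun t => evQ F t - (-(ε / 2)))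
    ((contDiff_evQ F).continuous.continuousOn.sub continuousOn_const)
    ((harmonicOnQ_evQ hF').sub Metric.isOpen_ball (harmonicOnQ_const _ _)) (fun z hz => by
      have := (abs_le.1 (hFu z hz)).1
      linarith) y hy
  have h2 := hv (fun t => k t - evQ F t - (-(ε / 2)))
    ((hc.sub (contDiff_evQ F).continuous.continuousOn).sub continuousOn_const)
    ((hk.sub Metric.isOpen_ball (harmonicOnQ_evQ hF')).sub Metric.isOpen_ball
      (harmonicOnQ_const _ _)) (fun z hz => by
      have := (abs_le.1 (hFu z hz)).2
      linarith [hle z hz]) y hy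
  linarith

theorem MajOn.const_mul {u : ℍ → ℝ} {x : ℍ} {r c : ℝ} (hr : 0 < r)
    (hu : MajOn u x r) (hc : 0 ≤ c) : MajOn (fun t => c * u t) x r := by
  rcases hc.eq_or_lt with rfl | hc
  · simpa using majOn_const 0 x hr
  intro k hck hk hle y hy
  have h1 := hu (fun t => c⁻¹ • k t) (hck.const_smul c⁻¹)
    ⟨hk.1.const_smul c⁻¹, fun z hz => by
      obtain ⟨e1, e2⟩ := ((hk.1 z hz).contDiffAt
        (Metric.isOpen_ball.mem_nhds hz)).eventually_hasFDerivAt_two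
      have := hk.2 z hz
      rw [lapQ_eq_traceQ e1 e2] at this
      rw [lapQ_eq_traceQ (by filter_upwards [e1] with t ht using ht.const_smul c⁻¹)
        (e2.const_smul c⁻¹), traceQ_smul, this, mul_zero]⟩ (fun z hz => by
      rw [smul_eq_mul, ← div_eq_inv_mul, le_div_iff₀ hc, mul_comm]; exact hle z hz) y hy
  rwa [smul_eq_mul, ← div_eq_inv_mul, le_div_iff₀ hc, mul_comm] at h1

theorem QPSHr.add {n : ℕ} {u v : Hn n → ℝ} {Ω : Set (Hn n)} (hu : QPSHr u Ω) (hv : QPSHr v Ω)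
    (hc : ContinuousOn u Ω) : QPSHr (fun q => u q + v q) Ω := by
  rw [qpshr_iff_majOn] at *
  exact ⟨hu.1.add hv.1, fun a b x r hr hs => (hu.2 a b x r hr hs).add hr
    (hc.comp (continuous_qLine a b).continuousOn hs) (hv.2 a b x r hr hs)⟩

theorem qpshr_average {n : ℕ} {P : Hn n → ℝ} (hP : Continuous P) (hP' : QPSHr P Set.univ)
    (ν : Measure (Hn n)) [IsProbabilityMeasure ν] {K : Set (Hn n)} (hK : IsCompact K)
    (hν : ∀ᵐ z ∂ν, z ∈ K) (hcont : Continuous fun q => ∫ z, P (q - z) ∂ν) :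
    QPSHr (fun q => ∫ z, P (q - z) ∂ν) Set.univ := by
  refine qpshr_iff_majOn.2 ⟨hcont.continuousOn.upperSemicontinuousOn, fun a b x r hr _ => ?_⟩
  let B := Metric.closedBall x r
  have : CompactSpace B := isCompact_iff_compactSpace.1 (isCompact_closedBall x r)
  let ext : C(B, ℝ) → ℍ → ℝ := fun w t => by
    classical exact if h : t ∈ B then w ⟨t, h⟩ else 0
  have hext : ∀ (w : C(B, ℝ)) (t : B), ext w t = w t := fun w t => by
    simp [ext, t.2]
  have hcext : ∀ w, ContinuousOn (ext w) B := fun w => by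
    rw [continuousOn_iff_continuous_domRestrict]
    refine w.continuous.congr fun t => (hext w t).symm
  let S : Set C(B, ℝ) := {w | MajOn (ext w) x r}
  have congrMaj : ∀ {u v : ℍ → ℝ}, MajOn u x r → (∀ t ∈ B, u t = v t) → MajOn v x r := by
    intro u v hu huv
    exact MajOn.of_approx fun ε hε => ⟨u, hu, fun y hy => by rw [huv y hy]; simpa using hε.le⟩
  have hSconv : Convex ℝ S := by
    intro u hu v hv s t hs ht _
    refine congrMaj ((hu.const_mul hr hs).add hr (continuousOn_const.mul (hcext u))
      (hv.const_mul hr ht)) fun y hy => ?_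
    simp [ext, hy]
  have hSclosed : IsClosed S := by
    refine isClosed_of_closure_subset fun w hw => MajOn.of_approx fun ε hε => ?_
    obtain ⟨v, hv, hvw⟩ := Metric.mem_closure_iff.1 hw ε hε
    refine ⟨ext v, hv, fun y hy => ?_⟩
    rw [hext v ⟨y, hy⟩, hext w ⟨y, hy⟩, ← Real.dist_eq, dist_comm]
    exact (ContinuousMap.dist_apply_le_dist _).trans hvw.le
  let φ : Hn n → C(B, ℝ) := fun z => ⟨fun t => P (qLine a b t - z),
    hP.comp ((((continuous_qLine a b).comp continuous_subtype_val)).sub continuous_const)⟩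
  have hφc : Continuous φ := by
    let ψ : C(Hn n × B, ℝ) := ⟨fun p => P (qLine a b p.2 - p.1), hP.comp
      (((continuous_qLine a b).comp (continuous_subtype_val.comp continuous_snd)).sub
        continuous_fst)⟩
    exact ψ.curry.continuous
  have hφi : Integrable φ ν := by
    have : ν.restrict K = ν := Measure.restrict_eq_self_of_ae_mem hν
    rw [← this]
    exact hφc.continuousOn.integrableOn_compact hK
  have hmem := hSconv.integral_mem hSclosed (Eventually.of_forall fun z => by
    show MajOn (ext (φ z)) x r
    have h1 := (qpshr_iff_majOn.1 (hP'.translate (-z))).2 a b x r hr (fun t _ => Set.mem_univ _)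
    refine congrMaj h1 fun t ht => ?_
    rw [hext (φ z) ⟨t, ht⟩, ← sub_eq_add_neg]; rfl) hφi
  refine congrMaj (show MajOn (ext (∫ z, φ z ∂ν)) x r from hmem) fun t ht => ?_
  rw [hext _ ⟨t, ht⟩, ContinuousMap.integral_apply hφi]
  rfl

end

noncomputable section

/-! ### Continuous functions decreasing to an upper semicontinuous one -/

/-- The sup-convolution of the truncation of `φ` at level `-j` with slope `j`. -/
def supConv {n : ℕ} (Ω : Set (Hn n)) (φ : Hn n → EReal) (j : ℝ) (x : Hn n) : ℝ :=
  ⨆ y : Ω, ((max (φ y) ((-j : ℝ) : EReal)).toReal - j * ‖x - y‖)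

theorem toReal_max_le {x : EReal} {c t : ℝ} (hx : x ≤ 0) (hxt : x ≤ t) (hct : c ≤ t) :
    (max x (c : EReal)).toReal ≤ t := by
  rw [← EReal.coe_le_coe_iff, coe_toReal_max hx]
  exact max_le hxt (EReal.coe_le_coe_iff.2 hct)

theorem supConv_aux {n : ℕ} {Ω : Set (Hn n)} {φ : Hn n → EReal} (hneg : ∀ q ∈ Ω, φ q ≤ 0)
    {j : ℝ} (hj : 0 ≤ j) (x : Hn n) (y : Ω) :
    (max (φ y) ((-j : ℝ) : EReal)).toReal - j * ‖x - y‖ ≤ 0 := by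
  have h1 := toReal_max_le (c := -j) (t := 0) (hneg y y.2) (hneg y y.2) (by linarith)
  have h2 : 0 ≤ j * ‖x - y‖ := by positivity
  linarith

theorem supConv_bdd {n : ℕ} {Ω : Set (Hn n)} {φ : Hn n → EReal} (hneg : ∀ q ∈ Ω, φ q ≤ 0)
    {j : ℝ} (hj : 0 ≤ j) (x : Hn n) :
    BddAbove (Set.range fun y : Ω => (max (φ y) ((-j : ℝ) : EReal)).toReal - j * ‖x - y‖) :=
  ⟨0, by rintro _ ⟨y, rfl⟩; exact supConv_aux hneg hj x y⟩

theorem exists_continuous_antitone {n : ℕ} (hn : 0 < n) {Ω : Set (Hn n)} (hΩ : IsOpen Ω)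
    (hb : Bornology.IsBounded Ω) (hne : Ω.Nonempty) {φ : Hn n → EReal}
    (hφ : UpperSemicontinuousOn φ Ω) (hneg : ∀ q ∈ Ω, φ q ≤ 0) :
    ∃ f : ℕ → Hn n → ℝ, (∀ j, Continuous (f j)) ∧ (∀ j q, f j q ≤ 0) ∧
      (∀ j, ∃ K, IsCompact K ∧ K ⊆ Ω ∧ ∀ q ∉ K, f j q = 0) ∧ (∀ q, Antitone fun j => f j q) ∧
      (∀ j, ∀ q ∈ Ω, φ q ≤ f j q) ∧
      ∀ q ∈ Ω, ∀ t : ℝ, φ q < t → ∀ᶠ j in atTop, f j q ≤ t := by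
  have : Nonempty Ω := hne.to_subtype
  have : NeZero n := ⟨hn.ne'⟩
  have hcne : Ωᶜ.Nonempty := by
    rw [Set.nonempty_compl]
    rintro rfl
    exact NormedSpace.unbounded_univ ℝ (Hn n) hb
  let J : ℕ → ℝ := fun j => j + 1
  have hJ : ∀ j, 0 < J j := fun j => by positivity
  have hJm : Monotone J := fun a b hab => by simp only [J]; gcongr
  have hJt : Tendsto J atTop atTop := tendsto_natCast_atTop_atTop.atTop_add tendsto_const_nhds
  let χ : ℕ → Hn n → ℝ := fun j x => min 1 (max 0 (J j * Metric.infDist x Ωᶜ - 1))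
  have hχ0 : ∀ j x, 0 ≤ χ j x := fun j x => le_min zero_le_one (le_max_left _ _)
  have hχ1 : ∀ j x, χ j x ≤ 1 := fun j x => min_le_left _ _
  have hχm : ∀ x, Monotone fun j => χ j x := fun x a b hab => by
    simp only [χ]
    have := hJm hab
    have := Metric.infDist_nonneg (x := x) (s := Ωᶜ)
    gcongr
  let h : ℕ → Hn n → ℝ := fun j => supConv Ω φ (J j)
  have hbdd := fun j x => supConv_bdd hneg (hJ j).le x
  have h0 : ∀ j x, h j x ≤ 0 := fun j x => ciSup_le fun y => supConv_aux hneg (hJ j).le x y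
  have hlip : ∀ j, LipschitzWith ⟨J j, (hJ j).le⟩ (h j) := fun j => by
    refine LipschitzWith.of_le_add_mul _ fun x x' => ciSup_le fun y => ?_
    have h1 := le_ciSup (hbdd j x') y
    have h2 : ‖x' - y‖ ≤ ‖x - y‖ + dist x x' := by
      rw [dist_eq_norm, show x' - (y : Hn n) = (x - y) - (x - x') by abel]
      exact norm_sub_le _ _
    have h3 := mul_le_mul_of_nonneg_left h2 (hJ j).le
    show _ ≤ h j x' + J j * dist x x'
    simp only [h, supConv]
    linarith
  have hm : ∀ x, Antitone fun j => h j x := fun x a b hab => by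
    refine ciSup_le fun y => le_trans ?_ (le_ciSup (hbdd a x) y)
    have h1 := hJm hab
    have h2 : (max (φ y) ((-J b : ℝ) : EReal)).toReal ≤
        (max (φ y) ((-J a : ℝ) : EReal)).toReal := by
      rw [← EReal.coe_le_coe_iff, coe_toReal_max (hneg y y.2), coe_toReal_max (hneg y y.2)]
      exact max_le_max le_rfl (EReal.coe_le_coe_iff.2 (by linarith))
    have h3 : 0 ≤ ‖x - y‖ := norm_nonneg _
    nlinarith
  refine ⟨fun j x => χ j x * h j x, fun j => ?_, fun j q => ?_, fun j => ?_, fun q => ?_,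
    fun j q hq => ?_, fun q hq t ht => ?_⟩
  · refine Continuous.mul ?_ (hlip j).continuous
    have := Metric.continuous_infDist_pt (Ωᶜ : Set (Hn n))
    fun_prop
  · exact mul_nonpos_of_nonneg_of_nonpos (hχ0 j q) (h0 j q)
  · have hKΩ : {x : Hn n | 1 ≤ J j * Metric.infDist x Ωᶜ} ⊆ Ω := by
      intro x hx
      by_contra hxΩ
      have : Metric.infDist x Ωᶜ = 0 := Metric.infDist_zero_of_mem hxΩ
      rw [Set.mem_ofPred_eq, this] at hx
      linarith
    refine ⟨_, Metric.isCompact_of_isClosed_isBounded ?_ (hb.subset hKΩ), hKΩ, fun q hq => ?_⟩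
    · exact isClosed_le continuous_const
        (continuous_const.mul (Metric.continuous_infDist_pt _))
    · have : χ j q = 0 := by
        simp only [Set.mem_ofPred_eq, not_le] at hq
        simp only [χ]
        rw [max_eq_left (by linarith), min_eq_right zero_le_one]
      simp [this]
  · intro a b hab
    have h1 := hχm q hab
    have h2 := hm q hab
    have h3 := h0 b q
    have h4 := hχ0 a q
    simp only at h1 h2 ⊢
    nlinarith
  · have h1 := le_ciSup (hbdd j q) ⟨q, hq⟩
    simp only [sub_self, norm_zero, mul_zero, sub_zero] at h1
    have h2 : h j q ≤ χ j q * h j q := by nlinarith [h0 j q, hχ1 j q]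
    refine le_trans ?_ (EReal.coe_le_coe_iff.2 (h1.trans h2))
    rw [coe_toReal_max (hneg q hq)]
    exact le_max_left _ _
  · obtain ⟨s, hs, hsub⟩ := Metric.mem_nhds_iff.1 (by
      have := hφ q hq t ht
      rwa [hΩ.nhdsWithin_eq hq] at this)
    have hd : 0 < Metric.infDist q Ωᶜ :=
      (hΩ.isClosed_compl.notMem_iff_infDist_pos hcne).1 (fun h => h hq)
    filter_upwards [hJt.eventually_ge_atTop (2 / Metric.infDist q Ωᶜ),
      hJt.eventually_ge_atTop (-t / s), hJt.eventually_ge_atTop (-t)] with j j1 j2 j3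
    have hχ : χ j q = 1 := by
      rw [div_le_iff₀ hd] at j1
      simp only [χ]
      rw [max_eq_right (by linarith), min_eq_left (by linarith)]
    rw [hχ, one_mul]
    refine ciSup_le fun y => ?_
    have hnn : 0 ≤ J j * ‖q - y‖ := mul_nonneg (hJ j).le (norm_nonneg _)
    by_cases hy : (y : Hn n) ∈ Metric.ball q s
    · have := toReal_max_le (c := -J j) (hneg y y.2) (le_of_lt (show φ y < t from hsub hy))
        (by linarith)
      linarith
    · have h1 := toReal_max_le (c := -J j) (t := 0) (hneg y y.2) (hneg y y.2)
        (by linarith [hJ j])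
      rw [mem_ball_iff_norm, not_lt, norm_sub_rev] at hy
      rw [div_le_iff₀ hs] at j2
      have := mul_le_mul_of_nonneg_left hy (hJ j).le
      linarith

/-! ### Plurisubharmonic envelopes -/

theorem exists_barrier {n : ℕ} {Ω : Set (Hn n)} (hΩ : QHyperconvex Ω) {f : Hn n → ℝ}
    (hf : Continuous f) {K : Set (Hn n)} (hK : IsCompact K) (hKΩ : K ⊆ Ω)
    (hfK : ∀ q ∉ K, f q = 0) :
    ∃ w, QPSHr w Ω ∧ (∀ q ∈ Ω, w q ≤ f q) ∧
      ∀ δ > 0, ∃ L, IsCompact L ∧ L ⊆ Ω ∧ ∀ q ∈ Ω, q ∉ L → -δ ≤ w q := by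
  obtain ⟨hop, -, -, ρ, hρ, hρ0, hex⟩ := hΩ
  obtain ⟨M, hM, hfM⟩ : ∃ M : ℝ, 0 < M ∧ ∀ q ∈ K, -M ≤ f q := by
    obtain ⟨m, hm⟩ := (hK.image hf).bddBelow
    refine ⟨max 1 (-m), by positivity, fun q hq => ?_⟩
    have := hm (Set.mem_image_of_mem f hq)
    linarith [le_max_right 1 (-m)]
  obtain ⟨c, hc, hρK⟩ : ∃ c : ℝ, c < 0 ∧ ∀ q ∈ K, ρ q ≤ c := by
    rcases K.eq_empty_or_nonempty with rfl | hne
    · exact ⟨-1, by norm_num, by simp⟩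
    · obtain ⟨q0, hq0, hmax⟩ := (show UpperSemicontinuousOn ρ K from fun x hx y hy =>
        (hρ.1 x (hKΩ hx) y hy).filter_mono (nhdsWithin_mono x hKΩ)).exists_isMaxOn hne hK
      obtain ⟨c, hc1, hc2⟩ := EReal.lt_iff_exists_real_btwn.1 (hρ0 q0 (hKΩ hq0))
      exact ⟨c, by exact_mod_cast hc2, fun q hq => (hmax hq).trans hc1.le⟩
  have hneg : ∀ q ∈ Ω, ρ q ≤ 0 := fun q hq => (hρ0 q hq).le
  have hA : 0 < M / (-c) := div_pos hM (by linarith)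
  refine ⟨fun q => M / (-c) * (max (ρ q) (c : EReal)).toReal,
    (hρ.truncate hneg c).const_mul hop hA, fun q hq => ?_, fun δ hδ => ?_⟩
  · by_cases hqK : q ∈ K
    · have := toReal_max_le (c := c) (t := c) (hneg q hq) (hρK q hqK) le_rfl
      have := mul_le_mul_of_nonneg_left this hA.le
      have hc0 : -c ≠ 0 := neg_ne_zero.2 hc.ne
      have e : M / (-c) * c = -M := by
        linarith [div_mul_cancel₀ M hc0]
      linarith [hfM q hqK]
    · rw [hfK q hqK]
      exact mul_nonpos_of_nonneg_of_nonpos hA.le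
        (toReal_max_le (t := 0) (hneg q hq) (hneg q hq) hc.le)
  · have hc' : -(δ / (M / (-c))) < 0 := by
      have : 0 < δ / (M / (-c)) := by positivity
      linarith
    obtain ⟨h1, h2⟩ := hex _ hc'
    refine ⟨_, h1, h2, fun q hq hqL => ?_⟩
    have h3 : ¬ ρ q < ((-(δ / (M / (-c))) : ℝ) : EReal) := fun h => hqL (subset_closure ⟨hq, h⟩)
    have h4 : -(δ / (M / (-c))) ≤ (max (ρ q) (c : EReal)).toReal := by
      rw [← EReal.coe_le_coe_iff, coe_toReal_max (hneg q hq)]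
      exact (not_lt.1 h3).trans (le_max_left _ _)
    have h5 := mul_le_mul_of_nonneg_left h4 hA.le
    rwa [mul_neg, mul_div_cancel₀ _ hA.ne'] at h5

theorem exists_envelope {n : ℕ} {Ω : Set (Hn n)} (hΩ : QHyperconvex Ω) {f : Hn n → ℝ}
    (hf : Continuous f) (hf0 : ∀ q, f q ≤ 0) {K : Set (Hn n)} (hK : IsCompact K) (hKΩ : K ⊆ Ω)
    (hfK : ∀ q ∉ K, f q = 0) :
    ∃ g : Hn n → ℝ, UniformContinuous g ∧ QPSHr g Ω ∧ (∀ q ∉ Ω, g q = 0) ∧ (∀ q, g q ≤ f q) ∧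
      ∀ v, QPSHr v Ω → (∀ q ∈ Ω, v q ≤ f q) → ∀ q ∈ Ω, v q ≤ g q := by
  obtain ⟨w, hw, hwf, hwδ⟩ := exists_barrier hΩ hf hK hKΩ hfK
  have hop := hΩ.1
  let F : Set (Hn n → ℝ) := {v | QPSHr v Ω ∧ ∀ q ∈ Ω, v q ≤ f q}
  have hwF : w ∈ F := ⟨hw, hwf⟩
  classical
  let g : Hn n → ℝ := fun q => if q ∈ Ω then sSup ((fun v : Hn n → ℝ => v q) '' F) else 0
  have hbdd : ∀ q ∈ Ω, BddAbove ((fun v : Hn n → ℝ => v q) '' F) := fun q hq =>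
    ⟨f q, by rintro _ ⟨v, hv, rfl⟩; exact hv.2 q hq⟩
  have hgo : ∀ q ∉ Ω, g q = 0 := fun q hq => if_neg hq
  have hle : ∀ v ∈ F, ∀ q ∈ Ω, v q ≤ g q := fun v hv q hq => by
    simp only [g, if_pos hq]
    exact le_csSup (hbdd q hq) ⟨v, hv, rfl⟩
  have hge : ∀ q ∈ Ω, ∀ c, (∀ v ∈ F, v q ≤ c) → g q ≤ c := fun q hq c hc => by
    simp only [g, if_pos hq]
    exact csSup_le ⟨w q, w, hwF, rfl⟩ (by rintro _ ⟨v, hv, rfl⟩; exact hc v hv)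
  have hgf : ∀ q, g q ≤ f q := fun q => by
    by_cases hq : q ∈ Ω
    · exact hge q hq _ fun v hv => hv.2 q hq
    · rw [hgo q hq, hfK q fun h => hq (hKΩ h)]
  have huf : UniformContinuous f :=
    (HasCompactSupport.intro hK fun q hq => hfK q hq).uniformContinuous_of_continuous hf
  have key : ∀ ε > 0, ∃ η > 0, ∀ q h : Hn n, ‖h‖ < η → g (q + h) ≤ g q + ε := by
    intro ε hε
    obtain ⟨L, hL, hLΩ, hLw⟩ := hwδ ε hε
    obtain ⟨η₁, hη₁, hfη⟩ := Metric.uniformContinuous_iff.1 huf ε hε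
    obtain ⟨η₂, hη₂, hLη⟩ := hL.exists_thickening_subset_open hop hLΩ
    refine ⟨min η₁ η₂, lt_min hη₁ hη₂, fun q h hh => ?_⟩
    have hLh : ∀ p ∈ L, p + h ∈ Ω := fun p hp => hLη (Metric.mem_thickening_iff.2
      ⟨p, hp, by rw [dist_eq_norm, add_sub_cancel_left]; exact hh.trans_le (min_le_right _ _)⟩)
    have hfh : ∀ p, f (p + h) ≤ f p + ε := fun p => by
      have := hfη (a := p + h) (b := p) (by
        rw [dist_eq_norm, add_sub_cancel_left]; exact hh.trans_le (min_le_left _ _))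
      rw [Real.dist_eq] at this
      linarith [(abs_lt.1 this).2]
    by_cases hq : q ∈ Ω
    · by_cases hqh : q + h ∈ Ω
      · refine hge _ hqh _ fun v hv => ?_
        let v' : Hn n → ℝ := fun p => if p + h ∈ Ω then max (v (p + h) + -ε) (w p) else w p
        have hv' : v' ∈ F := by
          have hoff : ∀ p ∈ Ω, p ∉ L → v' p = w p := fun p hp hpL => by
            simp only [v']
            split_ifs with hph
            · refine max_eq_right ?_
              have := hLw p hp hpL
              linarith [hv.2 _ hph, hf0 (p + h)]
            · rfl
          constructor
          · refine qpshr_of_locally hop fun p hp => ?_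
            by_cases hpL : p ∈ L
            · have hVo : IsOpen {p : Hn n | p + h ∈ Ω} := hop.preimage (by fun_prop)
              refine ⟨Ω ∩ {p | p + h ∈ Ω}, hop.inter hVo, ⟨hp, hLh p hpL⟩,
                fun p => max (v (p + h) + -ε) (w p), ?_, fun y hy => if_pos hy.2⟩
              refine QPSHr.max (hop.inter hVo) ?_ (hw.mono Set.inter_subset_left)
              exact QPSHr.add_const (hop.inter hVo)
                ((hv.1.translate h).mono Set.inter_subset_right) (-ε)
            · exact ⟨Ω \ L, hop.sdiff hL.isClosed, ⟨hp, hpL⟩, w, hw.mono Set.sdiff_subset,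
                fun y hy => hoff y hy.1 hy.2⟩
          · intro p hp
            simp only [v']
            split_ifs with hph
            · refine max_le ?_ (hwf p hp)
              linarith [hv.2 _ hph, hfh p]
            · exact hwf p hp
        have h1 := hle v' hv' q hq
        have h2 : v' q = max (v (q + h) + -ε) (w q) := if_pos hqh
        have h3 := le_max_left (v (q + h) + -ε) (w q)
        linarith
      · rw [hgo _ hqh]
        have := hLw q hq fun hqL => hqh (hLh q hqL)
        linarith [hle w hwF q hq]
    · rw [hgo q hq]
      linarith [hgf (q + h), hf0 (q + h)]
  have hunif : UniformContinuous g := by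
    refine Metric.uniformContinuous_iff.2 fun ε hε => ?_
    obtain ⟨η, hη, hg⟩ := key (ε / 2) (by positivity)
    refine ⟨η, hη, fun {a b} hab => ?_⟩
    have h1 := hg a (b - a) (by rwa [← dist_eq_norm, dist_comm])
    have h2 := hg b (a - b) (by rwa [← dist_eq_norm])
    rw [add_sub_cancel] at h1 h2
    rw [Real.dist_eq, abs_lt]
    constructor <;> linarith
  refine ⟨g, hunif, qpshr_of_sup hunif.continuous.continuousOn fun q hq ε hε => ?_, hgo, hgf,
    fun v hv hvf q hq => hle v ⟨hv, hvf⟩ q hq⟩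
  by_contra! hcon
  have := hge q hq (g q - ε) fun v hv => hcon v hv.1 (hle v hv)
  linarith

/-- The envelope is maximal outside the support of the obstacle. -/
theorem envelope_maximal {n : ℕ} (hn : 0 < n) {Ω : Set (Hn n)} (hΩ : IsOpen Ω) {f g v : Hn n → ℝ}
    (hg : Continuous g) (hgP : QPSHr g Ω) (hgf : ∀ q, g q ≤ f q)
    (hmax : ∀ v, QPSHr v Ω → (∀ q ∈ Ω, v q ≤ f q) → ∀ q ∈ Ω, v q ≤ g q)
    {a : Hn n} {R δ : ℝ} (hR : 0 < R) (hball : Metric.closedBall a R ⊆ Ω)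
    (hf : ∀ q ∈ Metric.closedBall a R, f q = 0)
    (hv : Continuous v) (hvP : QPSHr v Set.univ)
    (hle : ∀ q ∈ Metric.sphere a R, v q ≤ g q + δ) :
    ∀ q ∈ Metric.closedBall a R, v q ≤ g q + δ := by
  intro q hq
  refine le_of_forall_pos_le_add fun τ hτ => ?_
  have hg0 : ∀ p ∈ Metric.closedBall a R, g p ≤ 0 := fun p hp => (hgf p).trans (hf p hp).le
  have hvδ : ∀ p ∈ Metric.closedBall a R, v p ≤ δ := hvP.le_of_le_sphere hn hR (Set.subset_univ _)
    fun p hp => by linarith [hle p hp, hg0 p (Metric.sphere_subset_closedBall hp)]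
  classical
  let g' : Hn n → ℝ := fun p =>
    if p ∈ Metric.closedBall a R then max (g p) (v p + (-(δ + τ))) else g p
  have h1 : QPSHr g' Ω := by
    refine qpshr_of_locally hΩ fun p hp => ?_
    by_cases hp1 : p ∈ Metric.ball a R
    · refine ⟨Metric.ball a R, Metric.isOpen_ball, hp1, fun p => max (g p) (v p + (-(δ + τ))), ?_,
        fun y hy => if_pos (Metric.ball_subset_closedBall hy)⟩
      exact QPSHr.max Metric.isOpen_ball
        (hgP.mono (Metric.ball_subset_closedBall.trans hball))
        ((hvP.mono (Set.subset_univ _)).add_const Metric.isOpen_ball _)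
    · by_cases hp2 : p ∈ Metric.closedBall a R
      · have hp3 : p ∈ Metric.sphere a R := by
          rw [Metric.mem_ball, not_lt] at hp1
          exact le_antisymm hp2 hp1
        refine ⟨Ω ∩ {y | v y + (-(δ + τ)) < g y}, hΩ.inter (isOpen_lt (by fun_prop) hg),
          ⟨hp, ?_⟩, g, hgP.mono Set.inter_subset_left, fun y hy => ?_⟩
        · have := hle p hp3
          simp only [Set.mem_ofPred_eq]; linarith
        · simp only [g']
          split_ifs
          · exact max_eq_left (le_of_lt hy.2)
          · rfl
      · exact ⟨Ω \ Metric.closedBall a R, hΩ.sdiff Metric.isClosed_closedBall, ⟨hp, hp2⟩, g,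
          hgP.mono Set.sdiff_subset, fun y hy => if_neg hy.2⟩
  have h2 := hmax g' h1 (fun p hp => by
    simp only [g']
    split_ifs with hpb
    · refine max_le (hgf p) ?_
      rw [hf p hpb]
      linarith [hvδ p hpb]
    · exact hgf p) q (hball hq)
  simp only [g', if_pos hq] at h2
  linarith [(max_le_iff.1 h2).2]

end

noncomputable section

/-! ### Semiconcave regularization -/

theorem sqrt_second_diff_le {G : Type*} [NormedAddCommGroup G] [InnerProductSpace ℝ G] {s : ℝ}
    (hs : 0 < s) (z h : G) :
    √(s ^ 2 + ‖z + h‖ ^ 2) + √(s ^ 2 + ‖z - h‖ ^ 2) ≤ 2 * √(s ^ 2 + ‖z‖ ^ 2) + ‖h‖ ^ 2 / s := by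
  set α := √(s ^ 2 + ‖z‖ ^ 2) with hα
  have hα2 : α ^ 2 = s ^ 2 + ‖z‖ ^ 2 := Real.sq_sqrt (by positivity)
  have hsα : s ≤ α := Real.le_sqrt_of_sq_le (by nlinarith [sq_nonneg ‖z‖])
  have hα0 : 0 < α := hs.trans_le hsα
  have key : ∀ t : ℝ, 0 ≤ α ^ 2 + t → √(α ^ 2 + t) ≤ α + t / (2 * α) := fun t ht => by
    have h1 : 0 ≤ α + t / (2 * α) := by
      have : α + t / (2 * α) = (α ^ 2 + (α ^ 2 + t)) / (2 * α) := by field_simp; ring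
      rw [this]; positivity
    refine Real.sqrt_le_iff.2 ⟨h1, ?_⟩
    have : (α + t / (2 * α)) ^ 2 = α ^ 2 + t + (t / (2 * α)) ^ 2 := by field_simp; ring
    rw [this]; nlinarith [sq_nonneg (t / (2 * α))]
  have e1 : s ^ 2 + ‖z + h‖ ^ 2 = α ^ 2 + (2 * inner ℝ z h + ‖h‖ ^ 2) := by
    rw [hα2, norm_add_sq_real]; ring
  have e2 : s ^ 2 + ‖z - h‖ ^ 2 = α ^ 2 + (-(2 * inner ℝ z h) + ‖h‖ ^ 2) := by
    rw [hα2, norm_sub_sq_real]; ring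
  have k1 := key (2 * inner ℝ z h + ‖h‖ ^ 2) (by rw [← e1]; positivity)
  have k2 := key (-(2 * inner ℝ z h) + ‖h‖ ^ 2) (by rw [← e2]; positivity)
  rw [e1, e2]
  have e3 : (2 * inner ℝ z h + ‖h‖ ^ 2) / (2 * α) + (-(2 * inner ℝ z h) + ‖h‖ ^ 2) / (2 * α)
      = ‖h‖ ^ 2 / α := by field_simp; ring
  have e4 : ‖h‖ ^ 2 / α ≤ ‖h‖ ^ 2 / s := by gcongr
  linarith

theorem sqrt_add_sq_le {s x y : ℝ} (hy : 0 ≤ y) :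
    √(s ^ 2 + x ^ 2) ≤ √(s ^ 2 + y ^ 2) + |x - y| := by
  refine Real.sqrt_le_iff.2 ⟨by positivity, ?_⟩
  have h1 : √(s ^ 2 + y ^ 2) ^ 2 = s ^ 2 + y ^ 2 := Real.sq_sqrt (by positivity)
  have h2 : y ≤ √(s ^ 2 + y ^ 2) := Real.le_sqrt_of_sq_le (by nlinarith [sq_nonneg s])
  have h3 : |x - y| ^ 2 = (x - y) ^ 2 := sq_abs _
  have h4 := le_abs_self (x - y)
  nlinarith [abs_nonneg (x - y)]

/-- A uniformly continuous function is uniformly approximated from above by Lipschitz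
semiconcave functions. -/
theorem exists_semiconcave {E G : Type*} [NormedAddCommGroup E] [NormedSpace ℝ E]
    [NormedAddCommGroup G] [InnerProductSpace ℝ G] (e : E →L[ℝ] G) (he : ∀ z, ‖z‖ ≤ ‖e z‖)
    {F : E → ℝ} (hF : ∀ δ > 0, ∃ m > 0, ∀ x y, F x - F y ≤ δ + m * ‖x - y‖) {δ : ℝ} (hδ : 0 < δ) :
    ∃ f : E → ℝ, (∃ L, 0 ≤ L ∧ ∀ x y, f x ≤ f y + L * ‖x - y‖) ∧
      (∃ C, 0 ≤ C ∧ ∀ x h, f (x + h) + f (x - h) - 2 * f x ≤ C * ‖h‖ ^ 2) ∧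
      ∀ x, F x ≤ f x ∧ f x ≤ F x + δ := by
  obtain ⟨m, hm, hFm⟩ := hF (δ / 2) (by positivity)
  let s := δ / (2 * m)
  have hs : 0 < s := by positivity
  let θ : E → ℝ := fun z => m * (√(s ^ 2 + ‖e z‖ ^ 2) - s)
  have hθ0 : θ 0 = 0 := by simp [θ, Real.sqrt_sq hs.le]
  have hθ1 : ∀ z, m * ‖z‖ - δ / 2 ≤ θ z := fun z => by
    have h1 : ‖z‖ ≤ √(s ^ 2 + ‖e z‖ ^ 2) :=
      Real.le_sqrt_of_sq_le (by nlinarith [sq_nonneg s, he z, norm_nonneg z])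
    have h2 : m * s = δ / 2 := by simp only [s]; field_simp
    simp only [θ]
    nlinarith
  have hθL : ∀ z w, θ z ≤ θ w + m * ‖e‖ * ‖z - w‖ := fun z w => by
    have h1 := sqrt_add_sq_le (s := s) (x := ‖e z‖) (norm_nonneg (e w))
    have h2 : |‖e z‖ - ‖e w‖| ≤ ‖e‖ * ‖z - w‖ :=
      (abs_norm_sub_norm_le _ _).trans (by rw [← map_sub]; exact e.le_opNorm _)
    simp only [θ]
    nlinarith
  have hθC : ∀ z h, θ (z + h) + θ (z - h) ≤ 2 * θ z + m * ‖e‖ ^ 2 / s * ‖h‖ ^ 2 := fun z h => by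
    have h1 := sqrt_second_diff_le hs (e z) (e h)
    have h2 : ‖e h‖ ^ 2 / s ≤ (‖e‖ * ‖h‖) ^ 2 / s := by
      gcongr; exact e.le_opNorm _
    have h3 : m * ‖e‖ ^ 2 / s * ‖h‖ ^ 2 = m * ((‖e‖ * ‖h‖) ^ 2 / s) := by ring
    rw [h3]
    simp only [θ, map_add, map_sub]
    nlinarith
  have hlow : ∀ x y, F x - δ ≤ F y + θ (x - y) := fun x y => by
    linarith [hFm x y, hθ1 (x - y)]
  have hbdd : ∀ x, BddBelow (Set.range fun y => F y + θ (x - y)) := fun x =>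
    ⟨F x - δ, by rintro _ ⟨y, rfl⟩; exact hlow x y⟩
  have hle := fun x y => ciInf_le (hbdd x) y
  refine ⟨fun x => δ + ⨅ y, (F y + θ (x - y)), ⟨m * ‖e‖, by positivity, fun x x' => ?_⟩,
    ⟨m * ‖e‖ ^ 2 / s, by positivity, fun x h => ?_⟩, fun x => ⟨?_, ?_⟩⟩
  · have : (⨅ y, (F y + θ (x - y))) - m * ‖e‖ * ‖x - x'‖ ≤ ⨅ y, (F y + θ (x' - y)) := by
      refine le_ciInf fun y => ?_
      have h1 := hle x y
      have h2 := hθL (x - y) (x' - y)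
      rw [sub_sub_sub_cancel_right] at h2
      linarith
    linarith
  · have : ((⨅ y, (F y + θ (x + h - y))) + (⨅ y, (F y + θ (x - h - y))) -
        m * ‖e‖ ^ 2 / s * ‖h‖ ^ 2) / 2 ≤ ⨅ y, (F y + θ (x - y)) := by
      refine le_ciInf fun y => ?_
      have h1 := hle (x + h) y
      have h2 := hle (x - h) y
      have h3 := hθC (x - y) h
      rw [show x - y + h = x + h - y by abel, show x - y - h = x - h - y by abel] at h3
      linarith
    linarith
  · have : F x - δ ≤ ⨅ y, (F y + θ (x - y)) := le_ciInf fun y => hlow x y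
    linarith
  · have := hle x x
    rw [sub_self, hθ0] at this
    linarith

/-! ### Limits of functions with Lipschitz gradient -/

theorem abs_taylor_one_le {E : Type*} [NormedAddCommGroup E] [NormedSpace ℝ E] {P : E → ℝ}
    {A : E → E →L[ℝ] ℝ} (hP : ∀ x, HasFDerivAt P (A x) x) {K : ℝ} (hK : 0 ≤ K)
    (hA : ∀ x y, ‖A x - A y‖ ≤ K * ‖x - y‖) (x h : E) :
    |P (x + h) - P x - A x h| ≤ K * ‖h‖ * ‖h‖ := by
  have h1 := (convex_closedBall x ‖h‖).norm_image_sub_le_of_norm_hasFDerivWithin_le'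
    (f := P) (f' := A) (φ := A x) (C := K * ‖h‖) (fun y _ => (hP y).hasFDerivWithinAt)
    (fun y hy => (hA y x).trans (by
      rw [Metric.mem_closedBall, dist_eq_norm] at hy
      gcongr)) (Metric.mem_closedBall_self (norm_nonneg h))
    (show x + h ∈ _ by simp)
  simpa using h1

theorem exists_lipschitz_fderiv {E : Type*} [NormedAddCommGroup E] [NormedSpace ℝ E]
    [FiniteDimensional ℝ E] {P : E → ℝ} {Ps : ℕ → E → ℝ} {A : ℕ → E → E →L[ℝ] ℝ}
    (hP : ∀ j x, HasFDerivAt (Ps j) (A j x) x) {K L : ℝ} (hK : 0 ≤ K)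
    (hA : ∀ j x y, ‖A j x - A j y‖ ≤ K * ‖x - y‖) (hL : ∀ j x, ‖A j x‖ ≤ L)
    (hlim : ∀ x, Tendsto (fun j => Ps j x) atTop (𝓝 (P x))) :
    ∃ a : E → E →L[ℝ] ℝ, (∀ x y, ‖a x - a y‖ ≤ K * ‖x - y‖) ∧ ∀ x, HasFDerivAt P (a x) x := by
  have hF : (hyperfilter ℕ : Filter ℕ) ≤ atTop := Nat.hyperfilter_le_atTop
  have hex : ∀ x, ∃ a : E →L[ℝ] ℝ, Tendsto (fun j => A j x) (hyperfilter ℕ) (𝓝 a) := fun x => by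
    have := (isCompact_closedBall (0 : E →L[ℝ] ℝ) L).ultrafilter_le_nhds
      ((hyperfilter ℕ).map fun j => A j x) (by
        refine le_principal_iff.2 (Ultrafilter.mem_coe.2 (Ultrafilter.mem_map.2 ?_))
        exact Filter.univ_mem' fun j => by simpa using hL j x)
    obtain ⟨a, -, ha⟩ := this
    exact ⟨a, ha⟩
  choose a ha using hex
  refine ⟨a, fun x y => le_of_tendsto ((ha x).sub (ha y)).norm
    (Eventually.of_forall fun j => hA j x y), fun x => ?_⟩
  rw [hasFDerivAt_iff_isLittleO_nhds_zero]
  have hb : ∀ h, |P (x + h) - P x - a x h| ≤ K * ‖h‖ * ‖h‖ := fun h => by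
    have h1 : Tendsto (fun j => |Ps j (x + h) - Ps j x - A j x h|) (hyperfilter ℕ)
        (𝓝 |P (x + h) - P x - a x h|) :=
      ((((hlim (x + h)).mono_left hF).sub ((hlim x).mono_left hF)).sub
        (((ContinuousLinearMap.apply ℝ ℝ h).continuous.tendsto (a x)).comp (ha x))).abs
    exact le_of_tendsto h1 (Eventually.of_forall fun j => abs_taylor_one_le (hP j) hK (hA j) x h)
  refine Asymptotics.IsLittleO.of_bound fun c hc => ?_
  filter_upwards [Metric.ball_mem_nhds (0 : E) (show 0 < c / (K + 1) by positivity)] with h hh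
  rw [mem_ball_zero_iff, lt_div_iff₀ (by positivity)] at hh
  refine (hb h).trans ?_
  have : K * ‖h‖ ≤ c := by nlinarith [norm_nonneg h]
  gcongr

/-! ### Derivatives of convolutions with Lipschitz functions -/

theorem hasFDerivAt_integral_smul_sub {E F : Type*} [NormedAddCommGroup E] [NormedSpace ℝ E]
    [FiniteDimensional ℝ E] [MeasurableSpace E] [BorelSpace E] [NormedAddCommGroup F]
    [NormedSpace ℝ F] [FiniteDimensional ℝ F] (μ : Measure E) [μ.IsAddHaarMeasure]
    {χ : E → ℝ} (hχ : Continuous χ) (hχs : HasCompactSupport χ) (hχ0 : ∀ y, 0 ≤ χ y)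
    {a : E → F} {K : NNReal} (ha : LipschitzWith K a) (x : E) :
    HasFDerivAt (fun x => ∫ y, χ y • a (x - y) ∂μ) (∫ y, χ y • fderiv ℝ a (x - y) ∂μ) x := by
  have : ProperSpace (E →L[ℝ] F) := FiniteDimensional.proper_real _
  borelize (E →L[ℝ] F)
  have hχi : Integrable χ μ := hχ.integrable_of_hasCompactSupport hχs
  refine (hasFDerivAt_integral_of_dominated_loc_of_lip (μ := μ) (F := fun x y => χ y • a (x - y))
    (F' := fun y => χ y • fderiv ℝ a (x - y)) (bound := fun y => χ y * K) (s := Set.univ) univ_mem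
    (Eventually.of_forall fun x' => ?_) ?_ ?_ (Eventually.of_forall fun y => ?_) ?_ ?_).2
  · exact (hχ.smul (ha.continuous.comp (by fun_prop))).aestronglyMeasurable
  · refine (hχ.smul (ha.continuous.comp (by fun_prop))).integrable_of_hasCompactSupport ?_
    exact hχs.smul_right
  · refine hχ.aestronglyMeasurable.smul ?_
    exact ((measurable_fderiv ℝ a).comp (by fun_prop)).aestronglyMeasurable
  · refine LipschitzWith.lipschitzOnWith (LipschitzWith.of_dist_le_mul fun p q => ?_)
    rw [dist_smul₀, Real.norm_of_nonneg (hχ0 y), Real.coe_nnabs,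
      abs_of_nonneg (show 0 ≤ χ y * K from mul_nonneg (hχ0 y) K.2), mul_assoc]
    gcongr
    · exact hχ0 y
    · simpa using ha.dist_le_mul (p - y) (q - y)
  · exact hχi.mul_const _
  · have h1 : ∀ᵐ y ∂μ, DifferentiableAt ℝ a (x - y) :=
      (Measure.measurePreserving_sub_left μ x).quasiMeasurePreserving.ae ha.ae_differentiableAt
    filter_upwards [h1] with y hy
    have h2 : HasFDerivAt (fun x => a (x - y)) (fderiv ℝ a (x - y)) x := by
      have := hy.hasFDerivAt.comp x ((hasFDerivAt_id x).sub_const y)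
      simpa [Function.comp_def] using this
    exact h2.const_smul (χ y)

end

noncomputable section

/-! ### Second derivatives and second differences -/

theorem diag_le_of_second_diff {E : Type*} [NormedAddCommGroup E] [NormedSpace ℝ E] {f : E → ℝ}
    {f' : E → E →L[ℝ] ℝ} {H : E →L[ℝ] E →L[ℝ] ℝ} {x : E} (hf : ∀ y, HasFDerivAt f (f' y) y)
    (hH : HasFDerivAt f' H x) {C : ℝ} (hC : ∀ x h, f (x + h) + f (x - h) - 2 * f x ≤ C * ‖h‖ ^ 2)
    (v : E) : H v v ≤ C * ‖v‖ ^ 2 :=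
  second_deriv_le_of_touch (Eventually.of_forall hf) hH v _ (Eventually.of_forall fun s => by
    refine (hC x (s • v)).trans_eq ?_
    rw [norm_smul, mul_pow, Real.norm_eq_abs, sq_abs]; ring)

theorem abs_le_of_diag {E : Type*} [NormedAddCommGroup E] [NormedSpace ℝ E]
    {H : E →L[ℝ] E →L[ℝ] ℝ} (hs : ∀ v w, H v w = H w v) {M : ℝ} (hM : 0 ≤ M)
    (h : ∀ v, |H v v| ≤ M * ‖v‖ ^ 2) (v w : E) : |H v w| ≤ 2 * M * ‖v‖ * ‖w‖ := by
  have key : ∀ v w : E, ‖v‖ ≤ 1 → ‖w‖ ≤ 1 → |H v w| ≤ 2 * M := fun v w hv hw => by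
    have h1 := abs_le.1 (h (v + w))
    have h2 := abs_le.1 (h (v - w))
    have e1 : H (v + w) (v + w) = H v v + 2 * H v w + H w w := by
      simp only [map_add, add_apply, hs w v]; ring
    have e2 : H (v - w) (v - w) = H v v - 2 * H v w + H w w := by
      simp only [map_sub, sub_apply, hs w v]; ring
    have n1 : ‖v + w‖ ^ 2 ≤ 4 := by nlinarith [norm_add_le v w, norm_nonneg (v + w)]
    have n2 : ‖v - w‖ ^ 2 ≤ 4 := by nlinarith [norm_sub_le v w, norm_nonneg (v - w)]
    have m1 := mul_le_mul_of_nonneg_left n1 hM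
    have m2 := mul_le_mul_of_nonneg_left n2 hM
    rw [e1] at h1
    rw [e2] at h2
    rw [abs_le]
    constructor <;> linarith
  rcases eq_or_ne v 0 with rfl | hv
  · simp
  rcases eq_or_ne w 0 with rfl | hw
  · simp
  have hv' := norm_pos_iff.2 hv
  have hw' := norm_pos_iff.2 hw
  have h1 := key (‖v‖⁻¹ • v) (‖w‖⁻¹ • w)
      (by rw [norm_smul, norm_inv, norm_norm, inv_mul_cancel₀ hv'.ne'])
    (by rw [norm_smul, norm_inv, norm_norm, inv_mul_cancel₀ hw'.ne'])
  rw [map_smul, map_smul, smul_apply, smul_eq_mul, smul_eq_mul, abs_mul, abs_mul,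
    abs_of_pos (inv_pos.2 hv'), abs_of_pos (inv_pos.2 hw')] at h1
  have e : |(H v) w| = ‖v‖ * ‖w‖ * (‖w‖⁻¹ * (‖v‖⁻¹ * |(H v) w|)) := by field_simp
  rw [e]
  calc _ ≤ ‖v‖ * ‖w‖ * (2 * M) := by gcongr
    _ = _ := by ring

/-! ### Mollification -/

section Mollify

set_option linter.unusedSectionVars false

variable {E F : Type*} [NormedAddCommGroup E] [NormedSpace ℝ E] [FiniteDimensional ℝ E]
  [MeasurableSpace E] [BorelSpace E] [NormedAddCommGroup F] [NormedSpace ℝ F]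
  [FiniteDimensional ℝ F] (μ : Measure E) [μ.IsAddHaarMeasure]

/-- Bump functions with radii tending to zero. -/
def bumpSeq (E : Type*) [NormedAddCommGroup E] (j : ℕ) : ContDiffBump (0 : E) where
  rIn := 1 / (j + 1) / 2
  rOut := 1 / (j + 1)
  rIn_pos := by positivity
  rIn_lt_rOut := half_lt_self (by positivity)

/-- The normalized bump functions. -/
def bumpN (j : ℕ) : E → ℝ := (bumpSeq E j).normed μ

/-- Mollification. -/
def mollify (j : ℕ) (P : E → F) (x : E) : F := ∫ y, bumpN μ j y • P (x - y) ∂μ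

theorem bumpN_continuous (j : ℕ) : Continuous (bumpN μ j) := (bumpSeq E j).continuous_normed

theorem bumpN_compact (j : ℕ) : HasCompactSupport (bumpN μ j) :=
  (bumpSeq E j).hasCompactSupport_normed

theorem bumpN_nonneg (j : ℕ) (y : E) : 0 ≤ bumpN μ j y := (bumpSeq E j).nonneg_normed y

theorem bumpN_integral (j : ℕ) : ∫ y, bumpN μ j y ∂μ = 1 := (bumpSeq E j).integral_normed

theorem mollify_contDiff (j : ℕ) {P : E → F} (hP : Continuous P) :
    ContDiff ℝ (⊤ : ℕ∞) (mollify μ j P) :=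
  (bumpN_compact μ j).contDiff_convolution_left (ContinuousLinearMap.lsmul ℝ ℝ)
    (bumpSeq E j).contDiff_normed hP.locallyIntegrable

theorem dist_mollify_le (j : ℕ) {P : E → F} (hP : Continuous P) {x : E} {ε : ℝ}
    (h : ∀ y ∈ Metric.ball x (1 / (j + 1)), dist (P y) (P x) ≤ ε) :
    dist (mollify μ j P x) (P x) ≤ ε :=
  (bumpSeq E j).dist_normed_convolution_le hP.aestronglyMeasurable h

theorem bumpN_integrable_smul (j : ℕ) {P : E → F} (hP : Continuous P) (x : E) :
    Integrable (fun y => bumpN μ j y • P (x - y)) μ :=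
  ((bumpN_continuous μ j).smul (hP.comp (by fun_prop))).integrable_of_hasCompactSupport
    (bumpN_compact μ j).smul_right

theorem ae_tendsto_mollify {P : E → F} (hP : LocallyIntegrable P μ) :
    ∀ᵐ x ∂μ, Tendsto (fun j => mollify μ j P x) atTop (𝓝 (P x)) :=
  ContDiffBump.ae_convolution_tendsto_right_of_locallyIntegrable (φ := bumpSeq E) (K := 2)
    tendsto_one_div_add_atTop_nhds_zero_nat
    (Eventually.of_forall fun j => by simp only [bumpSeq]; linarith) hP

theorem mollify_lipschitz (j : ℕ) {P : E → F} {L : ℝ} (hL : ∀ x y, ‖P x - P y‖ ≤ L * ‖x - y‖)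
    (hP : Continuous P) (x y : E) : ‖mollify μ j P x - mollify μ j P y‖ ≤ L * ‖x - y‖ := by
  simp only [mollify]
  rw [← integral_sub (bumpN_integrable_smul μ j hP x) (bumpN_integrable_smul μ j hP y)]
  have h1 : Integrable (fun z => bumpN μ j z * (L * ‖x - y‖)) μ :=
    (bumpSeq E j).integrable_normed.mul_const _
  refine (norm_integral_le_of_norm_le h1 (Eventually.of_forall fun z => ?_)).trans_eq ?_
  · rw [← smul_sub, norm_smul, Real.norm_of_nonneg (bumpN_nonneg μ j z)]
    refine mul_le_mul_of_nonneg_left ?_ (bumpN_nonneg μ j z)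
    simpa using hL (x - z) (y - z)
  · rw [integral_mul_const, bumpN_integral, one_mul]

theorem mollify_second_diff (j : ℕ) {P : E → ℝ} (hP : Continuous P) {C : ℝ}
    (hC : ∀ x h, P (x + h) + P (x - h) - 2 * P x ≤ C * ‖h‖ ^ 2) (x h : E) :
    mollify μ j P (x + h) + mollify μ j P (x - h) - 2 * mollify μ j P x ≤ C * ‖h‖ ^ 2 := by
  have i := bumpN_integrable_smul μ j hP
  simp only [mollify]
  have e : (∫ y, (bumpN μ j y • P (x + h - y) + bumpN μ j y • P (x - h - y) -
      2 * bumpN μ j y • P (x - y)) ∂μ) = (∫ y, bumpN μ j y • P (x + h - y) ∂μ) +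
      (∫ y, bumpN μ j y • P (x - h - y) ∂μ) - 2 * ∫ y, bumpN μ j y • P (x - y) ∂μ := by
    have i2 : Integrable (fun y => bumpN μ j y • P (x + h - y) + bumpN μ j y • P (x - h - y)) μ :=
      (i _).add (i _)
    rw [integral_sub i2 ((i _).const_mul 2), integral_add (i _) (i _),
      integral_const_mul]
  rw [← e]
  have h1 : Integrable (fun z => bumpN μ j z * (C * ‖h‖ ^ 2)) μ :=
    (bumpSeq E j).integrable_normed.mul_const _
  refine (integral_mono (((i _).add (i _)).sub ((i _).const_mul 2)) h1 fun z => ?_).trans_eq ?_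
  · have := mul_le_mul_of_nonneg_left (hC (x - z) h) (bumpN_nonneg μ j z)
    rw [show x - z + h = x + h - z by abel, show x - z - h = x - h - z by abel] at this
    simp only [Pi.sub_apply, Pi.add_apply, smul_eq_mul]
    linarith
  · rw [integral_mul_const, bumpN_integral, one_mul]

theorem mollify_hasFDerivAt (j : ℕ) {P : E → ℝ} (hP : Continuous P) (x : E) :
    HasFDerivAt (mollify μ j P) (fderiv ℝ (mollify μ j P) x) x :=
  ((mollify_contDiff μ j hP).differentiable (by simp) x).hasFDerivAt

theorem mollify_hasFDerivAt_fderiv (j : ℕ) {P : E → ℝ} (hP : Continuous P) (x : E) :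
    HasFDerivAt (fderiv ℝ (mollify μ j P)) (fderiv ℝ (fderiv ℝ (mollify μ j P)) x) x :=
  (((mollify_contDiff μ j hP).fderiv_right (m := 1) (by norm_cast)).differentiable
    (by simp) x).hasFDerivAt

theorem aestronglyMeasurable_fderiv' (a : E → F) : AEStronglyMeasurable (fderiv ℝ a) μ := by
  have : ProperSpace (E →L[ℝ] F) := FiniteDimensional.proper_real _
  borelize (E →L[ℝ] F)
  exact (measurable_fderiv ℝ a).aestronglyMeasurable

/-- If the Hessians of the mollifications of a Lipschitz function are uniformly bounded, then
the function is differentiable with Lipschitz gradient, and the Hessians converge almost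
everywhere to the derivative of the gradient. -/
theorem exists_gradient {P : E → ℝ} {L : ℝ} (hL : ∀ x y, ‖P x - P y‖ ≤ L * ‖x - y‖)
    (hL0 : 0 ≤ L) {K : ℝ} (hK0 : 0 ≤ K)
    (hK : ∀ j x v w, |fderiv ℝ (fderiv ℝ (mollify μ j P)) x v w| ≤ K * ‖v‖ * ‖w‖) :
    ∃ a : E → E →L[ℝ] ℝ, (∀ x, HasFDerivAt P (a x) x) ∧ (∀ᵐ x ∂μ, DifferentiableAt ℝ a x) ∧
      ∀ᵐ x ∂μ, ∀ v w, Tendsto (fun j => fderiv ℝ (fderiv ℝ (mollify μ j P)) x v w) atTop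
        (𝓝 (fderiv ℝ a x v w)) := by
  have hlip : LipschitzWith ⟨L, hL0⟩ P := LipschitzWith.of_dist_le_mul fun x y => by
    rw [dist_eq_norm, dist_eq_norm]; exact hL x y
  have hP := hlip.continuous
  have hlim : ∀ x, Tendsto (fun j => mollify μ j P x) atTop (𝓝 (P x)) := fun x => by
    refine tendsto_iff_dist_tendsto_zero.2 (squeeze_zero (fun _ => dist_nonneg)
      (g := fun j : ℕ => L * (1 / ((j : ℝ) + 1))) (fun j => ?_) ?_)
    · refine dist_mollify_le μ j hP fun y hy => (hlip.dist_le_mul y x).trans ?_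
      exact mul_le_mul_of_nonneg_left (le_of_lt hy) hL0
    · simpa using tendsto_one_div_add_atTop_nhds_zero_nat.const_mul L
  obtain ⟨a, haK, ha⟩ := exists_lipschitz_fderiv (Ps := fun j => mollify μ j P)
    (A := fun j => fderiv ℝ (mollify μ j P)) (K := K) (L := L)
    (fun j x => mollify_hasFDerivAt μ j hP x) hK0
    (fun j x y => convex_univ.norm_image_sub_le_of_norm_fderiv_le
      (fun z _ => (mollify_hasFDerivAt_fderiv μ j hP z).differentiableAt)
      (fun z _ => ContinuousLinearMap.opNorm_le_bound₂ _ hK0 (hK j z))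
      (Set.mem_univ y) (Set.mem_univ x))
    (fun j x => norm_fderiv_le_of_lip' ℝ hL0
      (Eventually.of_forall fun y => mollify_lipschitz μ j hL hP y x)) hlim
  have halip : LipschitzWith ⟨K, hK0⟩ a := LipschitzWith.of_dist_le_mul fun x y => by
    rw [dist_eq_norm, dist_eq_norm]; exact haK x y
  have e1 : ∀ j x, fderiv ℝ (mollify μ j P) x = mollify μ j a x := fun j x => by
    have := hasFDerivAt_integral_smul_sub μ (bumpN_continuous μ j) (bumpN_compact μ j)
      (bumpN_nonneg μ j) hlip x
    simp only [(ha _).fderiv] at this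
    exact this.fderiv
  have e2 : ∀ j x, fderiv ℝ (fderiv ℝ (mollify μ j P)) x = mollify μ j (fderiv ℝ a) x :=
    fun j x => by
      have := hasFDerivAt_integral_smul_sub μ (bumpN_continuous μ j) (bumpN_compact μ j)
        (bumpN_nonneg μ j) halip x
      rw [show fderiv ℝ (mollify μ j P) = mollify μ j a from funext (e1 j)]
      exact this.fderiv
  refine ⟨a, ha, halip.ae_differentiableAt, ?_⟩
  simp only [e2]
  suffices h : ∀ᵐ x ∂μ, Tendsto (fun j => mollify μ j (fderiv ℝ a) x) atTop (𝓝 (fderiv ℝ a x)) by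
    filter_upwards [h] with x hx v w
    exact (((ContinuousLinearMap.apply ℝ ℝ w).continuous.tendsto _).comp
      (((ContinuousLinearMap.apply ℝ (E →L[ℝ] ℝ) v).continuous.tendsto _).comp hx))
  refine ae_tendsto_mollify μ ?_
  refine (locallyIntegrable_const K).mono (aestronglyMeasurable_fderiv' μ a)
    (Eventually.of_forall fun x => ?_)
  rw [Real.norm_of_nonneg hK0]
  exact norm_fderiv_le_of_lipschitz ℝ halip

end Mollify

end

noncomputable section

/-! ### Mollification of plurisubharmonic functions -/

instance : (volume : Measure ℍ).IsAddHaarMeasure :=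
  (Quaternion.linearIsometryEquivTuple.symm.toContinuousLinearEquiv).isAddHaarMeasure_map volume

theorem qpshr_mollify {n : ℕ} {P : Hn n → ℝ} (hP : Continuous P) (hP' : QPSHr P Set.univ)
    (j : ℕ) : QPSHr (mollify (volume : Measure (Hn n)) j P) Set.univ := by
  let χ : Hn n → ℝ := bumpN volume j
  have hχ : Continuous χ := bumpN_continuous _ j
  have hm : Measurable fun z => ENNReal.ofReal (χ z) := hχ.measurable.ennreal_ofReal
  let ν : Measure (Hn n) := volume.withDensity fun z => ENNReal.ofReal (χ z)
  have : IsProbabilityMeasure ν := ⟨by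
    rw [withDensity_apply _ MeasurableSet.univ, Measure.restrict_univ,
      ← ofReal_integral_eq_lintegral_ofReal
        (hχ.integrable_of_hasCompactSupport (bumpN_compact _ j))
        (Eventually.of_forall (bumpN_nonneg _ j)), bumpN_integral, ENNReal.ofReal_one]⟩
  have e : ∀ q, ∫ z, P (q - z) ∂ν = mollify volume j P q := fun q => by
    simp only [ν, mollify]
    rw [integral_withDensity_eq_integral_toReal_smul hm
      (Eventually.of_forall fun z => ENNReal.ofReal_lt_top)]
    refine integral_congr_ae (Eventually.of_forall fun z => ?_)
    simp only [χ]
    rw [ENNReal.toReal_ofReal (bumpN_nonneg _ j z)]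
  have h := qpshr_average hP hP' ν (K := tsupport χ) (bumpN_compact _ j) ?_ ?_
  · simpa only [e] using h
  · rw [ae_withDensity_iff hm]
    refine Eventually.of_forall fun z hz => subset_tsupport _ fun h0 => hz ?_
    rw [h0, ENNReal.ofReal_zero]
  · simp only [e]
    exact (mollify_contDiff _ j hP).continuous

theorem norm_unitQ_lineL {n : ℕ} (v : Hn n) (m : Fin 4) : ‖lineL v (unitQ m)‖ = ‖v‖ := by
  rw [norm_lineL, norm_unitQ, mul_one]

theorem lineL_one {n : ℕ} (v : Hn n) : lineL v (unitQ 0) = v := by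
  ext k : 1
  exact mul_one (v k)

theorem abs_hessian_le {n : ℕ} {H : Hn n →L[ℝ] Hn n →L[ℝ] ℝ} (hs : ∀ v w, H v w = H w v)
    (hH : ∀ b, 0 ≤ traceQ (pullL H b)) {C : ℝ} (hC0 : 0 ≤ C) (hC : ∀ v, H v v ≤ C * ‖v‖ ^ 2) :
    ∀ v w, |H v w| ≤ 2 * (3 * C) * ‖v‖ * ‖w‖ := by
  refine abs_le_of_diag hs (by positivity) fun v => abs_le.2 ⟨?_, ?_⟩
  · have h0 := hH v
    simp only [traceQ, Fin.sum_univ_four] at h0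
    change 0 ≤ H (lineL v (unitQ 0)) (lineL v (unitQ 0)) +
      H (lineL v (unitQ 1)) (lineL v (unitQ 1)) + H (lineL v (unitQ 2)) (lineL v (unitQ 2)) +
      H (lineL v (unitQ 3)) (lineL v (unitQ 3)) at h0
    have h1 := hC (lineL v (unitQ 1))
    have h2 := hC (lineL v (unitQ 2))
    have h3 := hC (lineL v (unitQ 3))
    rw [norm_unitQ_lineL] at h1 h2 h3
    rw [lineL_one] at h0
    linarith
  · have := mul_nonneg hC0 (sq_nonneg ‖v‖)
    linarith [hC v]

theorem abs_hessian_mollify_le {n : ℕ} {P : Hn n → ℝ} (hP : Continuous P)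
    (hP' : QPSHr P Set.univ) {C : ℝ} (hC0 : 0 ≤ C)
    (hC : ∀ x h, P (x + h) + P (x - h) - 2 * P x ≤ C * ‖h‖ ^ 2) (j : ℕ) (x : Hn n) :
    ∀ v w, |fderiv ℝ (fderiv ℝ (mollify (volume : Measure (Hn n)) j P)) x v w| ≤
      2 * (3 * C) * ‖v‖ * ‖w‖ := by
  have h1 := mollify_hasFDerivAt (volume : Measure (Hn n)) j hP
  have h2 := mollify_hasFDerivAt_fderiv (volume : Measure (Hn n)) j hP x
  refine abs_hessian_le (second_derivative_symmetric h1 h2) ?_ hC0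
    (diag_le_of_second_diff h1 h2 (mollify_second_diff _ j hP hC))
  exact (qpshr_mollify hP hP' j).traceQ_nonneg isOpen_univ (Set.mem_univ x)
    (Eventually.of_forall h1) h2

end

noncomputable section

/-! ### Algebra of the quaternionic Monge–Ampère density -/

theorem hasFDerivAt_ofReal {E : Type*} [NormedAddCommGroup E] [NormedSpace ℝ E]
    {f : E → ℝ} {f' : E →L[ℝ] ℝ} {x : E} (h : HasFDerivAt f f' x) (v : E) :
    fderiv ℝ (fun y => (f y : ℂ)) x v = (f' v : ℂ) := by
  have := (Complex.ofRealCLM.hasFDerivAt (x := f x)).comp x h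
  have h2 : HasFDerivAt (fun y => (f y : ℂ)) (Complex.ofRealCLM.comp f') x := this
  rw [h2.fderiv]
  rfl

theorem fderiv_combination {E : Type*} [NormedAddCommGroup E] [NormedSpace ℝ E]
    {f' : E → E →L[ℝ] ℝ} {H : E →L[ℝ] E →L[ℝ] ℝ} {x : E} (h : HasFDerivAt f' H x)
    {ι : Type*} [Fintype ι] (c : ι → ℂ) (d : ι → E) (v : E) :
    fderiv ℝ (fun y => ∑ m, c m * (f' y (d m) : ℂ)) x v = ∑ m, c m * (H v (d m) : ℂ) := by
  have h1 : ∀ m, HasFDerivAt (fun y => c m * (f' y (d m) : ℂ))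
      (c m • (Complex.ofRealCLM.comp
        ((ContinuousLinearMap.apply ℝ ℝ (d m)).comp H))) x := fun m => by
    have := ((Complex.ofRealCLM.comp
      (ContinuousLinearMap.apply ℝ ℝ (d m))).hasFDerivAt (x := f' x)).comp x h
    exact this.const_mul (c m)
  have h2 := HasFDerivAt.fun_sum (u := Finset.univ) fun m _ => h1 m
  rw [h2.fderiv, sum_apply]
  rfl

/-- The coefficients of the first-order operators `∇_{jα}` in real coordinates. -/
def coeffQ (j : ℕ) (α : Fin 2) : Fin 4 → ℂ :=
  if j % 2 = 0 then (if α = 0 then ![1, Complex.I, 0, 0] else ![0, 0, -1, -Complex.I])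
  else (if α = 0 then ![0, 0, 1, -Complex.I] else ![1, -Complex.I, 0, 0])

/-- The quaternionic coordinate to which the complex index `j` belongs. -/
def blockQ {n : ℕ} (j : Fin (2 * n)) : Fin n := ⟨j.val / 2, by omega⟩

theorem nablaQ_eq {n : ℕ} (j : Fin (2 * n)) (α : Fin 2) (f : Hn n → ℂ) (q : Hn n) :
    nablaQ j α f q = ∑ m, coeffQ j.val α m * fderiv ℝ f q (dirQ (blockQ j) m) := by
  simp only [nablaQ, coeffQ, pdQ, blockQ, Fin.sum_univ_four]
  split_ifs <;> simp <;> ring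

/-- The real bilinear form `H` evaluated on the directions of `∇_{iα}` and `∇_{jβ}`. -/
def formQ {n : ℕ} (H : Hn n →L[ℝ] Hn n →L[ℝ] ℝ) (i : Fin (2 * n)) (α : Fin 2)
    (j : Fin (2 * n)) (β : Fin 2) : ℂ :=
  ∑ m, ∑ k, coeffQ i.val α m * coeffQ j.val β k *
    (H (dirQ (blockQ i) m) (dirQ (blockQ j) k) : ℂ)

/-- The Baston coefficients of a function with second derivative `H`. -/
def bastonForm {n : ℕ} (H : Hn n →L[ℝ] Hn n →L[ℝ] ℝ) (i j : Fin (2 * n)) : ℂ :=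
  (1 / 2 : ℂ) * (formQ H i 0 j 1 - formQ H i 1 j 0)

/-- The Monge–Ampère density of a function with second derivative `H`. -/
def densForm {n : ℕ} (H : Hn n →L[ℝ] Hn n →L[ℝ] ℝ) : ℝ :=
  (∑ σ : Fin n → Fin (2 * n) × Fin (2 * n),
    permSignC (flattenQ σ) * ∏ k : Fin n, bastonForm H (σ k).1 (σ k).2).re

theorem nablaQ_nablaQ {n : ℕ} {u : Hn n → ℝ} {u' : Hn n → Hn n →L[ℝ] ℝ}
    {H : Hn n →L[ℝ] Hn n →L[ℝ] ℝ} {q : Hn n} (hu : ∀ x, HasFDerivAt u (u' x) x)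
    (hH : HasFDerivAt u' H q) (i j : Fin (2 * n)) (α β : Fin 2) :
    nablaQ i α (fun x => nablaQ j β (fun y => (u y : ℂ)) x) q = formQ H i α j β := by
  have h1 : (fun x => nablaQ j β (fun y => (u y : ℂ)) x) =
      fun x => ∑ k, coeffQ j.val β k * (u' x (dirQ (blockQ j) k) : ℂ) := by
    ext x
    rw [nablaQ_eq]
    exact Finset.sum_congr rfl fun k _ => by rw [hasFDerivAt_ofReal (hu x)]
  rw [h1, nablaQ_eq, formQ]
  refine Finset.sum_congr rfl fun m _ => ?_
  rw [fderiv_combination hH, Finset.mul_sum]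
  exact Finset.sum_congr rfl fun k _ => by ring

theorem maDensity_eq_densForm {n : ℕ} {u : Hn n → ℝ} {u' : Hn n → Hn n →L[ℝ] ℝ}
    {H : Hn n →L[ℝ] Hn n →L[ℝ] ℝ} {q : Hn n} (hu : ∀ x, HasFDerivAt u (u' x) x)
    (hH : HasFDerivAt u' H q) : maDensity (fun _ => u) q = densForm H := by
  simp only [maDensity, densForm, bastonQ, bastonForm, nablaQ_nablaQ hu hH]

theorem formQ_symm {n : ℕ} {H : Hn n →L[ℝ] Hn n →L[ℝ] ℝ} (hs : ∀ v w, H v w = H w v)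
    (i j : Fin (2 * n)) (α β : Fin 2) : formQ H i α j β = formQ H j β i α := by
  rw [formQ, formQ, Finset.sum_comm]
  refine Finset.sum_congr rfl fun m _ => Finset.sum_congr rfl fun k _ => ?_
  rw [hs]
  ring

theorem bastonForm_antisymm {n : ℕ} {H : Hn n →L[ℝ] Hn n →L[ℝ] ℝ}
    (hs : ∀ v w, H v w = H w v) (i j : Fin (2 * n)) :
    bastonForm H j i = -bastonForm H i j := by
  rw [bastonForm, bastonForm, formQ_symm hs j i, formQ_symm hs j i]
  ring

theorem exists_flattenQ_eq {n : ℕ} {σ : Fin n → Fin (2 * n) × Fin (2 * n)}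
    (j : Fin (2 * n)) :
    flattenQ σ j = (σ (blockQ j)).1 ∨ flattenQ σ j = (σ (blockQ j)).2 := by
  rw [flattenQ]
  split_ifs
  · exact Or.inl rfl
  · exact Or.inr rfl

theorem flattenQ_even {n : ℕ} (σ : Fin n → Fin (2 * n) × Fin (2 * n)) (k : Fin n) :
    flattenQ σ ⟨2 * k.val, by omega⟩ = (σ k).1 := by
  have h1 : 2 * k.val % 2 = 0 := by omega
  have h2 : 2 * k.val / 2 = k.val := by omega
  simp [flattenQ, h1, h2]

theorem flattenQ_odd {n : ℕ} (σ : Fin n → Fin (2 * n) × Fin (2 * n)) (k : Fin n) :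
    flattenQ σ ⟨2 * k.val + 1, by omega⟩ = (σ k).2 := by
  have h1 : (2 * k.val + 1) % 2 ≠ 0 := by omega
  have h2 : (2 * k.val + 1) / 2 = k.val := by omega
  simp [flattenQ, h2]

theorem flattenQ_map {n : ℕ} (σ : Fin n → Fin (2 * n) × Fin (2 * n))
    (r : Fin (2 * n) → Fin (2 * n)) :
    flattenQ (fun k => (r (σ k).1, r (σ k).2)) = r ∘ flattenQ σ := by
  ext j
  simp only [flattenQ, Function.comp]
  split_ifs <;> rfl

theorem permSignC_swap_comp {m : ℕ} (f : Fin m → Fin m) {a b : Fin m} (hab : a ≠ b) :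
    permSignC (Equiv.swap a b ∘ f) = -permSignC f := by
  unfold permSignC
  by_cases h : Function.Bijective f
  · have h' : Function.Bijective (Equiv.swap a b ∘ f) := (Equiv.swap a b).bijective.comp h
    rw [dif_pos h, dif_pos h']
    have : Equiv.ofBijective _ h' = Equiv.swap a b * Equiv.ofBijective f h := by
      ext x; rfl
    rw [this, Equiv.Perm.sign_mul, Equiv.Perm.sign_swap hab]
    simp
  · have h' : ¬ Function.Bijective (Equiv.swap a b ∘ f) := fun h' => h <| by
      have := (Equiv.swap a b).bijective.comp h'
      convert this using 1
      ext x; simp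
    rw [dif_neg h, dif_neg h', neg_zero]

/-- Substituting the index `i` for `i₀` everywhere kills the Pfaffian-type sum. -/
theorem sum_permSignC_update_eq_zero {n : ℕ} (A : Fin (2 * n) → Fin (2 * n) → ℂ)
    {i₀ i : Fin (2 * n)} (hi : i ≠ i₀) :
    ∑ σ : Fin n → Fin (2 * n) × Fin (2 * n), permSignC (flattenQ σ) *
      ∏ k, A (if (σ k).1 = i₀ then i else (σ k).1) (if (σ k).2 = i₀ then i else (σ k).2) = 0 := by
  set τ := Equiv.swap i₀ i with hτ
  have hr : ∀ x, (if τ x = i₀ then i else τ x) = if x = i₀ then i else x := fun x => by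
    rcases eq_or_ne x i₀ with rfl | h1
    · simp [hτ, hi]
    · rcases eq_or_ne x i with rfl | h2
      · simp [hτ, h1]
      · simp [hτ, Equiv.swap_apply_of_ne_of_ne h1 h2]
  let e : (Fin n → Fin (2 * n) × Fin (2 * n)) ≃ (Fin n → Fin (2 * n) × Fin (2 * n)) :=
    Equiv.piCongrRight fun _ => Equiv.prodCongr τ τ
  have h := e.sum_comp fun σ => permSignC (flattenQ σ) *
      ∏ k, A (if (σ k).1 = i₀ then i else (σ k).1) (if (σ k).2 = i₀ then i else (σ k).2)
  have h3 : ∀ σ, permSignC (flattenQ (e σ)) = -permSignC (flattenQ σ) := fun σ => by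
    rw [← permSignC_swap_comp _ (Ne.symm hi), ← flattenQ_map]
    rfl
  have h4 : ∀ σ k, (e σ k) = (τ (σ k).1, τ (σ k).2) := fun σ k => rfl
  simp only [h3, h4, hr, neg_mul, Finset.sum_neg_distrib] at h
  exact self_eq_neg.1 h.symm

theorem prod_update_eq_zero {n : ℕ} {A : Fin (2 * n) → Fin (2 * n) → ℂ}
    (hA : ∀ i j, A j i = -A i j) {v : Fin (2 * n) → ℂ} (hv : ∀ j, ∑ i, v i * A i j = 0)
    (i₀ : Fin (2 * n)) {σ : Fin n → Fin (2 * n) × Fin (2 * n)}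
    (hσ : Function.Bijective (flattenQ σ)) :
    ∑ i, v i * ∏ k, A (if (σ k).1 = i₀ then i else (σ k).1)
      (if (σ k).2 = i₀ then i else (σ k).2) = 0 := by
  obtain ⟨j, hj⟩ := hσ.2 i₀
  have key : ∀ k₀ : Fin n, (∀ k ≠ k₀, (σ k).1 ≠ i₀ ∧ (σ k).2 ≠ i₀) →
      (∑ i, v i * A (if (σ k₀).1 = i₀ then i else (σ k₀).1)
        (if (σ k₀).2 = i₀ then i else (σ k₀).2) = 0) →
      ∑ i, v i * ∏ k, A (if (σ k).1 = i₀ then i else (σ k).1)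
        (if (σ k).2 = i₀ then i else (σ k).2) = 0 := fun k₀ hk h0 => by
    have h1 : ∀ i, v i * ∏ k, A (if (σ k).1 = i₀ then i else (σ k).1)
        (if (σ k).2 = i₀ then i else (σ k).2) =
        (v i * A (if (σ k₀).1 = i₀ then i else (σ k₀).1)
        (if (σ k₀).2 = i₀ then i else (σ k₀).2)) *
        ∏ k ∈ Finset.univ.erase k₀, A (σ k).1 (σ k).2 := fun i => by
      rw [← Finset.mul_prod_erase _ _ (Finset.mem_univ k₀), mul_assoc]
      congr 2
      refine Finset.prod_congr rfl fun k hk' => ?_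
      obtain ⟨h1, h2⟩ := hk k (Finset.ne_of_mem_erase hk')
      rw [if_neg h1, if_neg h2]
    simp_rw [h1]
    rw [← Finset.sum_mul, h0, zero_mul]
  have hfst : ∀ k, (σ k).1 = i₀ → (⟨2 * k.val, by omega⟩ : Fin (2 * n)) = j := fun k hk =>
    hσ.1 (by rw [flattenQ_even, hj, hk])
  have hsnd : ∀ k, (σ k).2 = i₀ → (⟨2 * k.val + 1, by omega⟩ : Fin (2 * n)) = j := fun k hk =>
    hσ.1 (by rw [flattenQ_odd, hj, hk])
  have hne : ∀ k ≠ blockQ j, (σ k).1 ≠ i₀ ∧ (σ k).2 ≠ i₀ := fun k hk => by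
    constructor
    · intro h
      apply hk
      rw [← hfst k h]
      ext
      simp [blockQ]
    · intro h
      apply hk
      rw [← hsnd k h]
      ext
      simp only [blockQ]
      omega
  refine key _ hne ?_
  rcases exists_flattenQ_eq (σ := σ) j with h | h
  · have h1 : (σ (blockQ j)).1 = i₀ := by rw [← h, hj]
    have h2 : (σ (blockQ j)).2 ≠ i₀ := fun h2 => by
      have e := (hfst _ h1).trans (hsnd _ h2).symm
      rw [Fin.mk.injEq] at e
      omega
    simp only [if_pos h1, if_neg h2]
    exact hv _
  · have h1 : (σ (blockQ j)).2 = i₀ := by rw [← h, hj]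
    have h2 : (σ (blockQ j)).1 ≠ i₀ := fun h2 => by
      have e := (hfst _ h2).trans (hsnd _ h1).symm
      rw [Fin.mk.injEq] at e
      omega
    simp only [if_pos h1, if_neg h2]
    simp only [hA _ (σ (blockQ j)).1, mul_neg, Finset.sum_neg_distrib]
    have := hv (σ (blockQ j)).1
    simp only [hA (σ (blockQ j)).1, mul_neg, Finset.sum_neg_distrib] at this ⊢
    simpa using this

theorem sum_permSignC_eq_zero {n : ℕ} {A : Fin (2 * n) → Fin (2 * n) → ℂ}
    (hA : ∀ i j, A j i = -A i j) {v : Fin (2 * n) → ℂ} (hv : ∀ j, ∑ i, v i * A i j = 0)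
    (hv0 : v ≠ 0) :
    ∑ σ : Fin n → Fin (2 * n) × Fin (2 * n), permSignC (flattenQ σ) *
      ∏ k, A (σ k).1 (σ k).2 = 0 := by
  obtain ⟨i₀, hi₀⟩ := Function.ne_iff.1 hv0
  let T : Fin (2 * n) → (Fin n → Fin (2 * n) × Fin (2 * n)) → ℂ := fun i σ =>
    ∏ k, A (if (σ k).1 = i₀ then i else (σ k).1) (if (σ k).2 = i₀ then i else (σ k).2)
  have h1 : ∀ σ, permSignC (flattenQ σ) * ∑ i, v i * T i σ = 0 := fun σ => by
    by_cases h : Function.Bijective (flattenQ σ)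
    · rw [prod_update_eq_zero hA hv i₀ h, mul_zero]
    · rw [permSignC, dif_neg h, zero_mul]
  have h2 : ∑ i, v i * ∑ σ, permSignC (flattenQ σ) * T i σ = 0 := by
    rw [← Finset.sum_eq_zero fun σ _ => h1 σ]
    simp_rw [Finset.mul_sum]
    rw [Finset.sum_comm]
    exact Finset.sum_congr rfl fun σ _ => Finset.sum_congr rfl fun i _ => by ring
  rw [Finset.sum_eq_single i₀ (fun i _ hi => by
    rw [sum_permSignC_update_eq_zero A hi, mul_zero]) (by simp)] at h2
  have h3 : ∀ σ, T i₀ σ = ∏ k, A (σ k).1 (σ k).2 := fun σ =>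
    Finset.prod_congr rfl fun k _ => by
      congr 1
      · split_ifs with h <;> simp [h]
      · split_ifs with h <;> simp [h]
  simp_rw [h3] at h2
  exact (mul_eq_zero.1 h2).resolve_left hi₀

end

noncomputable section

/-- The vector of `ℍⁿ` whose `l`-th coordinate is `x` and whose other coordinates vanish. -/
def embQ {n : ℕ} (l : Fin n) (x : ℍ) : Hn n := fun k => if k = l then x else 0

theorem re_unitQ (m : Fin 4) : (unitQ m).re = ![1, 0, 0, 0] m := by
  fin_cases m <;> rfl

theorem imI_unitQ (m : Fin 4) : (unitQ m).imI = ![0, 1, 0, 0] m := by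
  fin_cases m <;> rfl

theorem imJ_unitQ (m : Fin 4) : (unitQ m).imJ = ![0, 0, 1, 0] m := by
  fin_cases m <;> rfl

theorem imK_unitQ (m : Fin 4) : (unitQ m).imK = ![0, 0, 0, 1] m := by
  fin_cases m <;> rfl

theorem embQ_eq {n : ℕ} (l : Fin n) (x : ℍ) : embQ l x =
    x.re • dirQ l 0 + x.imI • dirQ l 1 + x.imJ • dirQ l 2 + x.imK • dirQ l 3 := by
  funext k
  by_cases h : k = l
  · have e : ∀ m, (dirQ l m : Hn n) k = unitQ m := fun m => if_pos h
    simp only [embQ, if_pos h, Pi.add_apply, Pi.smul_apply, e]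
    ext <;> simp [re_unitQ, imI_unitQ, imJ_unitQ, imK_unitQ]
  · simp [embQ, dirQ, if_neg h]

theorem lineL_eq_sum {n : ℕ} (b : Hn n) (t : ℍ) : lineL b t = ∑ l, embQ l (b l * t) := by
  funext k
  rw [Finset.sum_apply]
  simp only [embQ]
  rw [Finset.sum_ite_eq Finset.univ k, if_pos (Finset.mem_univ k)]
  rfl

theorem lineL_dirQ {n : ℕ} (l : Fin n) (k : Fin 4) (t : ℍ) :
    lineL (dirQ l k) t = embQ l (unitQ k * t) := by
  funext p
  change dirQ l k p * t = _
  simp only [dirQ, embQ]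
  split_ifs <;> simp

theorem embQ_form {n : ℕ} (H : Hn n →L[ℝ] Hn n →L[ℝ] ℝ) (l l' : Fin n) (x y : ℍ) :
    H (embQ l x) (embQ l' y) =
      x.re * (y.re * H (dirQ l 0) (dirQ l' 0) + y.imI * H (dirQ l 0) (dirQ l' 1) +
        y.imJ * H (dirQ l 0) (dirQ l' 2) + y.imK * H (dirQ l 0) (dirQ l' 3)) +
      x.imI * (y.re * H (dirQ l 1) (dirQ l' 0) + y.imI * H (dirQ l 1) (dirQ l' 1) +
        y.imJ * H (dirQ l 1) (dirQ l' 2) + y.imK * H (dirQ l 1) (dirQ l' 3)) +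
      x.imJ * (y.re * H (dirQ l 2) (dirQ l' 0) + y.imI * H (dirQ l 2) (dirQ l' 1) +
        y.imJ * H (dirQ l 2) (dirQ l' 2) + y.imK * H (dirQ l 2) (dirQ l' 3)) +
      x.imK * (y.re * H (dirQ l 3) (dirQ l' 0) + y.imI * H (dirQ l 3) (dirQ l' 1) +
        y.imJ * H (dirQ l 3) (dirQ l' 2) + y.imK * H (dirQ l 3) (dirQ l' 3)) := by
  rw [embQ_eq l x, embQ_eq l' y]
  simp only [map_add, map_smul, add_apply, smul_apply, smul_eq_mul]
  ring

/-- The first complex index of the `l`-th quaternionic coordinate. -/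
def evenQ {n : ℕ} (l : Fin n) : Fin (2 * n) := ⟨2 * l.val, by omega⟩

/-- The second complex index of the `l`-th quaternionic coordinate. -/
def oddQ {n : ℕ} (l : Fin n) : Fin (2 * n) := ⟨2 * l.val + 1, by omega⟩

theorem blockQ_evenQ {n : ℕ} (l : Fin n) : blockQ (evenQ l) = l := by
  ext; simp [blockQ, evenQ]

theorem blockQ_oddQ {n : ℕ} (l : Fin n) : blockQ (oddQ l) = l := by
  ext; simp only [blockQ, oddQ]; omega

theorem sum_evenQ_oddQ {n : ℕ} (f : Fin (2 * n) → ℂ) :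
    ∑ i, f i = ∑ l, (f (evenQ l) + f (oddQ l)) := by
  rw [← Finset.sum_fiberwise Finset.univ blockQ f]
  refine Finset.sum_congr rfl fun l _ => ?_
  have : Finset.univ.filter (fun i => blockQ i = l) = {evenQ l, oddQ l} := by
    ext i
    simp only [Finset.mem_filter, Finset.mem_univ, true_and, Finset.mem_insert,
      Finset.mem_singleton, blockQ, evenQ, oddQ, Fin.ext_iff]
    omega
  rw [this, Finset.sum_pair]
  simp [evenQ, oddQ]

/-- The complex coordinates of a quaternionic vector matching the indices of `∇_{jα}`. -/
def complexQ {n : ℕ} (b : Hn n) (i : Fin (2 * n)) : ℂ :=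
  if i.val % 2 = 0 then ((b (blockQ i)).re : ℂ) - Complex.I * ((b (blockQ i)).imI : ℂ)
  else ((b (blockQ i)).imJ : ℂ) + Complex.I * ((b (blockQ i)).imK : ℂ)

theorem complexQ_evenQ {n : ℕ} (b : Hn n) (l : Fin n) :
    complexQ b (evenQ l) = ((b l).re : ℂ) - Complex.I * ((b l).imI : ℂ) := by
  rw [complexQ, if_pos (by simp [evenQ]), blockQ_evenQ]

theorem complexQ_oddQ {n : ℕ} (b : Hn n) (l : Fin n) :
    complexQ b (oddQ l) = ((b l).imJ : ℂ) + Complex.I * ((b l).imK : ℂ) := by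
  rw [complexQ, if_neg (by simp only [oddQ]; omega), blockQ_oddQ]

theorem complexQ_ne_zero {n : ℕ} {b : Hn n} (hb : b ≠ 0) : complexQ b ≠ 0 := by
  obtain ⟨l, hl⟩ := Function.ne_iff.1 hb
  intro h
  apply hl
  have h1 := congrFun h (evenQ l)
  have h2 := congrFun h (oddQ l)
  rw [complexQ_evenQ] at h1
  rw [complexQ_oddQ] at h2
  have h3 := congrArg Complex.re h1
  have h4 := congrArg Complex.im h1
  have h5 := congrArg Complex.re h2
  have h6 := congrArg Complex.im h2
  simp at h3 h4 h5 h6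
  ext <;> simp [h3, h4, h5, h6]

theorem bastonForm_block {n : ℕ} (H : Hn n →L[ℝ] Hn n →L[ℝ] ℝ) (b : Hn n) (l : Fin n)
    (j : Fin (2 * n)) {t : Fin 4 → ℝ}
    (ht : ∀ k, t k = ∑ m, H (embQ l (b l * unitQ m)) (embQ (blockQ j) (unitQ k * unitQ m))) :
    complexQ b (evenQ l) * bastonForm H (evenQ l) j +
      complexQ b (oddQ l) * bastonForm H (oddQ l) j =
    if j.val % 2 = 0 then -(1 / 2 : ℂ) * (t 2 + Complex.I * t 3)
    else (1 / 2 : ℂ) * (t 0 - Complex.I * t 1) := by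
  have he : (evenQ l).val % 2 = 0 := by simp [evenQ]
  have ho : ¬ (oddQ l).val % 2 = 0 := by simp only [oddQ]; omega
  have hI : Complex.I ^ 2 = -1 := Complex.I_sq
  rw [ht 0, ht 1, ht 2, ht 3, complexQ_evenQ, complexQ_oddQ]
  simp only [bastonForm, formQ, blockQ_evenQ, blockQ_oddQ, coeffQ, if_pos he, if_neg ho,
    Fin.sum_univ_four, embQ_form, Quaternion.re_mul, Quaternion.imI_mul,
    Quaternion.imJ_mul, Quaternion.imK_mul, re_unitQ, imI_unitQ, imJ_unitQ, imK_unitQ]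
  generalize (b l).re = b0
  generalize (b l).imI = b1
  generalize (b l).imJ = b2
  generalize (b l).imK = b3
  by_cases hj : j.val % 2 = 0
  · simp only [if_pos hj]
    simp
    ring_nf
    simp only [hI]
    ring
  · simp only [if_neg hj]
    simp
    ring_nf
    simp only [hI]
    ring

theorem densForm_eq_zero {n : ℕ} {H : Hn n →L[ℝ] Hn n →L[ℝ] ℝ} (hs : ∀ v w, H v w = H w v)
    {b : Hn n} (hb : b ≠ 0)
    (h0 : ∀ c, ∑ m, H (lineL b (unitQ m)) (lineL c (unitQ m)) = 0) : densForm H = 0 := by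
  rw [densForm, sum_permSignC_eq_zero (bastonForm_antisymm hs) (v := complexQ b) ?_
    (complexQ_ne_zero hb), Complex.zero_re]
  intro j
  rw [sum_evenQ_oddQ]
  let t : Fin n → Fin 4 → ℝ := fun l k =>
    ∑ m, H (embQ l (b l * unitQ m)) (embQ (blockQ j) (unitQ k * unitQ m))
  have ht : ∀ k, ∑ l, t l k = 0 := fun k => by
    rw [← h0 (dirQ (blockQ j) k), Finset.sum_comm]
    refine Finset.sum_congr rfl fun m _ => ?_
    rw [lineL_eq_sum, map_sum, sum_apply, lineL_dirQ]
  have ht' : ∀ k, ∑ l, (t l k : ℂ) = 0 := fun k => by exact_mod_cast ht k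
  simp_rw [fun l => bastonForm_block H b l j (t := t l) fun k => rfl]
  split_ifs
  · rw [← Finset.mul_sum, Finset.sum_add_distrib, ← Finset.mul_sum, ht', ht']
    simp
  · rw [← Finset.mul_sum, Finset.sum_sub_distrib, ← Finset.mul_sum, ht', ht']
    simp

theorem tendsto_densForm {n : ℕ} {ι : Type*} {l : Filter ι} {Hs : ι → Hn n →L[ℝ] Hn n →L[ℝ] ℝ}
    {H : Hn n →L[ℝ] Hn n →L[ℝ] ℝ}
    (h : ∀ v w, Tendsto (fun j => Hs j v w) l (𝓝 (H v w))) :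
    Tendsto (fun j => densForm (Hs j)) l (𝓝 (densForm H)) := by
  have h1 : ∀ i α j β, Tendsto (fun N => formQ (Hs N) i α j β) l (𝓝 (formQ H i α j β)) :=
    fun i α j β => tendsto_finsetSum _ fun m _ => tendsto_finsetSum _ fun k _ =>
      ((Complex.continuous_ofReal.tendsto _).comp (h _ _)).const_mul _
  refine (Complex.continuous_re.tendsto _).comp (tendsto_finsetSum _ fun σ _ =>
    (tendsto_finsetProd _ fun k _ => ?_).const_mul _)
  exact ((h1 _ _ _ _).sub (h1 _ _ _ _)).const_mul _

theorem exists_abs_densForm_le (n : ℕ) (B : ℝ) : ∃ D : ℝ, 0 ≤ D ∧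
    ∀ H : Hn n →L[ℝ] Hn n →L[ℝ] ℝ, (∀ v w, |H v w| ≤ B * ‖v‖ * ‖w‖) → |densForm H| ≤ D := by
  let c : Fin (2 * n) → Fin 2 → Fin 4 → ℝ := fun i α m => ‖coeffQ i.val α m‖
  let d : Fin (2 * n) → Fin 4 → ℝ := fun i m => ‖(dirQ (blockQ i) m : Hn n)‖
  let Fb : Fin (2 * n) → Fin 2 → Fin (2 * n) → Fin 2 → ℝ := fun i α j β =>
    ∑ m, ∑ k, c i α m * c j β k * (B * d i m * d j k)
  let G : Fin (2 * n) → Fin (2 * n) → ℝ := fun i j => 1 / 2 * (Fb i 0 j 1 + Fb i 1 j 0)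
  refine ⟨|∑ σ : Fin n → Fin (2 * n) × Fin (2 * n),
    ‖permSignC (flattenQ σ)‖ * ∏ k : Fin n, G (σ k).1 (σ k).2|, abs_nonneg _, fun H hH => ?_⟩
  have h1 : ∀ i α j β, ‖formQ H i α j β‖ ≤ Fb i α j β := fun i α j β => by
    refine (norm_sum_le _ _).trans (Finset.sum_le_sum fun m _ => (norm_sum_le _ _).trans
      (Finset.sum_le_sum fun k _ => ?_))
    rw [norm_mul, norm_mul, Complex.norm_real]
    exact mul_le_mul_of_nonneg_left (hH _ _) (by positivity)
  have h2 : ∀ i j, ‖bastonForm H i j‖ ≤ G i j := fun i j => by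
    rw [bastonForm, norm_mul]
    have := norm_sub_le (formQ H i 0 j 1) (formQ H i 1 j 0)
    have h3 : ‖(1 / 2 : ℂ)‖ = 1 / 2 := by simp
    rw [h3]
    exact mul_le_mul_of_nonneg_left (this.trans (add_le_add (h1 _ _ _ _) (h1 _ _ _ _)))
      (by norm_num)
  refine (Complex.abs_re_le_norm _).trans (((norm_sum_le _ _).trans
    (Finset.sum_le_sum fun σ _ => ?_)).trans (le_abs_self _))
  rw [norm_mul, norm_prod]
  exact mul_le_mul_of_nonneg_left (Finset.prod_le_prod (fun k _ => norm_nonneg _)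
    fun k _ => h2 _ _) (norm_nonneg _)

end

noncomputable section

/-! ### Degenerate second derivatives -/

theorem traceQ_pullL {n : ℕ} (H : Hn n →L[ℝ] Hn n →L[ℝ] ℝ) (b : Hn n) :
    traceQ (pullL H b) = ∑ m, H (lineL b (unitQ m)) (lineL b (unitQ m)) := rfl

theorem lineL_add {n : ℕ} (b c : Hn n) (t : ℍ) : lineL (b + c) t = lineL b t + lineL c t := by
  funext k
  exact add_mul _ _ _

theorem lineL_smul {n : ℕ} (r : ℝ) (b : Hn n) (t : ℍ) : lineL (r • b) t = r • lineL b t := by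
  funext k
  exact smul_mul_assoc r (b k) t

theorem traceQ_pullL_smul {n : ℕ} (H : Hn n →L[ℝ] Hn n →L[ℝ] ℝ) (r : ℝ) (b : Hn n) :
    traceQ (pullL H (r • b)) = r ^ 2 * traceQ (pullL H b) := by
  rw [traceQ_pullL, traceQ_pullL, Finset.mul_sum]
  refine Finset.sum_congr rfl fun m _ => ?_
  rw [lineL_smul, map_smul, map_smul, smul_apply, smul_eq_mul, smul_eq_mul]
  ring

theorem polar_eq_zero {n : ℕ} {H : Hn n →L[ℝ] Hn n →L[ℝ] ℝ} (hs : ∀ v w, H v w = H w v)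
    (hH : ∀ b, 0 ≤ traceQ (pullL H b)) {b : Hn n} (hb : traceQ (pullL H b) = 0) (c : Hn n) :
    ∑ m, H (lineL b (unitQ m)) (lineL c (unitQ m)) = 0 := by
  set p := ∑ m, H (lineL b (unitQ m)) (lineL c (unitQ m)) with hp
  have h1 : ∀ r : ℝ, traceQ (pullL H (r • b + c)) = 2 * r * p + traceQ (pullL H c) := fun r => by
    have h2 : traceQ (pullL H (r • b + c)) =
        r ^ 2 * traceQ (pullL H b) + 2 * r * p + traceQ (pullL H c) := by
      rw [traceQ_pullL, traceQ_pullL, traceQ_pullL, hp, Finset.mul_sum, Finset.mul_sum,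
        ← Finset.sum_add_distrib, ← Finset.sum_add_distrib]
      refine Finset.sum_congr rfl fun m _ => ?_
      rw [lineL_add, lineL_smul]
      simp only [map_add, map_smul, add_apply, smul_apply, smul_eq_mul]
      rw [hs (lineL c (unitQ m)) (lineL b (unitQ m))]
      ring
    rw [h2, hb]
    ring
  by_contra h0
  have h2 := hH ((-(traceQ (pullL H c) + 1) / (2 * p)) • b + c)
  rw [h1] at h2
  have h3 : 2 * (-(traceQ (pullL H c) + 1) / (2 * p)) * p = -(traceQ (pullL H c) + 1) := by
    field_simp
  linarith

theorem densForm_eq_zero_or {n : ℕ} {H : Hn n →L[ℝ] Hn n →L[ℝ] ℝ} (hs : ∀ v w, H v w = H w v)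
    (hH : ∀ b, 0 ≤ traceQ (pullL H b)) :
    densForm H = 0 ∨ ∃ κ > 0, ∀ b, κ * ‖b‖ ^ 2 ≤ traceQ (pullL H b) := by
  by_cases h : ∃ b : Hn n, b ≠ 0 ∧ traceQ (pullL H b) = 0
  · obtain ⟨b, hb, h0⟩ := h
    exact Or.inl (densForm_eq_zero hs hb (polar_eq_zero hs hH h0))
  · push Not at h
    right
    have hc : Continuous fun b : Hn n => traceQ (pullL H b) := by
      have hl : ∀ m, Continuous fun b : Hn n => lineL b (unitQ m) := fun m =>
        continuous_pi fun k => (continuous_apply k).mul continuous_const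
      simp only [traceQ_pullL]
      exact continuous_finsetSum _ fun m _ => (H.continuous.comp (hl m)).clm_apply (hl m)
    rcases (Metric.sphere (0 : Hn n) 1).eq_empty_or_nonempty with he | hne
    · refine ⟨1, one_pos, fun b => ?_⟩
      have hb : b = 0 := by
        by_contra hb
        have : (‖b‖⁻¹ • b) ∈ Metric.sphere (0 : Hn n) 1 := by
          rw [mem_sphere_zero_iff_norm, norm_smul, norm_inv, norm_norm,
            inv_mul_cancel₀ (norm_ne_zero_iff.2 hb)]
        rw [he] at this
        exact this
      rw [hb, norm_zero]
      simpa using hH 0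
    obtain ⟨b₀, hb₀, hmin⟩ := (isCompact_sphere (0 : Hn n) 1).exists_isMinOn hne hc.continuousOn
    have hb₀' : b₀ ≠ 0 := by
      rintro rfl
      simp at hb₀
    refine ⟨_, lt_of_le_of_ne (hH b₀) (Ne.symm (h b₀ hb₀')), fun b => ?_⟩
    rcases eq_or_ne b 0 with rfl | hb
    · rw [norm_zero]
      simpa using hH 0
    · have hb1 := norm_ne_zero_iff.2 hb
      have hm : traceQ (pullL H b₀) ≤ traceQ (pullL H (‖b‖⁻¹ • b)) := hmin (by
        rw [mem_sphere_zero_iff_norm, norm_smul, norm_inv, norm_norm, inv_mul_cancel₀ hb1])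
      have e : b = ‖b‖ • (‖b‖⁻¹ • b) := by rw [smul_smul, mul_inv_cancel₀ hb1, one_smul]
      calc traceQ (pullL H b₀) * ‖b‖ ^ 2 ≤ traceQ (pullL H (‖b‖⁻¹ • b)) * ‖b‖ ^ 2 := by gcongr
        _ = traceQ (pullL H (‖b‖ • (‖b‖⁻¹ • b))) := by rw [traceQ_pullL_smul H ‖b‖]; ring
        _ = _ := by rw [← e]

/-- The Euclidean inner product of `ℍⁿ ≅ ℝ^{4n}`. -/
def euclQ (n : ℕ) : Hn n →L[ℝ] Hn n →L[ℝ] ℝ :=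
  ∑ k, innerQ.bilinearComp (ContinuousLinearMap.proj k) (ContinuousLinearMap.proj k)

theorem euclQ_self {n : ℕ} (v : Hn n) : euclQ n v v = ∑ k, ‖v k‖ ^ 2 := by
  rw [euclQ, sum_apply, sum_apply]
  exact Finset.sum_congr rfl fun k _ => innerQ_self (v k)

theorem euclQ_self_le {n : ℕ} (v : Hn n) : euclQ n v v ≤ n * ‖v‖ ^ 2 := by
  rw [euclQ_self]
  refine (Finset.sum_le_sum fun k _ => pow_le_pow_left₀ (norm_nonneg _)
    (norm_le_pi_norm v k) 2).trans ?_
  simp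

theorem sq_norm_le_euclQ {n : ℕ} (v : Hn n) : ‖v‖ ^ 2 ≤ euclQ n v v := by
  rw [euclQ_self]
  rw [← Real.sqrt_le_sqrt_iff (by positivity), Real.sqrt_sq (norm_nonneg _),
    pi_norm_le_iff_of_nonneg (Real.sqrt_nonneg _)]
  intro k
  refine Real.le_sqrt_of_sq_le ?_
  exact Finset.single_le_sum (f := fun k => ‖v k‖ ^ 2) (fun k _ => by positivity)
    (Finset.mem_univ k)

/-- Where a maximal subsolution stays strictly below the obstacle, its second derivative is
nowhere strictly positive on right quaternionic lines. -/
theorem not_strictly_positive_of_maximal {n : ℕ} {P f : Hn n → ℝ} (hP : Continuous P)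
    (hPP : QPSHr P Set.univ) (hf : Continuous f) (hPf : ∀ y, P y ≤ f y)
    (hmax : ∀ v, QPSHr v Set.univ → (∀ y, v y ≤ f y) → ∀ y, v y ≤ P y)
    {x : Hn n} (hx : P x < f x) {P' : Hn n → Hn n →L[ℝ] ℝ} {H : Hn n →L[ℝ] Hn n →L[ℝ] ℝ}
    (h1 : ∀ y, HasFDerivAt P (P' y) y) (h2 : HasFDerivAt P' H x) {κ : ℝ} (hκ : 0 < κ) :
    ¬ ∀ b, κ * ‖b‖ ^ 2 ≤ traceQ (pullL H b) := by
  intro hH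
  set c : ℝ := κ / (8 * n + 8) with hc
  have hc0 : 0 < c := by positivity
  set β : Hn n →L[ℝ] Hn n →L[ℝ] ℝ := (1 / 2 : ℝ) • H - c • euclQ n with hβ
  have hβv : ∀ v w, β v w = 1 / 2 * H v w - c * euclQ n v w := fun v w => by
    rw [hβ]
    rfl
  have hw : ∀ k, QPSHr (fun y => k + P' x (y - x) + β (y - x) (y - x)) Set.univ := fun k => by
    refine qpshr_of_hessian (hasFDerivAt_quad k (P' x) β x) (hasFDerivAt_quad' (P' x) β x)
      fun _ b => ?_
    have e : traceQ (pullL (β + β.flip) b) = traceQ (pullL H b) -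
        2 * c * ∑ m, euclQ n (lineL b (unitQ m)) (lineL b (unitQ m)) := by
      rw [traceQ_pullL, traceQ_pullL, Finset.mul_sum, ← Finset.sum_sub_distrib]
      refine Finset.sum_congr rfl fun m _ => ?_
      change β _ _ + β _ _ = _
      rw [hβv]
      ring
    have h3 : ∑ m, euclQ n (lineL b (unitQ m)) (lineL b (unitQ m)) ≤ 4 * (n * ‖b‖ ^ 2) := by
      refine (Finset.sum_le_sum fun m _ => (euclQ_self_le _).trans_eq
        (by rw [norm_unitQ_lineL])).trans ?_
      simp
    have h4 : 2 * c * (4 * (n * ‖b‖ ^ 2)) ≤ κ * ‖b‖ ^ 2 := by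
      have h5 : 2 * c * (4 * (n * ‖b‖ ^ 2)) = c * (8 * n) * ‖b‖ ^ 2 := by ring
      have h6 : c * (8 * n) ≤ κ := by
        have : c * (8 * n + 8) = κ := by rw [hc]; field_simp
        nlinarith
      rw [h5]
      gcongr
    rw [e]
    have := mul_le_mul_of_nonneg_left h3 (by positivity : 0 ≤ 2 * c)
    linarith [hH b]
  set τ := (f x - P x) / 3 with hτ
  have hτ0 : 0 < τ := by rw [hτ]; linarith
  have hev1 := taylor_two_isLittleO (Eventually.of_forall h1) h2 (ε := c / 4) (by positivity)
  have hev2 : ∀ᶠ y in 𝓝 x, P y + 2 * τ < f y :=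
    (isOpen_lt (hP.add continuous_const) hf).mem_nhds
      (show P x + 2 * τ < f x by rw [hτ]; linarith)
  obtain ⟨r₀, hr₀, hr₀'⟩ := Metric.eventually_nhds_iff.1 (hev1.and hev2)
  obtain ⟨r, hr, hrr, hrτ⟩ : ∃ r > 0, r < r₀ ∧ c * r ^ 2 < τ := by
    have : Tendsto (fun r : ℝ => c * r ^ 2) (𝓝[>] 0) (𝓝 0) := by
      have h : ContinuousAt (fun r : ℝ => c * r ^ 2) 0 := by fun_prop
      simpa using h.tendsto.mono_left nhdsWithin_le_nhds
    have h6 : ∀ᶠ r in 𝓝[>] (0:ℝ), r < r₀ := nhdsWithin_le_nhds (eventually_lt_nhds hr₀)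
    obtain ⟨r, h3, h4, h5⟩ := ((eventually_mem_nhdsWithin (s := Set.Ioi (0:ℝ)) (a := 0)).and
      (h6.and (this.eventually_lt_const hτ0))).exists
    exact ⟨r, h3, h4, h5⟩
  set w : Hn n → ℝ := fun y => (P x + c * r ^ 2 / 2) + P' x (y - x) + β (y - x) (y - x) with hwd
  have hwP : QPSHr w Set.univ := hw _
  have hwc : Continuous w := (contDiff_quad (n := 0) _ (P' x) β x).continuous
  have hwle : ∀ y, ‖y - x‖ ≤ r →
      w y ≤ P y + c / 4 * ‖y - x‖ ^ 2 + c * r ^ 2 / 2 - c * ‖y - x‖ ^ 2 := fun y hy => by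
    have h3 := (abs_le.1 (hr₀' (y := y) (by rw [dist_eq_norm]; linarith)).1).1
    have h4 := mul_le_mul_of_nonneg_left (sq_norm_le_euclQ (y - x)) hc0.le
    simp only [hwd, hβv]
    linarith
  have hwsph : ∀ y, ‖y - x‖ = r → w y < P y := fun y hy => by
    have := hwle y hy.le
    rw [hy] at this
    have : 0 < c * r ^ 2 := by positivity
    linarith
  classical
  set v : Hn n → ℝ := fun y => if ‖y - x‖ ≤ r then max (P y) (w y) else P y with hv
  have hvP : QPSHr v Set.univ := by
    refine qpshr_of_locally isOpen_univ fun q _ => ?_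
    rcases lt_or_ge ‖q - x‖ r with hq | hq
    · refine ⟨Metric.ball x r, Metric.isOpen_ball, by rwa [mem_ball_iff_norm], _,
        (hPP.max isOpen_univ hwP).mono (Set.subset_univ _), fun p hp => ?_⟩
      rw [mem_ball_iff_norm] at hp
      exact if_pos hp.le
    · have hO1 : IsOpen {y : Hn n | w y < P y} := isOpen_lt hwc hP
      have hO2 : IsOpen {y : Hn n | r < ‖y - x‖} :=
        isOpen_lt continuous_const (continuous_id.sub continuous_const).norm
      refine ⟨{y | w y < P y} ∪ {y | r < ‖y - x‖}, hO1.union hO2, ?_, P,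
        hPP.mono (Set.subset_univ _), ?_⟩
      · rcases hq.eq_or_lt with h | h
        · exact Or.inl (hwsph q h.symm)
        · exact Or.inr h
      · rintro p (hp | hp)
        · simp only [hv]
          split_ifs
          · exact max_eq_left (le_of_lt hp)
          · rfl
        · exact if_neg (not_le.2 hp)
  have hvf : ∀ y, v y ≤ f y := fun y => by
    simp only [hv]
    split_ifs with hy
    · refine max_le (hPf y) ?_
      have h3 := hwle y hy
      have h4 := (hr₀' (y := y) (by rw [dist_eq_norm]; linarith)).2
      have h5 : c / 4 * ‖y - x‖ ^ 2 - c * ‖y - x‖ ^ 2 ≤ 0 := by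
        have := mul_nonneg hc0.le (sq_nonneg ‖y - x‖)
        linarith
      linarith
    · exact hPf y
  have h3 := hmax v hvP hvf x
  have h4 : w x = P x + c * r ^ 2 / 2 := by simp [hwd]
  have h5 : w x ≤ v x := by
    simp only [hv]
    rw [if_pos (by simpa using hr.le)]
    exact le_max_right _ _
  have : 0 < c * r ^ 2 := by positivity
  linarith

/-! ### The obstacle problem on the whole space -/

theorem exists_obstacle_solution {n : ℕ} {f s : Hn n → ℝ} {L C : ℝ} (hL0 : 0 ≤ L)
    (hL : ∀ x y, f x ≤ f y + L * ‖x - y‖)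
    (hC : ∀ x h, f (x + h) + f (x - h) - 2 * f x ≤ C * ‖h‖ ^ 2)
    (hs : QPSHr s Set.univ) (hsf : ∀ y, s y ≤ f y) :
    ∃ P : Hn n → ℝ, (∀ x y, ‖P x - P y‖ ≤ L * ‖x - y‖) ∧ QPSHr P Set.univ ∧
      (∀ x h, P (x + h) + P (x - h) - 2 * P x ≤ C * ‖h‖ ^ 2) ∧ (∀ y, P y ≤ f y) ∧
      ∀ v, QPSHr v Set.univ → (∀ y, v y ≤ f y) → ∀ y, v y ≤ P y := by
  let S : Set (Hn n → ℝ) := {v | QPSHr v Set.univ ∧ ∀ y, v y ≤ f y}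
  let P : Hn n → ℝ := fun y => sSup ((fun v : Hn n → ℝ => v y) '' S)
  have hne : S.Nonempty := ⟨s, hs, hsf⟩
  have hbdd : ∀ y, BddAbove ((fun v : Hn n → ℝ => v y) '' S) := fun y =>
    ⟨f y, by rintro _ ⟨v, hv, rfl⟩; exact hv.2 y⟩
  have hPf : ∀ y, P y ≤ f y := fun y =>
    csSup_le (hne.image _) (by rintro _ ⟨v, hv, rfl⟩; exact hv.2 y)
  have hmax : ∀ v, QPSHr v Set.univ → (∀ y, v y ≤ f y) → ∀ y, v y ≤ P y := fun v h1 h2 y =>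
    le_csSup (hbdd y) ⟨v, ⟨h1, h2⟩, rfl⟩
  have htr : ∀ {v : Hn n → ℝ} (_ : QPSHr v Set.univ) (h : Hn n),
      QPSHr (fun q => v (q + h)) Set.univ := fun hv h => by
    simpa using hv.translate h
  have hLip : ∀ x y, P x ≤ P y + L * ‖x - y‖ := fun x y => by
    refine csSup_le (hne.image _) ?_
    rintro _ ⟨v, hv, rfl⟩
    have h1 := hmax _ ((htr hv.1 (x - y)).add_const isOpen_univ (-(L * ‖x - y‖))) (fun z => by
      have h2 := hv.2 (z + (x - y))
      have h3 := hL (z + (x - y)) z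
      rw [add_sub_cancel_left] at h3
      linarith) y
    rw [add_sub_cancel] at h1
    change v x ≤ _
    linarith
  have hLip' : ∀ x y, ‖P x - P y‖ ≤ L * ‖x - y‖ := fun x y => by
    rw [Real.norm_eq_abs, abs_le]
    have h1 := hLip x y
    have h2 := hLip y x
    rw [norm_sub_rev] at h2
    constructor <;> linarith
  have hPc : Continuous P :=
    (LipschitzWith.of_dist_le_mul (K := ⟨L, hL0⟩) fun x y => by
      rw [dist_eq_norm, dist_eq_norm]; exact hLip' x y).continuous
  have hPP : QPSHr P Set.univ := qpshr_of_sup hPc.continuousOn fun q _ ε hε => by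
    obtain ⟨_, ⟨v, hv, rfl⟩, h⟩ := exists_lt_of_lt_csSup (hne.image fun v : Hn n → ℝ => v q)
      (sub_lt_self (P q) hε)
    exact ⟨v, hv.1, fun p _ => hmax v hv.1 hv.2 p, h⟩
  refine ⟨P, hLip', hPP, fun x h => ?_, hPf, hmax⟩
  have h1 := (((htr hPP h).add (htr hPP (-h)) (hPc.comp
    (continuous_id.add continuous_const)).continuousOn).const_mul isOpen_univ
      (c := 1 / 2) (by norm_num)).add_const isOpen_univ (-(C * ‖h‖ ^ 2) / 2)
  have h2 := hmax _ h1 (fun y => by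
    have h3 := hPf (y + h)
    have h4 := hPf (y + -h)
    have h5 := hC y h
    rw [sub_eq_add_neg y h] at h5
    linarith) x
  rw [sub_eq_add_neg x h]
  linarith

end

noncomputable section

/-! ### The obstacle solution has no Monge–Ampère mass off the contact set -/

theorem hasFDerivAt_add_const' {E : Type*} [NormedAddCommGroup E] [NormedSpace ℝ E]
    {f : E → ℝ} {f' : E →L[ℝ] ℝ} {x : E} (h : HasFDerivAt f f' x) (c : ℝ) :
    HasFDerivAt (fun y => f y + c) f' x := h.add_const c

theorem tendsto_hessian_apply {E : Type*} [NormedAddCommGroup E] [NormedSpace ℝ E]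
    {f : E → ℝ} (h : ContDiff ℝ (⊤ : ℕ∞) f) (x v w : E) :
    Tendsto (fun y => fderiv ℝ (fderiv ℝ f) y v w) (𝓝 x) (𝓝 (fderiv ℝ (fderiv ℝ f) x v w)) := by
  have h1 : ContDiff ℝ 1 (fderiv ℝ f) := h.fderiv_right (m := 1) (by norm_cast)
  have h2 : Continuous (fderiv ℝ (fderiv ℝ f)) := h1.continuous_fderiv (by norm_num)
  exact ((h2.clm_apply continuous_const).clm_apply continuous_const).tendsto x

theorem symm_of_hasFDerivAt {E : Type*} [NormedAddCommGroup E] [NormedSpace ℝ E]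
    {f : E → ℝ} {f' : E → E →L[ℝ] ℝ} {H : E →L[ℝ] E →L[ℝ] ℝ} {x : E}
    (h1 : ∀ y, HasFDerivAt f (f' y) y) (h2 : HasFDerivAt f' H x) (v w : E) : H v w = H w v :=
  second_derivative_symmetric h1 h2 v w

theorem tendsto_lintegral_maDensity_mollify {n : ℕ} {P f : Hn n → ℝ} {L C : ℝ} (hL0 : 0 ≤ L)
    (hL : ∀ x y, ‖P x - P y‖ ≤ L * ‖x - y‖) (hC0 : 0 ≤ C)
    (hC : ∀ x h, P (x + h) + P (x - h) - 2 * P x ≤ C * ‖h‖ ^ 2)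
    (hPP : QPSHr P Set.univ) (hf : Continuous f) (hPf : ∀ y, P y ≤ f y)
    (hmax : ∀ v, QPSHr v Set.univ → (∀ y, v y ≤ f y) → ∀ y, v y ≤ P y)
    {U : Set (Hn n)} (hU : MeasurableSet U) (hUf : volume U ≠ ⊤) (hlt : ∀ x ∈ U, P x < f x)
    (c : ℝ) :
    Tendsto (fun j => ∫⁻ x in U, ENNReal.ofReal
      (maDensity (fun _ => fun y => mollify volume j P y + c) x)) atTop (𝓝 0) := by
  have hP : Continuous P :=
    (LipschitzWith.of_dist_le_mul (K := ⟨L, hL0⟩) fun x y => by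
      rw [dist_eq_norm, dist_eq_norm]; exact hL x y).continuous
  have hdens : ∀ j x, maDensity (fun _ => fun y => mollify volume j P y + c) x =
      densForm (fderiv ℝ (fderiv ℝ (mollify (volume : Measure (Hn n)) j P)) x) := fun j x =>
    maDensity_eq_densForm (fun y => hasFDerivAt_add_const' (mollify_hasFDerivAt volume j hP y) c)
      (mollify_hasFDerivAt_fderiv volume j hP x)
  simp only [hdens]
  have hK := abs_hessian_mollify_le hP hPP hC0 hC
  obtain ⟨D, hD0, hD⟩ := exists_abs_densForm_le n (2 * (3 * C))
  obtain ⟨a, ha, had, hat⟩ := exists_gradient (volume : Measure (Hn n)) hL hL0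
    (K := 2 * (3 * C)) (by positivity) hK
  have hz : ∀ᵐ x ∂(volume.restrict U), densForm (fderiv ℝ a x) = 0 := by
    refine (ae_restrict_iff' hU).2 ?_
    filter_upwards [had] with x hx hxU
    have h2 := hx.hasFDerivAt
    refine (densForm_eq_zero_or (symm_of_hasFDerivAt ha h2)
      (hPP.traceQ_nonneg isOpen_univ (Set.mem_univ x)
        (Eventually.of_forall ha) h2)).resolve_right ?_
    rintro ⟨κ, hκ, h⟩
    exact not_strictly_positive_of_maximal hP hPP hf hPf hmax (hlt x hxU) ha h2 hκ h
  have hlim := tendsto_lintegral_of_dominated_convergence'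
    (μ := (volume : Measure (Hn n)).restrict U)
    (F := fun j x => ENNReal.ofReal
      (densForm (fderiv ℝ (fderiv ℝ (mollify (volume : Measure (Hn n)) j P)) x)))
    (f := fun _ => 0) (fun _ => ENNReal.ofReal D) (fun j => ?_) (fun j => ?_) ?_ ?_
  · simpa using hlim
  · refine (Continuous.measurable ?_).ennreal_ofReal.aemeasurable
    exact continuous_iff_continuousAt.2 fun x =>
      tendsto_densForm (tendsto_hessian_apply (mollify_contDiff volume j hP) x)
  · exact Eventually.of_forall fun x =>
      ENNReal.ofReal_le_ofReal ((le_abs_self _).trans (hD _ (hK j x)))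
  · rw [lintegral_const]
    exact ENNReal.mul_ne_top ENNReal.ofReal_ne_top (by simpa using hUf)
  · filter_upwards [hz, ae_restrict_of_ae hat] with x hx hxt
    have := (ENNReal.continuous_ofReal.tendsto _).comp (tendsto_densForm hxt)
    rw [hx, ENNReal.ofReal_zero] at this
    exact this

end

noncomputable section

/-! ### Smooth approximation of the envelope with small Monge–Ampère mass -/

theorem exists_affine_modulus {E : Type*} [NormedAddCommGroup E] {g : E → ℝ}
    (hg : UniformContinuous g) {M : ℝ} (hM : ∀ x, |g x| ≤ M) {δ : ℝ} (hδ : 0 < δ) :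
    ∃ m, 0 < m ∧ ∀ x y, g x - g y ≤ δ + m * ‖x - y‖ := by
  obtain ⟨τ, hτ, h⟩ := Metric.uniformContinuous_iff.1 hg δ hδ
  have hM0 : 0 ≤ M := (abs_nonneg _).trans (hM 0)
  refine ⟨2 * M / τ + 1, by positivity, fun x y => ?_⟩
  rcases lt_or_ge (dist x y) τ with hxy | hxy
  · have h1 := (abs_lt.1 (h hxy)).2
    have : 0 ≤ (2 * M / τ + 1) * ‖x - y‖ := by positivity
    linarith
  · rw [dist_eq_norm] at hxy
    have h1 := (abs_le.1 (hM x)).2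
    have h2 := (abs_le.1 (hM y)).1
    have h3 : 2 * M / τ * τ ≤ 2 * M / τ * ‖x - y‖ :=
      mul_le_mul_of_nonneg_left hxy (by positivity)
    rw [div_mul_cancel₀ _ hτ.ne'] at h3
    have := norm_nonneg (x - y)
    linarith

/-- A bounded plurisubharmonic function near a ball agrees on a smaller ball with a globally
defined plurisubharmonic function. -/
theorem qpshr_max_cone {n : ℕ} {Ω : Set (Hn n)} {g : Hn n → ℝ} (hg : Continuous g)
    (hgP : QPSHr g Ω) {M : ℝ} (hM : ∀ q, |g q| ≤ M) {a : Hn n} {R : ℝ} (hR : 0 < R)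
    (hball : Metric.closedBall a (3 * R) ⊆ Ω) :
    QPSHr (fun q => max (g q) ((M + 1) / R * ‖q - a‖ + -(2 * (M + 1)))) Set.univ := by
  have hM0 : 0 ≤ M := (abs_nonneg _).trans (hM 0)
  have hs : QPSHr (fun q : Hn n => (M + 1) / R * ‖q - a‖ + -(2 * (M + 1))) Set.univ :=
    ((qpshr_norm_sub a).const_mul isOpen_univ (by positivity)).add_const isOpen_univ _
  have hsc : Continuous fun q : Hn n => (M + 1) / R * ‖q - a‖ + -(2 * (M + 1)) := by fun_prop
  refine qpshr_of_locally isOpen_univ fun q _ => ?_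
  rcases lt_or_ge ‖q - a‖ (3 * R) with hq | hq
  · refine ⟨Metric.ball a (3 * R), Metric.isOpen_ball, by rwa [Metric.mem_ball, dist_eq_norm],
      _, (hgP.mono (Metric.ball_subset_closedBall.trans hball)).max Metric.isOpen_ball
        (hs.mono (Set.subset_univ _)), fun p _ => rfl⟩
  · refine ⟨{q | g q < (M + 1) / R * ‖q - a‖ + -(2 * (M + 1))}, isOpen_lt hg hsc, ?_, _,
      hs.mono (Set.subset_univ _), fun p hp => max_eq_right (le_of_lt hp)⟩
    have h1 : (M + 1) / R * (3 * R) ≤ (M + 1) / R * ‖q - a‖ :=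
      mul_le_mul_of_nonneg_left hq (by positivity)
    have h2 : (M + 1) / R * (3 * R) = 3 * (M + 1) := by field_simp
    have h3 := (abs_le.1 (hM q)).2
    change g q < _
    linarith

theorem max_cone_eq {n : ℕ} {g : Hn n → ℝ} {M : ℝ} (hM : ∀ q, |g q| ≤ M) {a : Hn n} {R : ℝ}
    (hR : 0 < R) {q : Hn n} (hq : ‖q - a‖ ≤ R) :
    max (g q) ((M + 1) / R * ‖q - a‖ + -(2 * (M + 1))) = g q := by
  have hM0 : 0 ≤ M := (abs_nonneg _).trans (hM 0)
  refine max_eq_left ?_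
  have h1 : (M + 1) / R * ‖q - a‖ ≤ (M + 1) / R * R :=
    mul_le_mul_of_nonneg_left hq (by positivity)
  rw [div_mul_cancel₀ _ hR.ne'] at h1
  have h3 := (abs_le.1 (hM q)).1
  linarith

theorem norm_le_norm_toLp {n : ℕ} (z : Hn n) :
    ‖z‖ ≤ ‖(PiLp.continuousLinearEquiv 2 ℝ (fun _ : Fin n => ℍ)).symm.toContinuousLinearMap z‖ :=
  (pi_norm_le_iff_of_nonneg (norm_nonneg _)).2 fun k =>
    PiLp.norm_apply_le ((PiLp.continuousLinearEquiv 2 ℝ (fun _ : Fin n => ℍ)).symm z) k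

theorem exists_smooth_approx {n : ℕ} (hn : 0 < n) {Ω : Set (Hn n)} (hΩ : IsOpen Ω)
    {f g : Hn n → ℝ} (hg : UniformContinuous g) (hgP : QPSHr g Ω) (hgf : ∀ q, g q ≤ f q)
    (hmax : ∀ v, QPSHr v Ω → (∀ q ∈ Ω, v q ≤ f q) → ∀ q ∈ Ω, v q ≤ g q)
    {M : ℝ} (hM : ∀ q, |g q| ≤ M) {a : Hn n} {R : ℝ} (hR : 0 < R)
    (hball : Metric.closedBall a (3 * R) ⊆ Ω) (hf : ∀ q ∈ Metric.closedBall a R, f q = 0)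
    {δ : ℝ} (hδ : 0 < δ) :
    ∃ F : Hn n → ℝ, ContDiff ℝ (⊤ : ℕ∞) F ∧ QPSHr F Set.univ ∧
      (∀ q ∈ Metric.ball a (R / 2), g q + 3 * δ ≤ F q ∧ F q ≤ g q + 5 * δ) ∧
      ∫⁻ x in Metric.ball a (R / 2), ENNReal.ofReal (maDensity (fun _ => F) x) ≤
        ENNReal.ofReal δ := by
  have hM0 : 0 ≤ M := (abs_nonneg _).trans (hM 0)
  set A : ℝ := (M + 1) / R with hA
  have hA0 : 0 ≤ A := by positivity
  set s : Hn n → ℝ := fun q => max (g q) (A * ‖q - a‖ + -(2 * (M + 1))) with hs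
  have hsP : QPSHr s Set.univ := qpshr_max_cone hg.continuous hgP hM hR hball
  set G : Hn n → ℝ := fun q => s q + max 0 (R - ‖q - a‖) with hG
  have hGm : ∀ δ > 0, ∃ m > 0, ∀ x y, G x - G y ≤ δ + m * ‖x - y‖ := fun δ hδ => by
    obtain ⟨m, hm, h⟩ := exists_affine_modulus hg hM hδ
    refine ⟨m + A + 1, by positivity, fun x y => ?_⟩
    have h0 := norm_nonneg (x - y)
    have h1 : ‖x - a‖ - ‖y - a‖ ≤ ‖x - y‖ := by
      simpa using norm_sub_norm_le (x - a) (y - a)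
    have h2 : ‖y - a‖ - ‖x - a‖ ≤ ‖x - y‖ := by
      rw [norm_sub_rev x y]
      simpa using norm_sub_norm_le (y - a) (x - a)
    have hs1 : s x ≤ s y + (δ + (m + A) * ‖x - y‖) := by
      refine max_le ?_ ?_
      · have := h x y
        have := le_max_left (g y) (A * ‖y - a‖ + -(2 * (M + 1)))
        have := mul_nonneg hA0 h0
        change g x ≤ max (g y) (A * ‖y - a‖ + -(2 * (M + 1))) + _
        linarith
      · have := mul_le_mul_of_nonneg_left h1 hA0
        have := le_max_right (g y) (A * ‖y - a‖ + -(2 * (M + 1)))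
        have := mul_nonneg hm.le h0
        change _ ≤ max (g y) (A * ‖y - a‖ + -(2 * (M + 1))) + _
        linarith
    have hs2 : max 0 (R - ‖x - a‖) ≤ max 0 (R - ‖y - a‖) + ‖x - y‖ := by
      have := le_max_left 0 (R - ‖y - a‖)
      have := le_max_right 0 (R - ‖y - a‖)
      exact max_le (by linarith) (by linarith)
    simp only [hG]
    linarith
  have hδ' : 0 < min (δ / 2) (R / 4) := by positivity
  set δ' := min (δ / 2) (R / 4) with hδ'd
  have hδ1 : δ' ≤ δ / 2 := min_le_left _ _
  have hδ2 : δ' ≤ R / 4 := min_le_right _ _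
  obtain ⟨h, ⟨L, hL0, hL⟩, ⟨C, hC0, hC⟩, hGh⟩ := exists_semiconcave
    ((PiLp.continuousLinearEquiv 2 ℝ (fun _ : Fin n => ℍ)).symm.toContinuousLinearMap)
    (fun z => norm_le_norm_toLp z) (F := G) hGm hδ'
  have hsh : ∀ y, s y ≤ h y := fun y =>
    (le_add_of_nonneg_right (le_max_left _ _)).trans (hGh y).1
  obtain ⟨P, hPL, hPP, hPC, hPh, hPmax⟩ := exists_obstacle_solution hL0 hL hC hsP hsh
  have hPc : Continuous P :=
    (LipschitzWith.of_dist_le_mul (K := ⟨L, hL0⟩) fun x y => by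
      rw [dist_eq_norm, dist_eq_norm]; exact hPL x y).continuous
  have hhL : ∀ x y, ‖h x - h y‖ ≤ L * ‖x - y‖ := fun x y => by
    rw [Real.norm_eq_abs, abs_le]
    have h1 := hL x y
    have h2 := hL y x
    rw [norm_sub_rev] at h2
    constructor <;> linarith
  have hhc : Continuous h :=
    (LipschitzWith.of_dist_le_mul (K := ⟨L, hL0⟩) fun x y => by
      rw [dist_eq_norm, dist_eq_norm]; exact hhL x y).continuous
  have hPg : ∀ q ∈ Metric.closedBall a R, P q ≤ g q + δ' :=
    envelope_maximal hn hΩ hg.continuous hgP hgf hmax hR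
      ((Metric.closedBall_subset_closedBall (by linarith)).trans hball) hf hPc hPP fun q hq => by
        rw [mem_sphere_iff_norm] at hq
        have h1 := (hPh q).trans (hGh q).2
        simp only [hG, hs, hq, sub_self, max_self, add_zero] at h1
        have h2 := max_cone_eq hM hR hq.le
        rw [hq] at h2
        rwa [h2] at h1
  have hlt : ∀ x ∈ Metric.ball a (R / 2), P x < h x := fun x hx => by
    rw [mem_ball_iff_norm] at hx
    have h1 := hPg x (by rw [mem_closedBall_iff_norm]; linarith)
    have h2 := (hGh x).1
    have h3 : s x = g x := max_cone_eq hM hR (by linarith)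
    have h4 := le_max_right 0 (R - ‖x - a‖)
    simp only [hG, h3] at h2
    linarith
  have hlim := tendsto_lintegral_maDensity_mollify hL0 hPL hC0 hPC hPP hhc hPh hPmax
    Metric.isOpen_ball.measurableSet (Metric.isBounded_ball.measure_lt_top.ne) hlt (4 * δ)
  have hsmall : ∀ᶠ j : ℕ in atTop, L * (1 / ((j : ℝ) + 1)) < δ / 2 := by
    have := tendsto_one_div_add_atTop_nhds_zero_nat (𝕜 := ℝ).const_mul L
    rw [mul_zero] at this
    exact this.eventually_lt_const (by positivity)
  obtain ⟨j, hj1, hj2⟩ :=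
    ((hlim.eventually_lt_const (ENNReal.ofReal_pos.2 hδ)).and hsmall).exists
  refine ⟨fun y => mollify volume j P y + 4 * δ, (mollify_contDiff volume j hPc).add contDiff_const,
    (qpshr_mollify hPc hPP j).add_const isOpen_univ _, fun q hq => ?_, hj1.le⟩
  rw [mem_ball_iff_norm] at hq
  have h1 : dist (mollify volume j P q) (P q) ≤ L * (1 / ((j : ℝ) + 1)) :=
    dist_mollify_le volume j hPc fun y hy => by
      rw [dist_eq_norm]
      refine (hPL y q).trans (mul_le_mul_of_nonneg_left ?_ hL0)
      rw [← dist_eq_norm]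
      exact le_of_lt hy
  rw [Real.dist_eq, abs_le] at h1
  have h2 := hPg q (by rw [mem_closedBall_iff_norm]; linarith)
  have h3 : g q ≤ P q := (le_max_left _ _).trans (hPmax s hsP hsh q)
  constructor <;> linarith

end

noncomputable section

/-! ### The Monge–Ampère measure of the envelope -/

theorem IsMixedMA.measure_ball_eq_zero {n : ℕ} (hn : 0 < n) {Ω : Set (Hn n)} (hΩ : IsOpen Ω)
    {f g : Hn n → ℝ} (hg : UniformContinuous g) (hgP : QPSHr g Ω) (hgf : ∀ q, g q ≤ f q)
    (hmax : ∀ v, QPSHr v Ω → (∀ q ∈ Ω, v q ≤ f q) → ∀ q ∈ Ω, v q ≤ g q)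
    {M : ℝ} (hM : ∀ q, |g q| ≤ M) {a : Hn n} {R : ℝ} (hR : 0 < R)
    (hball : Metric.closedBall a (3 * R) ⊆ Ω) (hf : ∀ q ∈ Metric.closedBall a R, f q = 0)
    {μ : Measure (Hn n)} (hμ : IsMixedMA Ω (fun _ => g) μ) : μ (Metric.ball a (R / 3)) = 0 := by
  have hδ : ∀ j : ℕ, (0 : ℝ) < (1 / 2) ^ j := fun j => by positivity
  choose F hFs hFP hFg hFm using fun j : ℕ =>
    exists_smooth_approx hn hΩ hg hgP hgf hmax hM hR hball hf (hδ j)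
  set U := Metric.ball a (R / 2) with hU
  have hcl : closure U ⊆ Metric.closedBall a (R / 2) := Metric.closure_ball_subset_closedBall
  have hclΩ : closure U ⊆ Ω :=
    hcl.trans ((Metric.closedBall_subset_closedBall (by linarith)).trans hball)
  have hclK : IsCompact (closure U) :=
    (isCompact_closedBall a (R / 2)).of_isClosed_subset isClosed_closure hcl
  have hpow : Tendsto (fun j : ℕ => (1 / 2 : ℝ) ^ j) atTop (𝓝 0) :=
    tendsto_pow_atTop_nhds_zero_of_lt_one (by norm_num) (by norm_num)
  have hweak := hμ.1 U Metric.isOpen_ball hclK hclΩ (fun _ j => F j)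
    (fun _ j => ⟨hFs j, (hFP j).mono (Set.subset_univ _)⟩)
    (fun _ q hq => antitone_nat_of_succ_le fun j => by
      have h1 := (hFg (j + 1) q hq).2
      have h2 := (hFg j q hq).1
      rw [pow_succ] at h1
      have := hδ j
      linarith)
    (fun _ q hq => tendsto_of_tendsto_of_tendsto_of_le_of_le
      (by simpa using (hpow.const_mul 3).const_add (g q))
      (by simpa using (hpow.const_mul 5).const_add (g q))
      (fun j => (hFg j q hq).1) (fun j => (hFg j q hq).2))
  let χ : Hn n → ℝ := fun q => max 0 (R / 3 - ‖q - a‖)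
  have hχ : Continuous χ := by fun_prop
  have hχ0 : ∀ q, 0 ≤ χ q := fun q => le_max_left _ _
  have hχ1 : ∀ q, ‖χ q‖ ≤ R / 3 := fun q => by
    rw [Real.norm_of_nonneg (hχ0 q)]
    have := norm_nonneg (q - a)
    exact max_le (by positivity) (by linarith)
  have hsupp : tsupport χ ⊆ Metric.closedBall a (R / 3) := by
    refine closure_minimal (fun q hq => ?_) Metric.isClosed_closedBall
    by_contra h
    rw [mem_closedBall_iff_norm, not_le] at h
    exact hq (max_eq_left (by linarith))
  have hlim := hweak χ hχ (HasCompactSupport.of_support_subset_isCompact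
    (isCompact_closedBall a (R / 3)) ((subset_tsupport χ).trans hsupp))
    (hsupp.trans (Metric.closedBall_subset_ball (by linarith)))
  have hlim0 : Tendsto (fun j => ∫ q, χ q ∂(smoothMA (fun _ : Fin n => F j) U)) atTop (𝓝 0) := by
    refine squeeze_zero_norm (a := fun j : ℕ => R / 3 * (1 / 2) ^ j) (fun j => ?_)
      (by simpa using hpow.const_mul (R / 3))
    have hm : smoothMA (fun _ : Fin n => F j) U Set.univ ≤ ENNReal.ofReal ((1 / 2) ^ j) := by
      rw [smoothMA, withDensity_apply _ MeasurableSet.univ, Measure.restrict_univ]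
      exact hFm j
    have : IsFiniteMeasure (smoothMA (fun _ : Fin n => F j) U) :=
      ⟨hm.trans_lt ENNReal.ofReal_lt_top⟩
    refine (norm_integral_le_of_norm_le_const (Eventually.of_forall hχ1)).trans ?_
    exact mul_le_mul_of_nonneg_left (ENNReal.toReal_le_of_le_ofReal (hδ j).le hm) (by positivity)
  have h0 := tendsto_nhds_unique hlim hlim0
  have hfin : IsFiniteMeasure (μ.restrict U) := ⟨by
    rw [Measure.restrict_apply_univ]
    exact (measure_mono subset_closure).trans_lt (hμ.2.2 _ hclK hclΩ)⟩
  have hχi : Integrable χ (μ.restrict U) :=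
    Integrable.of_bound hχ.aestronglyMeasurable (R / 3) (Eventually.of_forall hχ1)
  rw [integral_eq_zero_iff_of_nonneg hχ0 hχi] at h0
  have h1 : μ.restrict U (Metric.ball a (R / 3)) = 0 := by
    refine measure_mono_null (fun q hq => ?_) h0
    rw [mem_ball_iff_norm] at hq
    change ¬ (χ q = 0)
    exact (lt_max_of_lt_right (by linarith)).ne'
  rwa [Measure.restrict_apply Metric.isOpen_ball.measurableSet,
    Set.inter_eq_left.2 (Metric.ball_subset_ball (by linarith))] at h1

theorem MAn_envelope_eq_zero {n : ℕ} (hn : 0 < n) {Ω : Set (Hn n)} (hΩ : IsOpen Ω)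
    {f g : Hn n → ℝ} (hg : UniformContinuous g) (hgP : QPSHr g Ω) (hgf : ∀ q, g q ≤ f q)
    (hmax : ∀ v, QPSHr v Ω → (∀ q ∈ Ω, v q ≤ f q) → ∀ q ∈ Ω, v q ≤ g q)
    {M : ℝ} (hM : ∀ q, |g q| ≤ M) {K : Set (Hn n)} (hK : IsCompact K) (hfK : ∀ q ∉ K, f q = 0) :
    MAn Ω g (Ω \ K) = 0 := by
  rw [MAn, MAmix]
  split_ifs with h
  · refine measure_null_of_locally_null _ fun a ha => ?_
    obtain ⟨ε, hε, hsub⟩ := Metric.isOpen_iff.1 (hΩ.sdiff hK.isClosed) a ha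
    have hsub' : Metric.closedBall a (3 * (ε / 4)) ⊆ Ω \ K :=
      (Metric.closedBall_subset_ball (by linarith)).trans hsub
    refine ⟨Metric.ball a (ε / 4 / 3),
      mem_nhdsWithin_of_mem_nhds (Metric.ball_mem_nhds a (by positivity)), ?_⟩
    exact h.choose_spec.measure_ball_eq_zero hn hΩ hg hgP hgf hmax hM (by positivity)
      (hsub'.trans Set.sdiff_subset) fun q hq => hfK q
        (hsub' (Metric.closedBall_subset_closedBall (by linarith) hq)).2
  · rfl

end

noncomputable section

theorem approximation_in_E0_of_pos {n : ℕ} (hn : 0 < n) (Ω : Set (Hn n)) (hΩ : QHyperconvex Ω)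
    (φ : Hn n → EReal) (hφ : QPSH φ Ω) (hφneg : ∀ q ∈ Ω, φ q ≤ 0) :
    ∃ g : ℕ → Hn n → ℝ,
      (∀ j, QPSHr (g j) Ω) ∧
      (∀ q ∈ Ω, Antitone fun j => g j q) ∧
      (∀ j, ContinuousOn (g j) (closure Ω)) ∧
      (∀ j, ∀ ζ ∈ frontier Ω, g j ζ = 0) ∧
      (∀ j, ∃ K : Set (Hn n), IsCompact K ∧ K ⊆ Ω ∧ MAn Ω (g j) (Ω \ K) = 0) ∧
      (∀ q ∈ Ω, Tendsto (fun j => ((g j q : ℝ) : EReal)) atTop (𝓝 (φ q))) := by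
  obtain ⟨f, hf, hf0, hfK, hfm, hfφ, hfl⟩ :=
    exists_continuous_antitone hn hΩ.1 hΩ.2.1 hΩ.2.2.1.nonempty hφ.1 hφneg
  choose K hK hKΩ hK0 using hfK
  choose g hg hgP hg0 hgf hgmax using fun j =>
    exists_envelope hΩ (hf j) (hf0 j) (hK j) (hKΩ j) (hK0 j)
  have hfb : ∀ j, ∃ m : ℝ, ∀ q, m ≤ f j q := fun j => by
    obtain ⟨m, hm⟩ := ((hK j).image (hf j)).bddBelow
    refine ⟨min m 0, fun q => ?_⟩
    by_cases hq : q ∈ K j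
    · exact (min_le_left _ _).trans (hm (Set.mem_image_of_mem _ hq))
    · rw [hK0 j q hq]; exact min_le_right _ _
  have hgb : ∀ j, ∃ M : ℝ, ∀ q, |g j q| ≤ M := fun j => by
    obtain ⟨m, hm⟩ := hfb j
    refine ⟨|m|, fun q => ?_⟩
    have h1 : g j q ≤ 0 := (hgf j q).trans (hf0 j q)
    have h2 : m ≤ 0 := (hm q).trans (hf0 j q)
    rw [abs_of_nonpos h1, abs_of_nonpos h2, neg_le_neg_iff]
    by_cases hq : q ∈ Ω
    · exact hgmax j _ (qpshr_const m Ω) (fun p _ => hm p) q hq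
    · rwa [hg0 j q hq]
  choose M hM using hgb
  have hφg : ∀ j, ∀ q ∈ Ω, φ q ≤ g j q := by
    intro j q hq
    obtain ⟨m, hm⟩ := hfb j
    have h1 := hgmax j _ (hφ.truncate hφneg m) (fun p hp => by
      rw [← EReal.coe_le_coe_iff, coe_toReal_max (hφneg p hp)]
      exact max_le (hfφ j p hp) (EReal.coe_le_coe_iff.2 (hm p))) q hq
    rw [← EReal.coe_le_coe_iff, coe_toReal_max (hφneg q hq)] at h1
    exact (le_max_left _ _).trans h1
  refine ⟨g, hgP, fun q hq => antitone_nat_of_succ_le fun j => ?_,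
    fun j => (hg j).continuous.continuousOn, fun j ζ hζ => hg0 j ζ fun h => ?_,
    fun j => ⟨K j, hK j, hKΩ j, ?_⟩, fun q hq => ?_⟩
  · exact hgmax j _ (hgP (j + 1)) (fun p _ => (hgf _ p).trans (hfm p (Nat.le_succ j))) q hq
  · rw [hΩ.1.frontier_eq] at hζ
    exact hζ.2 h
  · exact MAn_envelope_eq_zero hn hΩ.1 (hg j) (hgP j) (hgf j) (hgmax j) (hM j) (hK j) (hK0 j)
  · refine tendsto_order.2 ⟨fun b hb => Eventually.of_forall fun j => hb.trans_le (hφg j q hq),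
      fun b hb => ?_⟩
    obtain ⟨t, ht1, ht2⟩ := EReal.lt_iff_exists_real_btwn.1 hb
    filter_upwards [hfl q hq t ht1] with j hj
    exact lt_of_le_of_lt (EReal.coe_le_coe_iff.2 ((hgf j q).trans hj)) ht2

/-- **Theorem 3.1 (global approximation).**  For every negative plurisubharmonic `φ` on a
quaternionic hyperconvex domain `Ω` there is a decreasing sequence `gⱼ` of plurisubharmonic
functions, continuous on `closure Ω`, vanishing on `∂Ω`, whose Monge–Ampère measures have
compact support in `Ω`, converging pointwise to `φ` on `Ω`. -/
theorem approximation_in_E0 {n : ℕ} (Ω : Set (Hn n)) (hΩ : QHyperconvex Ω)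
    (φ : Hn n → EReal) (hφ : QPSH φ Ω) (hφneg : ∀ q ∈ Ω, φ q ≤ 0) :
    ∃ g : ℕ → Hn n → ℝ,
      (∀ j, QPSHr (g j) Ω) ∧
      (∀ q ∈ Ω, Antitone fun j => g j q) ∧
      (∀ j, ContinuousOn (g j) (closure Ω)) ∧
      (∀ j, ∀ ζ ∈ frontier Ω, g j ζ = 0) ∧
      (∀ j, ∃ K : Set (Hn n), IsCompact K ∧ K ⊆ Ω ∧ MAn Ω (g j) (Ω \ K) = 0) ∧
      (∀ q ∈ Ω, Tendsto (fun j => ((g j q : ℝ) : EReal)) atTop (𝓝 (φ q))) := by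
  rcases Nat.eq_zero_or_pos n with rfl | hn
  · have hu : Ω = Set.univ := Subsingleton.eq_univ_of_nonempty hΩ.2.2.1.nonempty
    subst hu
    refine ⟨fun j q => (max (φ q) ((-(j : ℝ) : ℝ) : EReal)).toReal,
      fun j => hφ.truncate hφneg _, fun q hq i j hij => ?_, fun j => ?_, by simp,
      fun j => ⟨Set.univ, Set.subsingleton_univ.finite.isCompact, subset_rfl, by simp⟩,
      fun q hq => ?_⟩
    · simp only
      rw [← EReal.coe_le_coe_iff, coe_toReal_max (hφneg q hq), coe_toReal_max (hφneg q hq)]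
      refine max_le_max le_rfl (EReal.coe_le_coe_iff.2 ?_)
      simpa using hij
    · exact (continuous_of_const fun x y => by rw [Subsingleton.elim x y]).continuousOn
    · simp only [coe_toReal_max (hφneg q hq)]
      refine tendsto_order.2 ⟨fun b hb => Eventually.of_forall fun j =>
        hb.trans_le (le_max_left _ _), fun b hb => ?_⟩
      obtain ⟨t, ht1, ht2⟩ := EReal.lt_iff_exists_real_btwn.1 hb
      filter_upwards [tendsto_natCast_atTop_atTop.eventually_ge_atTop (-t)] with j hj
      refine lt_of_le_of_lt (max_le ht1.le (EReal.coe_le_coe_iff.2 ?_)) ht2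
      linarith
  · exact approximation_in_E0_of_pos hn Ω hΩ φ hφ hφneg

end
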